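/- Every finite 2-edge-connected cubic (3-regular) simple graph G has circular chromatic index at most 11/3; equivalently, its line graph L(G) admits an (11,3)-coloring. -/

import Mathlib

open SimpleGraph

/-- A `(p,q)`-coloring of a simple graph `H`: a function into `{0,...,p-1}` such that
adjacent vertices `x, y` satisfy `q ≤ |f x - f y| ≤ p - q`. -/
def IsPQColoring {V : Type*} (H : SimpleGraph V) (p q : ℕ) (f : V → ℕ) : Prop :=
  (∀ v, f v < p) ∧
    ∀ x y, H.Adj x y → (q : ℤ) ≤ |(f x : ℤ) - (f y : ℤ)| ∧ |(f x : ℤ) - (f y : ℤ)| ≤ (p : ℤ) - q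


/-- A graph is 2-edge-connected if it is connected, has at least two vertices,
and has no bridge (cut edge). -/
def TwoEdgeConnected {V : Type*} [Fintype V] (G : SimpleGraph V) : Prop :=
  G.Connected ∧ 2 ≤ Fintype.card V ∧ ∀ e, ¬ G.IsBridge e

open Equiv

structure CSys (V : Type*) where
  σ : Perm V
  μ : V → V
  μμ : ∀ v, μ (μ v) = v
  μne : ∀ v, μ v ≠ v
  μσ : ∀ v, μ v ≠ σ v
  tr : ∀ A : Set V, A.Nonempty → (∀ v ∈ A, σ v ∈ A) → (∀ v ∈ A, μ v ∈ A) → ∀ v, v ∈ A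

namespace CSys
open Classical

variable {V : Type*}  (S : CSys V)

/-- same orbit -/
def SC (a b : V) : Prop := S.σ.SameCycle a b


theorem SC.symm {S : CSys V} {a b : V} (h : S.SC a b) : S.SC b a := Perm.SameCycle.symm h

theorem SC.trans {S : CSys V} {a b c : V} (h : S.SC a b) (h' : S.SC b c) : S.SC a c :=
  Perm.SameCycle.trans h h'

theorem SC.rfl {S : CSys V} {a : V} : S.SC a a := Perm.SameCycle.refl _ _

/-- a direction -/
def Dir (d : Perm V) : Prop := d = S.σ ∨ d = S.σ⁻¹


theorem Dir.sc {S : CSys V} {d : Perm V} (h : S.Dir d) (a : V) : S.SC a (d a) := by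
  rcases h with rfl | rfl
  · exact ⟨1, by simp⟩
  · exact ⟨-1, by simp⟩

theorem Dir.inv {S : CSys V} {d : Perm V} (h : S.Dir d) : S.Dir d⁻¹ := by
  rcases h with rfl | rfl
  · exact Or.inr rfl
  · exact Or.inl (by simp)


theorem Dir.mu_ne {S : CSys V} {d : Perm V} (h : S.Dir d) (a : V) : S.μ a ≠ d a := by
  rcases h with rfl | rfl
  · exact S.μσ a
  · intro h
    apply S.μσ (S.σ⁻¹ a)
    rw [← h, S.μμ]
    rw [h]; simp

def Good (x : V → SignType) (w : V) : Prop :=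
  ∃ s : SignType, s ≠ 0 ∧ ∃ d, S.Dir d ∧ x w = s ∧ x (d w) = s ∧ x (d (d w)) ≠ s ∧ x (d (d (d w))) ≠ s

def Sol (Z : Finset V) (L : V → Finset SignType) (x : V → SignType) : Prop :=
  (∀ v ∈ Z, S.μ v ∉ Z → x v ∈ L v) ∧ (∀ v ∈ Z, S.μ v ∈ Z → x (S.μ v) = x v) ∧
  (∀ v ∈ Z, ∃ w, S.SC v w ∧ S.Good x w)

def step (Z : Finset V) (a b : V) : Prop := a ∈ Z ∧ b ∈ Z ∧ (S.SC a b ∨ b = S.μ a)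

def Conn (Z : Finset V) : V → V → Prop := Relation.ReflTransGen (S.step Z)


theorem step_symm {Z : Finset V} {a b : V} (h : S.step Z a b) : S.step Z b a := by
  obtain ⟨h1, h2, h3⟩ := h
  refine ⟨h2, h1, ?_⟩
  rcases h3 with h3 | h3
  · exact Or.inl h3.symm
  · right; rw [h3, S.μμ]

variable {S}

theorem Conn.symm {Z : Finset V} {a b : V} (h : S.Conn Z a b) : S.Conn Z b a := by
  induction h with
  | refl => exact .refl
  | tail _ h2 ih => exact .head (S.step_symm h2) ih

theorem Conn.trans {Z : Finset V} {a b c : V} (h : S.Conn Z a b) (h' : S.Conn Z b c) :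
    S.Conn Z a c := Relation.ReflTransGen.trans h h'

theorem Conn.rfl {Z : Finset V} {a : V} : S.Conn Z a a := .refl

theorem Conn.mem {Z : Finset V} {a b : V} (h : S.Conn Z a b) (ha : a ∈ Z) : b ∈ Z := by
  induction h with
  | refl => exact ha
  | tail _ h2 ih => exact h2.2.1

theorem Conn.of_sc {Z : Finset V} {a b : V} (ha : a ∈ Z) (hb : b ∈ Z) (h : S.SC a b) :
    S.Conn Z a b := .single ⟨ha, hb, Or.inl h⟩

theorem Conn.of_mu {Z : Finset V} {a : V} (ha : a ∈ Z) (hb : S.μ a ∈ Z) :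
    S.Conn Z a (S.μ a) := .single ⟨ha, hb, Or.inr _root_.rfl⟩

theorem Conn.mono {Z Z' : Finset V} (hz : Z ⊆ Z') {a b : V} (h : S.Conn Z a b) :
    S.Conn Z' a b := by
  induction h with
  | refl => exact .refl
  | tail _ h2 ih => exact .tail ih ⟨hz h2.1, hz h2.2.1, h2.2.2⟩
variable (S)

/-- pentagon orbit without chords -/
def Pent (a : V) : Prop :=
  S.σ (S.σ (S.σ (S.σ (S.σ a)))) = a ∧ S.σ a ≠ a ∧ ∀ b, S.SC a b → ¬ S.SC b (S.μ b)

/-- a long orbit -/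
def Long (a : V) : Prop := ∀ d, S.Dir d → ∀ b, S.SC a b →
  [b, d b, d (d b), d (d (d b)), d⁻¹ b, d⁻¹ (d⁻¹ b)].Nodup

structure Zok (Z : Finset V) : Prop where
  cl : ∀ a b, S.SC a b → a ∈ Z → b ∈ Z
  good : ∀ a ∈ Z, S.Pent a ∨ S.Long a
  odd : ∀ a ∈ Z, ∃ n : ℕ, Odd n ∧ (S.σ ^ n) a = a

noncomputable def comp (W : Finset V) (a : V) : Finset V := W.filter (S.Conn W a)

variable {S}

theorem mem_comp {W : Finset V} {a b : V} : b ∈ S.comp W a ↔ b ∈ W ∧ S.Conn W a b := by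
  simp [comp]

theorem comp_sub {W : Finset V} {a : V} : S.comp W a ⊆ W := Finset.filter_subset _ _


theorem Zok.comp {W : Finset V} (h : S.Zok W) (a : V) : S.Zok (S.comp W a) where
  cl b c hbc hb := by
    rw [mem_comp] at hb ⊢
    exact ⟨h.cl _ _ hbc hb.1, hb.2.trans (.of_sc hb.1 (h.cl _ _ hbc hb.1) hbc)⟩
  good b hb := h.good b (comp_sub hb)
  odd b hb := h.odd b (comp_sub hb)


theorem mu_mem_comp {W : Finset V} {a b : V} (hb : b ∈ S.comp W a) :
    S.μ b ∈ S.comp W a ↔ S.μ b ∈ W := by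
  rw [mem_comp] at *
  exact ⟨fun h => h.1, fun h => ⟨h, hb.2.trans (.of_mu hb.1 h)⟩⟩


theorem conn_comp {W : Finset V} {a b : V} (h : S.Conn W a b) :
    S.Conn (S.comp W a) a b := by
  induction h with
  | refl => exact .refl
  | tail h1 h2 ih =>
    refine ih.trans (.single ⟨mem_comp.2 ⟨h2.1, h1⟩, mem_comp.2 ⟨h2.2.1, h1.tail h2⟩, h2.2.2⟩)

variable (S)
/-- connected nonempty -/
def Cn (Z : Finset V) : Prop := ∃ a ∈ Z, ∀ b ∈ Z, S.Conn Z a b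
variable {S}


theorem cn_comp {W : Finset V} {a : V} (ha : a ∈ W) : S.Cn (S.comp W a) :=
  ⟨a, mem_comp.2 ⟨ha, .rfl⟩, fun _ hb => conn_comp (mem_comp.1 hb).2⟩


theorem Cn.conn {Z : Finset V} (h : S.Cn Z) {a b : V} (ha : a ∈ Z) (hb : b ∈ Z) : S.Conn Z a b := by
  obtain ⟨c, hc, h⟩ := h
  exact (h a ha).symm.trans (h b hb)

/-- gluing -/
theorem glue {W : Finset V} (hW : S.Zok W) {L : V → Finset SignType}
    (h : ∀ a ∈ W, ∃ x, S.Sol (S.comp W a) L x) : ∃ x, S.Sol W L x := by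
  let st : Setoid V := ⟨S.Conn W, fun _ => .rfl, fun h => h.symm, fun h h' => h.trans h'⟩
  let r : V → V := fun a => (Quotient.mk st a).out
  have hr : ∀ a, S.Conn W (r a) a := fun a => Quotient.exact (Quotient.out_eq (Quotient.mk st a))
  have hr2 : ∀ a b, S.Conn W a b → r a = r b := fun a b hab => by
    have : Quotient.mk st a = Quotient.mk st b := Quotient.sound hab
    simp only [r, this]
  have h' : ∀ a, ∃ x, a ∈ W → S.Sol (S.comp W a) L x := fun a => by
    by_cases ha : a ∈ W
    · obtain ⟨x, hx⟩ := h a ha; exact ⟨x, fun _ => hx⟩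
    · exact ⟨fun _ => 0, fun h => absurd h ha⟩
  choose y hy using h'
  have key : ∀ a ∈ W, S.Sol (S.comp W (r a)) L (y (r a)) ∧ a ∈ S.comp W (r a) := fun a ha =>
    ⟨hy _ ((hr a).symm.mem ha), mem_comp.2 ⟨ha, hr a⟩⟩
  refine ⟨fun a => y (r a) a, ?_, ?_, ?_⟩
  · intro v hv hm
    obtain ⟨k1, k2⟩ := key v hv
    exact k1.1 v k2 (fun hh => hm (comp_sub hh))
  · intro v hv hm
    obtain ⟨k1, k2⟩ := key v hv
    have := hr2 _ _ (Conn.of_mu hv hm)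
    show y (r (S.μ v)) (S.μ v) = y (r v) v
    rw [← this]
    exact k1.2.1 v k2 ((mu_mem_comp k2).2 hm)
  · intro v hv
    obtain ⟨k1, k2⟩ := key v hv
    obtain ⟨w, hw, s, hs, d, hd, g⟩ := k1.2.2 v k2
    have e : ∀ u, S.SC v u → r u = r v := fun u hu => 
      (hr2 _ _ (Conn.of_sc hv (hW.cl _ _ hu hv) hu)).symm
    have e1 := e w hw
    have e2 := e _ (hw.trans (hd.sc w))
    have e3 := e _ ((hw.trans (hd.sc w)).trans (hd.sc _))
    have e4 := e _ (((hw.trans (hd.sc w)).trans (hd.sc _)).trans (hd.sc _))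
    refine ⟨w, hw, s, hs, d, hd, ?_⟩
    simp only [e1, e2, e3, e4]
    exact g

variable (S)
def MCA (K : Finset V) : Prop := ∀ L : V → Finset SignType,
  (∀ p ∈ K, S.μ p ∉ K → 2 ≤ (L p).card) → ∃ x, S.Sol K L x
def MCB (K : Finset V) : Prop := ∀ (L : V → Finset SignType) (p : V) (s : SignType),
  p ∈ K → S.μ p ∉ K → s ≠ 0 → s ∈ L p → (∀ q ∈ K, S.μ q ∉ K → q ≠ p → 2 ≤ (L q).card) →
  ((∃ q ∈ K, S.μ q ∉ K ∧ q ≠ p ∧ 1 ∈ L q ∧ -1 ∈ L q) ∨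
   (∀ q ∈ K, S.μ q ∉ K → q ≠ p → 0 ∈ L q ∧ -s ∈ L q) ∨
   (∀ q ∈ K, S.μ q ∉ K → q ≠ p → 0 ∈ L q ∧ s ∈ L q)) → ∃ x, S.Sol K L x
def H5 (K : Finset V) : Prop := ∀ (L : V → Finset SignType) (p q : V),
  p ∈ K → S.μ p ∉ K → q ∈ K → S.μ q ∉ K → p ≠ q →
  (∀ u ∈ K, S.μ u ∉ K → u ≠ p → u ≠ q → 2 ≤ (L u).card) → 
  ∃ x, S.Sol K (fun u => if u = p ∨ u = q then Finset.univ else L u) x ∧ x q ≠ 0 ∧ x p ≠ x q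
def MC (K : Finset V) : Prop := S.Zok K → S.Cn K → (∃ a, a ∉ K) → S.MCA K ∧ S.MCB K ∧ S.H5 K
variable {S}


theorem Sol.mono {K : Finset V} {L L' : V → Finset SignType} {x} (h : S.Sol K L x)
    (hl : ∀ v ∈ K, S.μ v ∉ K → x v ∈ L v → x v ∈ L' v) : S.Sol K L' x :=
  ⟨fun v hv hm => hl v hv hm (h.1 v hv hm), h.2⟩

/-- rest after removing an orbit -/
noncomputable def rest (S : CSys V) (Z : Finset V) (v0 : V) : Finset V :=
  Z.filter (fun u => ¬ S.SC v0 u)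


theorem mem_rest {Z : Finset V} {v u : V} : u ∈ S.rest Z v ↔ u ∈ Z ∧ ¬ S.SC v u := by
  simp [rest]


theorem Zok.rest {Z : Finset V} (h : S.Zok Z) (v : V) : S.Zok (S.rest Z v) where
  cl b c hbc hb := by
    rw [mem_rest] at hb ⊢
    exact ⟨h.cl _ _ hbc hb.1, fun h' => hb.2 (h'.trans hbc.symm)⟩
  good b hb := h.good b (mem_rest.1 hb).1
  odd b hb := h.odd b (mem_rest.1 hb).1


theorem rest_lt {Z : Finset V} {v : V} (hv : v ∈ Z) : (S.rest Z v).card < Z.card := by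
  apply Finset.card_lt_card
  refine (Finset.ssubset_iff_of_subset (Finset.filter_subset _ _)).2 ?_
  exact ⟨v, hv, fun h => (mem_rest.1 h).2 .rfl⟩

def FOK (S : CSys V) (Z : Finset V) (L : V → Finset SignType) (v0 : V) (F : List V) (s : SignType) (v : V) : Prop :=
  (S.μ v ∉ Z ∧ s ∈ L v) ∨ (S.SC v (S.μ v) ∧ S.μ v ∉ F) ∨
  (S.μ v ∈ S.rest Z v0 ∧
    ((∃ v', S.SC v0 v' ∧ v' ∉ F ∧ S.μ v' ∈ S.rest Z v0 ∧ S.Conn (S.rest Z v0) (S.μ v) (S.μ v')) ∨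
     (∃ q ∈ S.rest Z v0, S.μ q ∉ Z ∧ S.Conn (S.rest Z v0) (S.μ v) q ∧ 1 ∈ L q ∧ -1 ∈ L q) ∨
     (∀ q ∈ S.rest Z v0, S.μ q ∉ Z → S.Conn (S.rest Z v0) (S.μ v) q → 0 ∈ L q ∧ -s ∈ L q)))

end CSys

open Equiv
namespace CSys
open Classical
variable {V : Type*} {S : CSys V}

theorem card_two_sdiff (s : SignType) : 2 ≤ (Finset.univ \ {s} : Finset SignType).card := by
  cases s <;> decide

set_option maxHeartbeats 2000000 in
theorem fire {Z : Finset V} (hZ : S.Zok Z) (IH : ∀ K : Finset V, K.card < Z.card → S.MC K)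
    (L : V → Finset SignType) {v0 : V} (hv0 : v0 ∈ Z)
    (hcard : ∀ q ∈ Z, ¬ S.SC v0 q → S.μ q ∉ Z → 2 ≤ (L q).card)
    (hne : ∀ q ∈ Z, S.SC v0 q → S.μ q ∉ Z → (L q).Nonempty)
    {d : Perm V} (hd : S.Dir d) {w : V} (hw : S.SC v0 w)
    (hnd : [w, d w, d (d w), d (d (d w))].Nodup) {s : SignType} (hs : s ≠ 0)
    (h1 : S.FOK Z L v0 [w, d w, d (d w), d (d (d w))] s w)
    (h2 : S.FOK Z L v0 [w, d w, d (d w), d (d (d w))] s (d w))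
    (nc : S.μ w ∈ S.rest Z v0 → S.μ (d w) ∈ S.rest Z v0 → ¬ S.Conn (S.rest Z v0) (S.μ w) (S.μ (d w)))
    (hg1 : S.μ (d (d w)) ∉ Z → ∃ a ∈ L (d (d w)), a ≠ s)
    (hg2 : S.μ (d (d (d w))) ∉ Z → ∃ a ∈ L (d (d (d w))), a ≠ s) :
    ∃ x, S.Sol Z L x := by
  set W := S.rest Z v0 with hW
  have scw1 : S.SC v0 (d w) := hw.trans (hd.sc w)
  have scw2 : S.SC v0 (d (d w)) := scw1.trans (hd.sc _)
  have scw3 : S.SC v0 (d (d (d w))) := scw2.trans (hd.sc _)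
  generalize hF : [w, d w, d (d w), d (d (d w))] = F at h1 h2
  generalize hw1 : d w = w1 at *
  generalize hw2 : d w1 = w2 at *
  generalize hw3 : d w2 = w3 at *
  have hmemF : ∀ v, v ∈ F ↔ v = w ∨ v = w1 ∨ v = w2 ∨ v = w3 := fun v => by simp [← hF]
  simp only [List.nodup_cons, List.mem_cons, List.not_mem_nil, or_false, not_or] at hnd
  obtain ⟨⟨n01, n02, n03⟩, ⟨n12, n13⟩, n23, -⟩ := hnd
  have hf : ∀ v, v = w ∨ v = w1 → S.FOK Z L v0 F s v := by
    rintro v (rfl | rfl) <;> assumption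
  have scf : ∀ v, v = w ∨ v = w1 → S.SC v0 v := by
    rintro v (rfl | rfl) <;> assumption
  have hfW : ∀ v, v = w ∨ v = w1 → S.μ v ∈ W →
    ((∃ v', S.SC v0 v' ∧ v' ∉ F ∧ S.μ v' ∈ S.rest Z v0 ∧ S.Conn (S.rest Z v0) (S.μ v) (S.μ v')) ∨
     (∃ q ∈ S.rest Z v0, S.μ q ∉ Z ∧ S.Conn (S.rest Z v0) (S.μ v) q ∧ 1 ∈ L q ∧ -1 ∈ L q) ∨
     (∀ q ∈ S.rest Z v0, S.μ q ∉ Z → S.Conn (S.rest Z v0) (S.μ v) q → 0 ∈ L q ∧ -s ∈ L q)) := by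
    intro v hv hm
    rcases hf v hv with h | h | h
    · exact absurd (mem_rest.1 hm).1 h.1
    · exact absurd ((scf v hv).trans h.1) (mem_rest.1 hm).2
    · exact h.2
  let box : V → Finset SignType := fun v => if v = w ∨ v = w1 then {s} else
    (if S.μ v ∈ Z then Finset.univ else L v) \ (if v = w2 ∨ v = w3 then {s} else ∅)
  let L' : V → Finset SignType := fun u => if S.μ u ∈ Z then box (S.μ u) else L u
  have boxf : ∀ v, v = w ∨ v = w1 → box v = {s} := fun v hv => by simp [box, hv]
  have boxg : ∀ v, v = w2 ∨ v = w3 → s ∉ box v := fun v hv => by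
    have : ¬ (v = w ∨ v = w1) := by
      rintro (h | h) <;> rcases hv with h' | h' <;> subst h <;> subst h' <;> contradiction
    simp [box, hv, this]
  have boxn : ∀ v, ¬ (v = w ∨ v = w1) → S.μ v ∈ Z → Finset.univ \ {s} ⊆ box v := fun v hv hm => by
    simp only [box, hv, hm, if_true, if_false]
    apply Finset.sdiff_subset_sdiff le_rfl
    split_ifs <;> simp
  have key : ∃ y, S.Sol W L' y := by
    apply glue (hZ.rest v0)
    intro a ha
    set K := S.comp W a with hK
    have hKc : K.card < Z.card := (Finset.card_le_card comp_sub).trans_lt (rest_lt hv0)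
    obtain ⟨mca, mcb, -⟩ := IH K hKc ((hZ.rest v0).comp a) (cn_comp ha)
      ⟨v0, fun h => (mem_rest.1 (comp_sub h)).2 .rfl⟩
    have hport : ∀ q ∈ K, S.μ q ∉ K → S.μ q ∉ Z ∨ (S.μ q ∈ Z ∧ S.SC v0 (S.μ q)) := fun q hq hm => by
      rw [hK, mu_mem_comp hq, hW, mem_rest] at hm
      tauto
    have hq2 : ∀ q ∈ K, S.μ q ∉ K → ¬ (S.μ q = w ∨ S.μ q = w1) → 2 ≤ (L' q).card := by
      intro q hq hm hn
      rcases hport q hq hm with h | h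
      · have := mem_rest.1 (comp_sub hq)
        simp only [L', h, if_false]
        exact hcard q this.1 this.2 h
      · simp only [L', h.1, if_true]
        refine (card_two_sdiff s).trans (Finset.card_le_card (boxn _ hn ?_))
        rw [S.μμ]; exact (mem_rest.1 (comp_sub hq)).1
    by_cases hex : ∃ v, (v = w ∨ v = w1) ∧ S.μ v ∈ K
    · obtain ⟨v, hv, hvK⟩ := hex
      have hvZ : v ∈ Z := hZ.cl _ _ (scf v hv) hv0
      have hmK : S.μ (S.μ v) ∉ K := by
        rw [S.μμ]; exact fun h => (mem_rest.1 (comp_sub h)).2 (scf v hv)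
      have huniq : ∀ q ∈ K, q ≠ S.μ v → ¬ (S.μ q = w ∨ S.μ q = w1) := by
        intro q hq hqv hqw
        have hvq : v ≠ S.μ q := fun h => hqv (by rw [h, S.μμ])
        have c1 : S.Conn W (S.μ v) q := (mem_comp.1 hvK).2.symm.trans (mem_comp.1 hq).2
        have hvW := comp_sub hvK
        have hqW := comp_sub hq
        rcases hv with rfl | rfl <;> rcases hqw with h | h
        · exact hvq h.symm
        · rw [← h, S.μμ] at nc; exact nc hvW hqW c1
        · rw [← h, S.μμ] at nc; exact nc hqW hvW c1.symm
        · exact hvq h.symm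
      apply mcb L' (S.μ v) s hvK hmK hs
      · simp only [L', S.μμ, hvZ, if_true, boxf v hv]; simp
      · intro q hq hm hqv
        exact hq2 q hq hm (huniq q hq hqv)
      rcases hfW v hv (comp_sub hvK) with ⟨v', a1, a2, a3, a4⟩ | ⟨q, a1, a2, a3, a4⟩ | h
      · left
        have hv'Z : v' ∈ Z := hZ.cl _ _ a1 hv0
        have : Finset.univ ⊆ box v' := by
          rw [hmemF] at a2
          have e1 : ¬ (v' = w ∨ v' = w1) := by tauto
          have e2 : ¬ (v' = w2 ∨ v' = w3) := by tauto
          simp [box, e1, e2, (mem_rest.1 a3).1]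
        refine ⟨S.μ v', mem_comp.2 ⟨a3, (mem_comp.1 hvK).2.trans a4⟩, ?_, ?_, ?_⟩
        · rw [S.μμ]; exact fun h => (mem_rest.1 (comp_sub h)).2 a1
        · intro h
          have : v' = v := by rw [← S.μμ v', h, S.μμ]
          subst this
          exact a2 ((hmemF _).2 (by tauto))
        · simp only [L', S.μμ, hv'Z, if_true]
          exact ⟨this (Finset.mem_univ _), this (Finset.mem_univ _)⟩
      · left
        refine ⟨q, mem_comp.2 ⟨a1, (mem_comp.1 hvK).2.trans a3⟩, ?_, ?_, ?_⟩
        · exact fun h => a2 (mem_rest.1 (comp_sub h)).1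
        · rintro rfl; rw [S.μμ] at a2; exact a2 hvZ
        · simp only [L', a2, if_false]; exact a4
      · right; left
        intro q hq hm hqv
        rcases hport q hq hm with h' | h'
        · simp only [L', h', if_false]
          exact h q (comp_sub hq) h' ((mem_comp.1 hvK).2.symm.trans (mem_comp.1 hq).2)
        · simp only [L', h'.1, if_true]
          have hb := boxn _ (huniq q hq hqv) (by rw [S.μμ]; exact (mem_rest.1 (comp_sub hq)).1)
          constructor <;> apply hb
          · simp; exact hs.symm
          · revert hs; cases s <;> decide
    · apply mca
      intro q hq hm
      apply hq2 q hq hm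
      intro h
      exact hex ⟨S.μ q, h, by rwa [S.μμ]⟩
  obtain ⟨y, hy1, hy2, hy3⟩ := key
  have boxne : ∀ v, v ∈ Z → S.SC v0 v → S.μ v ∉ Z → (box v).Nonempty := by
    intro v hvZ hv hm
    by_cases e1 : v = w ∨ v = w1
    · rw [boxf v e1]; simp
    by_cases e2 : v = w2 ∨ v = w3
    · have : ∃ a ∈ L v, a ≠ s := by
        rcases e2 with rfl | rfl
        · exact hg1 hm
        · exact hg2 hm
      obtain ⟨a, ha, has⟩ := this
      exact ⟨a, by simp [box, e1, e2, hm, ha, has]⟩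
    · have := hne v hvZ hv hm
      simpa [box, e1, e2, hm] using this
  have boxL : ∀ v, v ∈ Z → S.μ v ∉ Z → box v ⊆ L v := by
    intro v hvZ hm
    by_cases e1 : v = w ∨ v = w1
    · rw [boxf v e1, Finset.singleton_subset_iff]
      rcases hf v e1 with h | h | h
      · exact h.2
      · exact absurd (hZ.cl _ _ h.1 hvZ) hm
      · exact absurd (mem_rest.1 h.1).1 hm
    · simp only [box, e1, hm, if_false]
      exact Finset.sdiff_subset
  let x : V → SignType := fun v => if v ∈ W then y v else if S.μ v ∈ W then y (S.μ v) else
    if h : S.μ v ∉ Z ∧ (box v).Nonempty then h.2.choose else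
    if (v = w ∨ v = w1) ∨ (S.μ v = w ∨ S.μ v = w1) then s else 0
  have xW : ∀ v, v ∈ W → x v = y v := fun v hv => by simp only [x, hv, if_true]
  have hCW : ∀ v, S.SC v0 v → v ∉ W := fun v hv h => (mem_rest.1 h).2 hv
  have xB : ∀ v, S.SC v0 v → S.μ v ∈ W → x v = y (S.μ v) ∧ y (S.μ v) ∈ box v := fun v hv hm => by
    refine ⟨by simp only [x, hCW v hv, hm, if_true, if_false], ?_⟩
    have := hy1 (S.μ v) hm (by rw [S.μμ]; exact hCW v hv)
    simpa only [L', S.μμ, hZ.cl _ _ hv hv0, if_true] using this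
  have xP : ∀ v, S.SC v0 v → S.μ v ∉ Z → x v ∈ box v := fun v hv hm => by
    have hne := boxne v (hZ.cl _ _ hv hv0) hv hm
    have h2 : S.μ v ∉ W := fun h => hm (mem_rest.1 h).1
    have h3 : S.μ v ∉ Z ∧ (box v).Nonempty := ⟨hm, hne⟩
    have : x v = h3.2.choose := by
      simp only [x, hCW v hv, h2, if_false, dif_pos h3]
    rw [this]; exact h3.2.choose_spec
  have xC : ∀ v, S.SC v0 v → S.SC v0 (S.μ v) →
      x v = if (v = w ∨ v = w1) ∨ (S.μ v = w ∨ S.μ v = w1) then s else 0 := fun v hv hm => by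
    have : ¬ (S.μ v ∉ Z ∧ (box v).Nonempty) := fun h => h.1 (hZ.cl _ _ hm hv0)
    simp only [x, hCW v hv, hCW _ hm, if_false, dif_neg this]
  have tri : ∀ v, S.μ v ∉ Z ∨ S.SC v0 (S.μ v) ∨ S.μ v ∈ W := fun v => by
    rw [hW, mem_rest]; tauto
  have xf : ∀ v, v = w ∨ v = w1 → x v = s := by
    intro v hv
    rcases tri v with h | h | h
    · have := xP v (scf v hv) h
      rwa [boxf v hv, Finset.mem_singleton] at this
    · rw [xC v (scf v hv) h, if_pos (Or.inl hv)]
    · obtain ⟨e1, e2⟩ := xB v (scf v hv) h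
      rw [e1]
      rwa [boxf v hv, Finset.mem_singleton] at e2
  have xg : ∀ v, v = w2 ∨ v = w3 → x v ≠ s := by
    intro v hv
    have hsc : S.SC v0 v := by rcases hv with rfl | rfl <;> assumption
    have hbs := boxg v hv
    rcases tri v with h | h | h
    · have := xP v hsc h
      exact fun h => hbs (h ▸ this)
    · rw [xC v hsc h, if_neg]
      · exact hs.symm
      · rintro (h' | h')
        · rcases h' with h' | h' <;> rcases hv with h'' | h'' <;> subst h' <;> subst h'' <;> contradiction
        · rcases hf _ h' with hh | hh | hh
          · rw [S.μμ] at hh; exact hh.1 (hZ.cl _ _ hsc hv0)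
          · rw [S.μμ] at hh; exact hh.2 ((hmemF _).2 (by tauto))
          · rw [S.μμ] at hh; exact hCW _ hsc hh.1
    · obtain ⟨e1, e2⟩ := xB v hsc h
      rw [e1]
      exact fun h => hbs (h ▸ e2)
  refine ⟨x, ?_, ?_, ?_⟩
  · intro v hv hm
    by_cases hc : S.SC v0 v
    · exact boxL v hv hm (xP v hc hm)
    · have hvW : v ∈ W := mem_rest.2 ⟨hv, hc⟩
      rw [xW v hvW]
      have := hy1 v hvW (fun h => hm (mem_rest.1 h).1)
      simpa only [L', hm, if_false] using this
  · intro v hv hm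
    by_cases hc : S.SC v0 v <;> by_cases hc' : S.SC v0 (S.μ v)
    · rw [xC v hc hc', xC _ hc' (by rwa [S.μμ]), S.μμ]
      congr 1
      exact propext or_comm
    · have hmW : S.μ v ∈ W := mem_rest.2 ⟨hm, hc'⟩
      rw [xW _ hmW, (xB v hc hmW).1]
    · have hvW : v ∈ W := mem_rest.2 ⟨hv, hc⟩
      rw [xW _ hvW, (xB (S.μ v) hc' (by rwa [S.μμ])).1, S.μμ]
    · have hmW : S.μ v ∈ W := mem_rest.2 ⟨hm, hc'⟩
      have hvW : v ∈ W := mem_rest.2 ⟨hv, hc⟩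
      rw [xW _ hmW, xW _ hvW]
      exact hy2 v hvW hmW
  · intro v hv
    by_cases hc : S.SC v0 v
    · refine ⟨w, hc.symm.trans hw, s, hs, d, hd, xf w (Or.inl rfl), ?_, ?_, ?_⟩
      · rw [hw1]; exact xf _ (Or.inr rfl)
      · rw [hw1, hw2]; exact xg _ (Or.inl rfl)
      · rw [hw1, hw2, hw3]; exact xg _ (Or.inr rfl)
    · have hvW : v ∈ W := mem_rest.2 ⟨hv, hc⟩
      obtain ⟨w', hw', t, ht, d', hd', g⟩ := hy3 v hvW
      have e : ∀ u, S.SC v u → x u = y u := fun u hu => xW u ((hZ.rest v0).cl _ _ hu hvW)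
      refine ⟨w', hw', t, ht, d', hd', ?_⟩
      rw [e w' hw', e _ (hw'.trans (hd'.sc w')), e _ ((hw'.trans (hd'.sc w')).trans (hd'.sc _)),
        e _ (((hw'.trans (hd'.sc w')).trans (hd'.sc _)).trans (hd'.sc _))]
      exact g

end CSys

open Equiv
namespace CSys
open Classical
variable {V : Type*} {S : CSys V}

/-- no partner vertex -/
def NoPart (S : CSys V) (Z : Finset V) (v0 v : V) : Prop :=
  ∀ v', S.SC v0 v' → v' ≠ v → S.μ v' ∈ S.rest Z v0 → ¬ S.Conn (S.rest Z v0) (S.μ v) (S.μ v')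

structure Bridge (S : CSys V) (Z : Finset V) (v0 v : V) (K Z1 : Finset V) : Prop where
  zK : S.Zok K
  cK : S.Cn K
  z1 : S.Zok Z1
  c1 : S.Cn Z1
  lK : K.card < Z.card
  l1 : Z1.card < Z.card
  sK : K ⊆ Z
  s1 : Z1 ⊆ Z
  un : ∀ u ∈ Z, u ∈ K ∨ u ∈ Z1
  dj : ∀ u ∈ K, u ∉ Z1
  v1 : v ∈ Z1
  vK : S.μ v ∈ K
  pK : ∀ u ∈ K, S.μ u ∈ Z1 → u = S.μ v
  p1 : ∀ u ∈ Z1, S.μ u ∈ K → u = v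
  sc1 : ∀ u, S.SC v0 u → u ∈ Z1

theorem bridge_mk {Z : Finset V} (hZ : S.Zok Z) (hc : S.Cn Z) {v0 v : V} (hv0 : v0 ∈ Z)
    (hv : S.SC v0 v) (hm : S.μ v ∈ S.rest Z v0) (hn : S.NoPart Z v0 v) :
    S.Bridge Z v0 v (S.comp (S.rest Z v0) (S.μ v)) (Z \ S.comp (S.rest Z v0) (S.μ v)) := by
  set W := S.rest Z v0 with hW
  set K := S.comp W (S.μ v) with hK
  have hWZ : ∀ u, u ∈ W → u ∈ Z := fun u hu => (mem_rest.1 hu).1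
  have hKC : ∀ u, S.SC v0 u → u ∉ K := fun u hu h => (mem_rest.1 (comp_sub h)).2 hu
  have hvK : S.μ v ∈ K := mem_comp.2 ⟨hm, .rfl⟩
  have hvZ := hZ.cl _ _ hv hv0
  have hp1 : ∀ u ∈ Z \ K, S.μ u ∈ K → u = v := by
    intro u hu hmu
    rw [Finset.mem_sdiff] at hu
    have huW : u ∉ W := by
      intro h
      apply hu.2
      have := (mu_mem_comp (S := S) hmu).2 (by rwa [S.μμ])
      rwa [S.μμ] at this
    have hsc : S.SC v0 u := by
      by_contra h; exact huW (mem_rest.2 ⟨hu.1, h⟩)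
    by_contra hne
    exact hn u hsc hne (comp_sub hmu) (mem_comp.1 hmu).2
  have zK := (hZ.rest v0).comp (S.μ v)
  have hv1 : v ∈ Z \ K := Finset.mem_sdiff.2 ⟨hvZ, hKC v hv⟩
  have hcl1 : ∀ a b, S.SC a b → a ∈ Z \ K → b ∈ Z \ K := by
    intro a b hab ha
    rw [Finset.mem_sdiff] at ha ⊢
    exact ⟨hZ.cl _ _ hab ha.1, fun h => ha.2 (zK.cl _ _ hab.symm h)⟩
  refine ⟨zK, cn_comp hm, ⟨hcl1, ?_, ?_⟩, ?_, ?_, ?_, ?_, ?_, ?_, ?_, hv1, hvK, ?_, hp1, ?_⟩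
  · exact fun a ha => hZ.good a (Finset.mem_sdiff.1 ha).1
  · exact fun a ha => hZ.odd a (Finset.mem_sdiff.1 ha).1
  · refine ⟨v, hv1, fun b hb => ?_⟩
    let r : V → V := fun u => if u ∈ K then v else u
    have hr : ∀ a b, S.Conn Z a b → S.Conn (Z \ K) (r a) (r b) := by
      intro a b hab
      induction hab with
      | refl => exact .rfl
      | @tail b c _ h2 ih =>
        refine ih.trans ?_
        by_cases hbK : b ∈ K <;> by_cases hcK : c ∈ K
        · simp only [r, hbK, hcK, if_true]; exact .rfl
        · simp only [r, hbK, hcK, if_true, if_false]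
          rcases h2.2.2 with h | h
          · exact absurd (zK.cl _ _ h hbK) hcK
          · have : c = v := hp1 c (Finset.mem_sdiff.2 ⟨h2.2.1, hcK⟩) (by rwa [h, S.μμ])
            rw [this]; exact .rfl
        · simp only [r, hbK, hcK, if_true, if_false]
          rcases h2.2.2 with h | h
          · exact absurd (zK.cl _ _ h.symm hcK) hbK
          · have : b = v := hp1 b (Finset.mem_sdiff.2 ⟨h2.1, hbK⟩) (by rwa [← h])
            rw [this]; exact .rfl
        · simp only [r, hbK, hcK, if_false]
          exact .single ⟨Finset.mem_sdiff.2 ⟨h2.1, hbK⟩, Finset.mem_sdiff.2 ⟨h2.2.1, hcK⟩, h2.2.2⟩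
    have := hr v b (hc.conn hvZ (Finset.mem_sdiff.1 hb).1)
    simpa only [r, hKC v hv, (Finset.mem_sdiff.1 hb).2, if_false] using this
  · exact (Finset.card_le_card comp_sub).trans_lt (rest_lt hv0)
  · apply Finset.card_lt_card
    refine (Finset.ssubset_iff_of_subset Finset.sdiff_subset).2 ⟨S.μ v, hWZ _ hm, ?_⟩
    simp [hvK]
  · exact fun u hu => hWZ _ (comp_sub hu)
  · exact Finset.sdiff_subset
  · intro u hu
    rw [Finset.mem_sdiff]; tauto
  · intro u hu h; exact (Finset.mem_sdiff.1 h).2 hu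
  · intro u hu h
    rw [← hp1 (S.μ u) h (by rwa [S.μμ]), S.μμ]
  · intro u hu
    exact Finset.mem_sdiff.2 ⟨hZ.cl _ _ hu hv0, hKC u hu⟩

variable {Z K Z1 : Finset V} {v0 v : V}

theorem Bridge.glue (b : S.Bridge Z v0 v K Z1) {L LK L1 : V → Finset SignType} {x y : V → SignType}
    (hx : S.Sol Z1 L1 x) (hy : S.Sol K LK y) (hL : ∀ u ∈ Z, S.μ u ∉ Z → u ∈ Z1 → L1 u ⊆ L u)
    (hL2 : ∀ u ∈ Z, S.μ u ∉ Z → u ∈ K → LK u ⊆ L u) (hxy : y (S.μ v) = x v) :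
    ∃ z, S.Sol Z L z ∧ (∀ u ∈ Z1, z u = x u) ∧ (∀ u ∈ K, z u = y u) := by
  let z : V → SignType := fun u => if u ∈ K then y u else x u
  have zK : ∀ u ∈ K, z u = y u := fun u hu => by simp only [z, hu, if_true]
  have z1 : ∀ u ∈ Z1, z u = x u := fun u hu => by
    have : u ∉ K := fun h => b.dj u h hu
    simp only [z, this, if_false]
  refine ⟨z, ⟨?_, ?_, ?_⟩, z1, zK⟩
  · intro u hu hm
    rcases b.un u hu with h | h
    · rw [zK u h]; exact hL2 u hu hm h (hy.1 u h (fun h' => hm (b.sK h')))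
    · rw [z1 u h]; exact hL u hu hm h (hx.1 u h (fun h' => hm (b.s1 h')))
  · intro u hu hm
    rcases b.un u hu with h | h <;> rcases b.un _ hm with h' | h'
    · rw [zK _ h, zK _ h']; exact hy.2.1 u h h'
    · have := b.pK u h h'
      rw [zK _ h, z1 _ h', this, S.μμ, hxy]
    · have := b.p1 u h h'
      rw [z1 _ h, zK _ h', this, hxy]
    · rw [z1 _ h, z1 _ h']; exact hx.2.1 u h h'
  · intro u hu
    have aux : ∀ (T : Finset V) (t : V → SignType), S.Zok T → u ∈ T → (∀ u ∈ T, z u = t u) →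
        (∃ w, S.SC u w ∧ S.Good t w) → ∃ w, S.SC u w ∧ S.Good z w := by
      rintro T t hT hu ht ⟨w', hw', t', ht', d', hd', g⟩
      have e : ∀ a, S.SC u a → z a = t a := fun a ha => ht a (hT.cl _ _ ha hu)
      refine ⟨w', hw', t', ht', d', hd', ?_⟩
      rw [e w' hw', e _ (hw'.trans (hd'.sc w')), e _ ((hw'.trans (hd'.sc w')).trans (hd'.sc _)),
        e _ (((hw'.trans (hd'.sc w')).trans (hd'.sc _)).trans (hd'.sc _))]
      exact g
    rcases b.un u hu with h | h
    · exact aux K y b.zK h zK (hy.2.2 u h)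
    · exact aux Z1 x b.z1 h z1 (hx.2.2 u h)

/-- values realisable at the bridging vertex -/
noncomputable def mv (S : CSys V) (K : Finset V) (L : V → Finset SignType) (u : V) :
    Finset SignType :=
  Finset.univ.filter (fun a => ∃ y, S.Sol K (Function.update L u {a}) y)

theorem mv_card (h : S.MCA K) {L : V → Finset SignType} {u : V} (hu : u ∈ K) (hm : S.μ u ∉ K)
    (hL : ∀ p ∈ K, S.μ p ∉ K → p ≠ u → 2 ≤ (L p).card) : 2 ≤ (S.mv K L u).card := by
  by_contra hlt
  have hc : (S.mv K L u).card + (S.mv K L u)ᶜ.card = 3 := by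
    rw [Finset.card_add_card_compl]; rfl
  obtain ⟨y, hy⟩ := h (Function.update L u (S.mv K L u)ᶜ) (by
    intro p hp hmp
    by_cases hpu : p = u
    · subst hpu; rw [Function.update_self]; omega
    · rw [Function.update_of_ne hpu]; exact hL p hp hmp hpu)
  have h1 := hy.1 u hu hm
  rw [Function.update_self, Finset.mem_compl] at h1
  apply h1
  simp only [mv, Finset.mem_filter, Finset.mem_univ, true_and]
  refine ⟨y, hy.mono ?_⟩
  intro p hp hmp hh
  by_cases hpu : p = u
  · subst hpu; rw [Function.update_self]; simp
  · rwa [Function.update_of_ne hpu] at hh ⊢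

theorem Bridge.glue' (b : S.Bridge Z v0 v K Z1) {L : V → Finset SignType} {x : V → SignType}
    {L1 : V → Finset SignType}
    (hx : S.Sol Z1 L1 x) (hL1 : ∀ u ∈ Z, S.μ u ∉ Z → u ∈ Z1 → u ≠ v → L1 u ⊆ L u)
    (hv : L1 v ⊆ S.mv K L (S.μ v)) :
    ∃ z, S.Sol Z L z ∧ (∀ u ∈ Z1, z u = x u) := by
  have h1 : S.μ v ∉ Z1 := b.dj _ b.vK
  have h2 := hv (hx.1 v b.v1 h1)
  simp only [mv, Finset.mem_filter, Finset.mem_univ, true_and] at h2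
  obtain ⟨y, hy⟩ := h2
  have h3 := hy.1 _ b.vK (by rw [S.μμ]; exact fun h => b.dj _ h b.v1)
  rw [Function.update_self, Finset.mem_singleton] at h3
  have hvZ : S.μ v ∈ Z := b.sK b.vK
  obtain ⟨z, z1, z2, -⟩ := b.glue (L := L) hx hy
    (by
      intro u hu hm hu1
      apply hL1 u hu hm hu1
      rintro rfl; exact hm hvZ)
    (by
      intro u hu hm huK
      rw [Function.update_of_ne]
      rintro rfl; rw [S.μμ] at hm; exact hm (b.s1 b.v1)) h3
  exact ⟨z, z1, z2⟩

theorem Bridge.portK (b : S.Bridge Z v0 v K Z1) {p : V} (hp : p ∈ K) (hm : S.μ p ∉ K)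
    (hne : p ≠ S.μ v) : S.μ p ∉ Z := by
  intro h
  rcases b.un _ h with h | h
  · exact hm h
  · exact hne (b.pK p hp h)

theorem Bridge.port1 (b : S.Bridge Z v0 v K Z1) {p : V} (hp : p ∈ Z1) (hm : S.μ p ∉ Z1)
    (hne : p ≠ v) : S.μ p ∉ Z := by
  intro h
  rcases b.un _ h with h | h
  · exact hne (b.p1 p hp h)
  · exact hm h

theorem Bridge.mK (b : S.Bridge Z v0 v K Z1) : S.μ (S.μ v) ∉ K := by
  rw [S.μμ]; exact fun h => b.dj _ h b.v1

theorem Bridge.exK (b : S.Bridge Z v0 v K Z1) : ∃ a, a ∉ K := ⟨_, b.mK⟩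
theorem Bridge.ex1 (b : S.Bridge Z v0 v K Z1) : ∃ a, a ∉ Z1 := ⟨_, b.dj _ b.vK⟩

theorem Bridge.redA (b : S.Bridge Z v0 v K Z1) (IH : ∀ K : Finset V, K.card < Z.card → S.MC K)
    {L : V → Finset SignType} (hL : ∀ p ∈ Z, S.μ p ∉ Z → 2 ≤ (L p).card) : ∃ x, S.Sol Z L x := by
  obtain ⟨kA, -⟩ := IH K b.lK b.zK b.cK b.exK
  obtain ⟨oA, -⟩ := IH Z1 b.l1 b.z1 b.c1 b.ex1
  have hM : 2 ≤ (S.mv K L (S.μ v)).card := mv_card kA b.vK b.mK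
    (fun p hp hm hne => hL p (b.sK hp) (b.portK hp hm hne))
  obtain ⟨x, hx⟩ := oA (Function.update L v (S.mv K L (S.μ v))) (by
    intro p hp hm
    by_cases hpv : p = v
    · subst hpv; rwa [Function.update_self]
    · rw [Function.update_of_ne hpv]; exact hL p (b.s1 hp) (b.port1 hp hm hpv))
  obtain ⟨z, hz, -⟩ := b.glue' hx (L := L)
    (by intro u _ _ _ hne; rw [Function.update_of_ne hne]) (by rw [Function.update_self])
  exact ⟨z, hz⟩

theorem Bridge.redB (b : S.Bridge Z v0 v K Z1) (IH : ∀ K : Finset V, K.card < Z.card → S.MC K)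
    {L : V → Finset SignType} {s : SignType} (hm0 : S.μ v0 ∉ Z) (hs : s ≠ 0) (hsL : s ∈ L v0)
    (hL : ∀ p ∈ Z, S.μ p ∉ Z → p ≠ v0 → 2 ≤ (L p).card)
    (ht : (∃ q ∈ Z, S.μ q ∉ Z ∧ q ≠ v0 ∧ 1 ∈ L q ∧ -1 ∈ L q) ∨
   (∀ q ∈ Z, S.μ q ∉ Z → q ≠ v0 → 0 ∈ L q ∧ -s ∈ L q) ∨
   (∀ q ∈ Z, S.μ q ∉ Z → q ≠ v0 → 0 ∈ L q ∧ s ∈ L q)) : ∃ x, S.Sol Z L x := by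
  obtain ⟨kA, kB, -⟩ := IH K b.lK b.zK b.cK b.exK
  obtain ⟨-, oB, -⟩ := IH Z1 b.l1 b.z1 b.c1 b.ex1
  have hv01 : v0 ∈ Z1 := b.sc1 _ .rfl
  have hvv0 : v ≠ v0 := by rintro rfl; exact hm0 (b.sK b.vK)
  have hK0 : ∀ p ∈ K, p ≠ v0 := by rintro p hp rfl; exact b.dj _ hp hv01
  have hLK : ∀ p ∈ K, S.μ p ∉ K → p ≠ S.μ v → 2 ≤ (L p).card :=
    fun p hp hm hne => hL p (b.sK hp) (b.portK hp hm hne) (hK0 p hp)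
  have hM : 2 ≤ (S.mv K L (S.μ v)).card := mv_card kA b.vK b.mK hLK
  have hmem : ∀ t : SignType, t ≠ 0 → 
      ((∃ q ∈ K, S.μ q ∉ Z ∧ 1 ∈ L q ∧ -1 ∈ L q) ∨
        (∀ q ∈ K, S.μ q ∉ Z → 0 ∈ L q ∧ -t ∈ L q) ∨
        (∀ q ∈ K, S.μ q ∉ Z → 0 ∈ L q ∧ t ∈ L q)) → t ∈ S.mv K L (S.μ v) := by
    intro t ht h
    simp only [mv, Finset.mem_filter, Finset.mem_univ, true_and]
    refine kB _ (S.μ v) t b.vK b.mK ht (by rw [Function.update_self]; simp) ?_ ?_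
    · intro q hq hm hne
      rw [Function.update_of_ne hne]; exact hLK q hq hm hne
    · rcases h with ⟨q, h1, h2, h3⟩ | h | h
      · left
        have hne : q ≠ S.μ v := by
          rintro rfl; rw [S.μμ] at h2; exact h2 (b.s1 b.v1)
        exact ⟨q, h1, fun h => h2 (b.sK h), hne, by rwa [Function.update_of_ne hne]⟩
      · right; left
        intro q hq hm hne
        rw [Function.update_of_ne hne]; exact h q hq (b.portK hq hm hne)
      · right; right
        intro q hq hm hne
        rw [Function.update_of_ne hne]; exact h q hq (b.portK hq hm hne)
  have h1t : ∀ t : SignType, t ≠ 0 → t = s ∨ t = -s := by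
    intro t ht
    revert hs ht
    cases t <;> cases s <;> decide
  obtain ⟨x, hx⟩ := oB (Function.update L v (S.mv K L (S.μ v))) v0 s hv01
    (fun h => hm0 (b.s1 h)) hs (by rwa [Function.update_of_ne hvv0.symm]) (by
    intro p hp hm hne
    by_cases hpv : p = v
    · subst hpv; rwa [Function.update_self]
    · rw [Function.update_of_ne hpv]; exact hL p (b.s1 hp) (b.port1 hp hm hpv) hne) (by
    left
    have viaV : (∀ t : SignType, t ≠ 0 → t ∈ S.mv K L (S.μ v)) → ∃ q ∈ Z1, S.μ q ∉ Z1 ∧ q ≠ v0 ∧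
        1 ∈ Function.update L v (S.mv K L (S.μ v)) q ∧
        -1 ∈ Function.update L v (S.mv K L (S.μ v)) q := fun h =>
      ⟨v, b.v1, b.dj _ b.vK, hvv0, by
        rw [Function.update_self]; exact ⟨h 1 (by decide), h (-1) (by decide)⟩⟩
    rcases ht with ⟨q, h1, h2, h3, h4⟩ | h | h
    · rcases b.un q h1 with h | h
      · exact viaV (fun t ht => hmem t ht (Or.inl ⟨q, h, h2, h4⟩))
      · have : q ≠ v := by rintro rfl; exact h2 (b.sK b.vK)
        exact ⟨q, h, fun h => h2 (b.s1 h), h3, by rwa [Function.update_of_ne this]⟩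
    · apply viaV
      intro t ht
      apply hmem t ht
      right
      rcases h1t t ht with rfl | rfl
      · left; intro q hq hm; exact h q (b.sK hq) hm (hK0 q hq)
      · right; intro q hq hm; exact h q (b.sK hq) hm (hK0 q hq)
    · apply viaV
      intro t ht
      apply hmem t ht
      right
      rcases h1t t ht with rfl | rfl
      · right; intro q hq hm; exact h q (b.sK hq) hm (hK0 q hq)
      · left; intro q hq hm; rw [neg_neg]; exact h q (b.sK hq) hm (hK0 q hq))
  obtain ⟨z, hz, -⟩ := b.glue' hx (L := L)
    (by intro u _ _ _ hne; rw [Function.update_of_ne hne]) (by rw [Function.update_self])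
  exact ⟨z, hz⟩

theorem Bridge.redH (b : S.Bridge Z v0 v K Z1) (IH : ∀ K : Finset V, K.card < Z.card → S.MC K)
    {L : V → Finset SignType} {p : V} (hm0 : S.μ v0 ∉ Z) (hp : p ∈ Z) (hmp : S.μ p ∉ Z)
    (hpq : p ≠ v0) (hpK : p ∉ K)
    (hL : ∀ u ∈ Z, S.μ u ∉ Z → u ≠ p → u ≠ v0 → 2 ≤ (L u).card) :
    ∃ x, S.Sol Z (fun u => if u = p ∨ u = v0 then Finset.univ else L u) x ∧ x v0 ≠ 0 ∧
      x p ≠ x v0 := by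
  obtain ⟨kA, -⟩ := IH K b.lK b.zK b.cK b.exK
  obtain ⟨-, -, o5⟩ := IH Z1 b.l1 b.z1 b.c1 b.ex1
  have hv01 : v0 ∈ Z1 := b.sc1 _ .rfl
  have hvv0 : v ≠ v0 := by rintro rfl; exact hm0 (b.sK b.vK)
  have hvp : v ≠ p := by rintro rfl; exact hmp (b.sK b.vK)
  have hp1 : p ∈ Z1 := by
    rcases b.un p hp with h | h
    · exact absurd h hpK
    · exact h
  set L0 : V → Finset SignType := (fun u => if u = p ∨ u = v0 then Finset.univ else L u) with hL0
  have hM : 2 ≤ (S.mv K L0 (S.μ v)).card := by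
    apply mv_card kA b.vK b.mK
    intro u hu hm hne
    have e1 : u ≠ p := by rintro rfl; exact hpK hu
    have e2 : u ≠ v0 := by rintro rfl; exact b.dj _ hu hv01
    simp only [hL0, e1, e2, or_self, if_false]
    exact hL u (b.sK hu) (b.portK hu hm hne) e1 e2
  obtain ⟨x, hx, hx1, hx2⟩ := o5 (Function.update L v (S.mv K L0 (S.μ v))) p v0 hp1
    (fun h => hmp (b.s1 h)) hv01 (fun h => hm0 (b.s1 h)) hpq (by
      intro u hu hm e1 e2
      by_cases huv : u = v
      · subst huv; rwa [Function.update_self]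
      · rw [Function.update_of_ne huv]; exact hL u (b.s1 hu) (b.port1 hu hm huv) e1 e2)
  obtain ⟨z, hz, hz1⟩ := b.glue' hx (L := L0)
    (by
      intro u _ _ _ hne
      simp only [hL0]
      split_ifs
      · exact le_rfl
      · rw [Function.update_of_ne hne]) (by
      simp only [hvp, hvv0, or_self, if_false]
      rw [Function.update_self])
  refine ⟨z, hz, ?_, ?_⟩
  · rw [hz1 _ hv01]; exact hx1
  · rw [hz1 _ hv01, hz1 _ hp1]; exact hx2

end CSys

open Equiv
namespace CSys
open Classical
variable {V : Type*} {S : CSys V}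

structure Ctx (S : CSys V) (Z : Finset V) (L : V → Finset SignType) (v0 : V) : Prop where
  hZ : S.Zok Z
  IH : ∀ K : Finset V, K.card < Z.card → S.MC K
  hv0 : v0 ∈ Z
  hcard : ∀ q ∈ Z, ¬ S.SC v0 q → S.μ q ∉ Z → 2 ≤ (L q).card
  hne : ∀ q ∈ Z, S.SC v0 q → S.μ q ∉ Z → (L q).Nonempty

/-- every block vertex of the orbit has a partner -/
def HP (S : CSys V) (Z : Finset V) (v0 v : V) : Prop :=
  S.μ v ∈ S.rest Z v0 → ∃ v', S.SC v0 v' ∧ v' ≠ v ∧ S.μ v' ∈ S.rest Z v0 ∧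
    S.Conn (S.rest Z v0) (S.μ v) (S.μ v')

theorem sc_induct {v0 u : V} (P : V → Prop) (h0 : P v0)
    (hs : ∀ d, S.Dir d → ∀ w, S.SC v0 w → P w → P (d w)) (hu : S.SC v0 u) : P u := by
  obtain ⟨i, rfl⟩ := hu
  induction i with
  | zero => simpa
  | succ i ih =>
    have := hs S.σ (Or.inl rfl) _ ⟨_, rfl⟩ ih
    rwa [← Perm.mul_apply, ← zpow_one_add, add_comm] at this
  | pred i ih =>
    have := hs S.σ⁻¹ (Or.inr rfl) _ ⟨_, rfl⟩ ih
    rwa [← Perm.mul_apply, ← zpow_neg_one, ← zpow_add, add_comm, ← sub_eq_add_neg] at this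

structure PD (S : CSys V) (d : Perm V) (a0 a1 a2 a3 a4 : V) : Prop where
  hd : S.Dir d
  e0 : d a0 = a1
  e1 : d a1 = a2
  e2 : d a2 = a3
  e3 : d a3 = a4
  e4 : d a4 = a0
  nd : [a0, a1, a2, a3, a4].Nodup
  nch : ∀ b, S.SC a0 b → ¬ S.SC b (S.μ b)

variable {d : Perm V} {a0 a1 a2 a3 a4 v0 : V} {Z : Finset V} {L : V → Finset SignType}

theorem PD.rot (h : S.PD d a0 a1 a2 a3 a4) : S.PD d a1 a2 a3 a4 a0 := by
  refine ⟨h.hd, h.e1, h.e2, h.e3, h.e4, h.e0, ?_, ?_⟩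
  · have := h.nd; simp at this ⊢; grind
  · intro b hb
    apply h.nch
    rw [← h.e0] at hb
    exact (h.hd.sc a0).trans hb

theorem PD.flip (h : S.PD d a0 a1 a2 a3 a4) : S.PD d⁻¹ a0 a4 a3 a2 a1 := by
  have key : ∀ a b, d a = b → d⁻¹ b = a := fun a b h => by rw [← h]; simp
  refine ⟨h.hd.inv, key _ _ h.e4, key _ _ h.e3, key _ _ h.e2, key _ _ h.e1, key _ _ h.e0, ?_, h.nch⟩
  have := h.nd; simp at this ⊢; grind

theorem PD.all (h : S.PD d a0 a1 a2 a3 a4) {u : V} (hu : S.SC a0 u) :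
    u = a0 ∨ u = a1 ∨ u = a2 ∨ u = a3 ∨ u = a4 := by
  refine sc_induct (S := S) (v0 := a0) (fun u => u = a0 ∨ u = a1 ∨ u = a2 ∨ u = a3 ∨ u = a4)
    (Or.inl rfl) ?_ hu
  have h0 := h.e0; have h1 := h.e1; have h2 := h.e2; have h3 := h.e3; have h4 := h.e4
  have f0 := h.flip.e0; have f1 := h.flip.e1; have f2 := h.flip.e2
  have f3 := h.flip.e3; have f4 := h.flip.e4
  intro d' hd' w _ hw
  have : d' = d ∨ d' = d⁻¹ := by
    rcases h.hd with rfl | rfl <;> rcases hd' with rfl | rfl <;> simp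
  rcases this with rfl | rfl <;> rcases hw with rfl | rfl | rfl | rfl | rfl <;> simp [*]

theorem PD.sc1 (h : S.PD d a0 a1 a2 a3 a4) : S.SC a0 a1 := h.e0 ▸ h.hd.sc a0
theorem PD.sc2 (h : S.PD d a0 a1 a2 a3 a4) : S.SC a0 a2 := h.sc1.trans h.rot.sc1
theorem PD.sc3 (h : S.PD d a0 a1 a2 a3 a4) : S.SC a0 a3 := h.sc2.trans h.rot.rot.sc1
theorem PD.sc4 (h : S.PD d a0 a1 a2 a3 a4) : S.SC a0 a4 := h.sc3.trans h.rot.rot.rot.sc1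

theorem Pent.pd (h : S.Pent a0) (hd : S.Dir d) : ∃ a1 a2 a3 a4, S.PD d a0 a1 a2 a3 a4 := by
  suffices hh : ∃ a1 a2 a3 a4, S.PD S.σ a0 a1 a2 a3 a4 by
    rcases hd with rfl | rfl
    · exact hh
    · obtain ⟨a1, a2, a3, a4, hh⟩ := hh
      exact ⟨_, _, _, _, hh.flip⟩
  obtain ⟨h5, hne, hch⟩ := h
  refine ⟨_, _, _, _, Or.inl rfl, rfl, rfl, rfl, rfl, h5, ?_, hch⟩
  have inj := S.σ.injective
  have n2 : S.σ (S.σ a0) ≠ a0 := by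
    intro h
    rw [h, h] at h5; exact hne h5
  have n3 : S.σ (S.σ (S.σ a0)) ≠ a0 := by
    intro h
    rw [h] at h5; exact n2 h5
  have n4 : S.σ (S.σ (S.σ (S.σ a0))) ≠ a0 := by
    intro h
    rw [h] at h5; exact hne h5
  simp only [List.nodup_cons, List.mem_cons, List.not_mem_nil, or_false, not_or, inj.eq_iff]
  refine ⟨⟨hne.symm, n2.symm, n3.symm, n4.symm⟩, ⟨hne.symm, n2.symm, n3.symm⟩, ⟨hne.symm, n2.symm⟩,
    hne.symm, ?_⟩
  simp

/-- fire with explicit names -/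
theorem Ctx.fire (c : S.Ctx Z L v0) (hd : S.Dir d) {a b g h : V} (ha : S.SC v0 a)
    (e1 : d a = b) (e2 : d b = g) (e3 : d g = h) (hnd : [a, b, g, h].Nodup)
    {s : SignType} (hs : s ≠ 0)
    (h1 : S.FOK Z L v0 [a, b, g, h] s a) (h2 : S.FOK Z L v0 [a, b, g, h] s b)
    (nc : S.μ a ∈ S.rest Z v0 → S.μ b ∈ S.rest Z v0 → ¬ S.Conn (S.rest Z v0) (S.μ a) (S.μ b))
    (hg1 : S.μ g ∉ Z → ∃ t ∈ L g, t ≠ s) (hg2 : S.μ h ∉ Z → ∃ t ∈ L h, t ≠ s) :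
    ∃ x, S.Sol Z L x := by
  subst e1 e2 e3
  exact CSys.fire c.hZ c.IH L c.hv0 c.hcard c.hne hd ha hnd hs h1 h2 nc hg1 hg2

theorem Ctx.fireP (c : S.Ctx Z L v0) (pd : S.PD d a0 a1 a2 a3 a4) (ha : S.SC v0 a0)
    {s : SignType} (hs : s ≠ 0)
    (h1 : S.FOK Z L v0 [a0, a1, a2, a3] s a0) (h2 : S.FOK Z L v0 [a0, a1, a2, a3] s a1)
    (nc : S.μ a0 ∈ S.rest Z v0 → S.μ a1 ∈ S.rest Z v0 → ¬ S.Conn (S.rest Z v0) (S.μ a0) (S.μ a1))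
    (hg1 : S.μ a2 ∉ Z → ∃ t ∈ L a2, t ≠ s) (hg2 : S.μ a3 ∉ Z → ∃ t ∈ L a3, t ≠ s) :
    ∃ x, S.Sol Z L x := by
  refine c.fire pd.hd ha pd.e0 pd.e1 pd.e2 ?_ hs h1 h2 nc hg1 hg2
  have := pd.nd; simp at this ⊢; grind

theorem Ctx.fire7 (c : S.Ctx Z L v0) (hl : S.Long v0) (hd : S.Dir d) {w : V} (hw : S.SC v0 w)
    {s : SignType} (hs : s ≠ 0) {t : V} (ht1 : t ≠ w) (ht2 : t ≠ d w)
    (h1 : ∀ F, t ∉ F → S.FOK Z L v0 F s w) (h2 : ∀ F, t ∉ F → S.FOK Z L v0 F s (d w))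
    (nc : S.μ w ∈ S.rest Z v0 → S.μ (d w) ∈ S.rest Z v0 →
      ¬ S.Conn (S.rest Z v0) (S.μ w) (S.μ (d w)))
    (hg : ∀ g, S.SC v0 g → g ≠ t → g ≠ w → g ≠ d w → S.μ g ∉ Z → ∃ a ∈ L g, a ≠ s) :
    ∃ x, S.Sol Z L x := by
  have nd := hl d hd w hw
  have i1 : d⁻¹ (d w) = w := by simp
  generalize hb1 : d w = b1 at *
  generalize hb2 : d b1 = b2 at *
  generalize hb3 : d b2 = b3 at *
  generalize hc1 : d⁻¹ w = c1 at *
  generalize hc2 : d⁻¹ c1 = c2 at *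
  have sb1 : S.SC v0 b1 := hw.trans (hb1 ▸ hd.sc w)
  have sb2 : S.SC v0 b2 := sb1.trans (hb2 ▸ hd.sc b1)
  have sb3 : S.SC v0 b3 := sb2.trans (hb3 ▸ hd.sc b2)
  have sc1 : S.SC v0 c1 := hw.trans (hc1 ▸ hd.inv.sc w)
  have sc2 : S.SC v0 c2 := sc1.trans (hc2 ▸ hd.inv.sc c1)
  simp only [List.nodup_cons, List.mem_cons, List.not_mem_nil, or_false, not_or] at nd
  by_cases h : t = b2 ∨ t = b3
  · have htF : t ∉ [b1, w, c1, c2] := by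
      simp only [List.mem_cons, List.not_mem_nil, or_false, not_or]; grind
    refine c.fire hd.inv sb1 i1 hc1 hc2 ?_ hs (h2 _ htF) (h1 _ htF) ?_ ?_ ?_
    · simp; grind
    · exact fun h h' h'' => nc h' h h''.symm
    · apply hg c1 sc1 <;> grind
    · apply hg c2 sc2 <;> grind
  · have htF : t ∉ [w, b1, b2, b3] := by
      simp only [List.mem_cons, List.not_mem_nil, or_false, not_or]; grind
    refine c.fire hd hw hb1 hb2 hb3 ?_ hs (h1 _ htF) (h2 _ htF) nc ?_ ?_
    · simp; grind
    · apply hg b2 sb2 <;> grind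
    · apply hg b3 sb3 <;> grind

theorem mate {v : V} (hv0 : v0 ∈ Z) (hZ : S.Zok Z) (hp : S.HP Z v0 v) (hv : S.SC v0 v)
    (hm : S.μ v ∈ Z) :
    ∃ m, S.SC v0 m ∧ m ≠ v ∧ S.μ m ∈ Z ∧ (∀ F s, m ∉ F → S.FOK Z L v0 F s v) ∧
      (m = S.μ v ∨ (S.μ v ∈ S.rest Z v0 ∧ S.μ m ∈ S.rest Z v0 ∧
        S.Conn (S.rest Z v0) (S.μ v) (S.μ m))) := by
  by_cases h : S.SC v0 (S.μ v)
  · refine ⟨S.μ v, h, S.μne v, ?_, ?_, Or.inl rfl⟩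
    · rw [S.μμ]; exact hZ.cl _ _ hv hv0
    · intro F s hF
      exact Or.inr (Or.inl ⟨hv.symm.trans h, hF⟩)
  · have hw : S.μ v ∈ S.rest Z v0 := mem_rest.2 ⟨hm, h⟩
    obtain ⟨v', h1, h2, h3, h4⟩ := hp hw
    exact ⟨v', h1, h2, (mem_rest.1 h3).1, fun F s hF => Or.inr (Or.inr ⟨hw, Or.inl ⟨v', h1, hF, h3, h4⟩⟩),
      Or.inr ⟨hw, h3, h4⟩⟩

/-- port and adjacent nonport, long orbit -/
theorem Ctx.fire7P (c : S.Ctx Z L v0) (hl : S.Long v0) (hd : S.Dir d) {w : V} (hw : S.SC v0 w)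
    {s : SignType} (hs : s ≠ 0) (hwp : S.μ w ∉ Z) (hwL : s ∈ L w) (hp : S.HP Z v0 (d w))
    (hn : S.μ (d w) ∈ Z)
    (hg : ∀ g, S.SC v0 g → g ≠ w → S.μ g ∉ Z → ∃ a ∈ L g, a ≠ s) :
    ∃ x, S.Sol Z L x := by
  obtain ⟨m, m1, m2, m3, m4, -⟩ := mate (L := L) c.hv0 c.hZ hp (hw.trans (hd.sc w)) hn
  refine c.fire7 hl hd hw hs (t := m) ?_ m2 ?_ ?_ ?_ ?_
  · rintro rfl; exact hwp m3
  · exact fun F _ => Or.inl ⟨hwp, hwL⟩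
  · exact fun F h => m4 F s h
  · exact fun h => absurd (mem_rest.1 h).1 hwp
  · exact fun g g1 _ g2 _ g3 => hg g g1 g2 g3

/-- pentagon, f = (0,1), 0 is a port, 1 a block vertex whose partner is 2 or 4 -/
theorem Ctx.fire01 (c : S.Ctx Z L v0) (pd : S.PD d a0 a1 a2 a3 a4) (ha : S.SC v0 a0)
    {s : SignType} (hs : s ≠ 0) (hp : S.μ a0 ∉ Z) (hpL : s ∈ L a0)
    (h1 : S.μ a1 ∈ S.rest Z v0)
    (hpar : (S.μ a2 ∈ S.rest Z v0 ∧ S.Conn (S.rest Z v0) (S.μ a1) (S.μ a2)) ∨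
            (S.μ a4 ∈ S.rest Z v0 ∧ S.Conn (S.rest Z v0) (S.μ a1) (S.μ a4)))
    (hg : ∀ g, S.SC v0 g → g ≠ a0 → S.μ g ∉ Z → ∃ a ∈ L g, a ≠ s) :
    ∃ x, S.Sol Z L x := by
  have nd := pd.nd
  simp only [List.nodup_cons, List.mem_cons, List.not_mem_nil, or_false, not_or] at nd
  have nc : S.μ a0 ∈ S.rest Z v0 → False := fun h => hp (mem_rest.1 h).1
  rcases hpar with ⟨p1, p2⟩ | ⟨p1, p2⟩
  · refine c.fireP pd.flip.rot.rot.rot.rot (ha.trans pd.sc1) hs ?_ (Or.inl ⟨hp, hpL⟩)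
      (fun _ h => (nc h).elim) ?_ ?_
    · refine Or.inr (Or.inr ⟨h1, Or.inl ⟨a2, ha.trans pd.sc2, ?_, p1, p2⟩⟩)
      simp; grind
    · exact hg _ (ha.trans pd.sc4) (by grind)
    · exact hg _ (ha.trans pd.sc3) (by grind)
  · refine c.fireP pd ha hs (Or.inl ⟨hp, hpL⟩) ?_
      (fun h => (nc h).elim) ?_ ?_
    · refine Or.inr (Or.inr ⟨h1, Or.inl ⟨a4, ha.trans pd.sc4, ?_, p1, p2⟩⟩)
      simp; grind
    · exact hg _ (ha.trans pd.sc2) (by grind)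
    · exact hg _ (ha.trans pd.sc3) (by grind)

/-- pentagon, f = (2,1), g = (0,4), 3 free, with 3 a partner of 1 -/
theorem Ctx.fire21 (c : S.Ctx Z L v0) (pd : S.PD d a0 a1 a2 a3 a4) (ha : S.SC v0 a0)
    {s : SignType} (hs : s ≠ 0) (hp : S.μ a2 ∉ Z) (hpL : s ∈ L a2)
    (h1 : S.μ a1 ∈ S.rest Z v0)
    (p1 : S.μ a3 ∈ S.rest Z v0) (p2 : S.Conn (S.rest Z v0) (S.μ a1) (S.μ a3))
    (hg1 : S.μ a0 ∉ Z → ∃ a ∈ L a0, a ≠ s) (hg2 : S.μ a4 ∉ Z → ∃ a ∈ L a4, a ≠ s) :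
    ∃ x, S.Sol Z L x := by
  have nd := pd.nd
  simp only [List.nodup_cons, List.mem_cons, List.not_mem_nil, or_false, not_or] at nd
  have nc : S.μ a2 ∈ S.rest Z v0 → False := fun h => hp (mem_rest.1 h).1
  refine c.fireP pd.flip.rot.rot.rot (ha.trans pd.sc2) hs (Or.inl ⟨hp, hpL⟩) ?_
    (fun h => (nc h).elim) hg1 hg2
  refine Or.inr (Or.inr ⟨h1, Or.inl ⟨a3, ha.trans pd.sc3, ?_, p1, p2⟩⟩)
  simp; grind

end CSys

open Equiv
namespace CSys
open Classical
variable {V : Type*} {S : CSys V}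
variable {d : Perm V} {a0 a1 a2 a3 a4 v0 : V} {Z : Finset V} {L : V → Finset SignType}

theorem comp_eq {W : Finset V} {a b : V} (h : S.Conn W a b) : S.comp W a = S.comp W b := by
  ext u
  rw [mem_comp, mem_comp]
  exact ⟨fun h' => ⟨h'.1, h.symm.trans h'.2⟩, fun h' => ⟨h'.1, h.trans h'.2⟩⟩

theorem IH_use (c : S.Ctx Z L v0) (b : V) (hb : b ∈ S.rest Z v0) :
    S.MCA (S.comp (S.rest Z v0) b) ∧ S.MCB (S.comp (S.rest Z v0) b) ∧
      S.H5 (S.comp (S.rest Z v0) b) :=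
  c.IH _ ((Finset.card_le_card comp_sub).trans_lt (rest_lt c.hv0)) ((c.hZ.rest v0).comp b)
    (cn_comp hb) ⟨v0, fun h => (mem_rest.1 (comp_sub h)).2 .rfl⟩

set_option maxHeartbeats 1000000 in
theorem Ctx.cross (c : S.Ctx Z L a0) (pd : S.PD d a0 a1 a2 a3 a4) (hp : S.μ a0 ∉ Z)
    (m1 : S.μ a1 ∈ S.rest Z a0) (m2 : S.μ a2 ∈ S.rest Z a0) (m3 : S.μ a3 ∈ S.rest Z a0)
    (m4 : S.μ a4 ∈ S.rest Z a0) (c13 : S.Conn (S.rest Z a0) (S.μ a1) (S.μ a3))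
    (c24 : S.Conn (S.rest Z a0) (S.μ a2) (S.μ a4))
    (nc : ¬ S.Conn (S.rest Z a0) (S.μ a1) (S.μ a2)) :
    ∃ ρ : SignType, ρ ≠ 0 ∧ ∀ L' : V → Finset SignType,
      (∀ q ∈ S.rest Z a0, S.μ q ∉ Z → 2 ≤ (L' q).card) →
      (∀ q ∈ S.rest Z a0, S.μ q ∉ Z → S.Conn (S.rest Z a0) (S.μ a2) q → L' q = L q) →
      (∃ a ∈ L' a0, a ≠ ρ) → ∃ x, S.Sol Z L' x := by
  set W := S.rest Z a0 with hW
  have nd := pd.nd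
  simp only [List.nodup_cons, List.mem_cons, List.not_mem_nil, or_false, not_or] at nd
  obtain ⟨⟨n01, n02, n03, n04⟩, ⟨n12, n13, n14⟩, ⟨n23, n24⟩, n34, -⟩ := nd
  have minj : ∀ a b, S.μ a = S.μ b → a = b := fun a b h => by rw [← S.μμ a, h, S.μμ]
  have hWZ : ∀ u, u ∈ W → u ∈ Z := fun u hu => (mem_rest.1 hu).1
  have zi : ∀ u, S.SC a0 u → u ∈ Z := fun u hu => c.hZ.cl _ _ hu c.hv0
  have zw : ∀ u, S.SC a0 u → u ∉ W := fun u hu h => (mem_rest.1 h).2 hu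
  have lt : ∀ a, (S.comp W a).card < Z.card := fun a =>
    (Finset.card_le_card comp_sub).trans_lt (rest_lt c.hv0)
  have hzw := c.hZ.rest a0
  have exn : ∀ a, ∃ b, b ∉ S.comp W a := fun a => ⟨a0, fun h => zw _ .rfl (comp_sub h)⟩
  have portW : ∀ q ∈ W, S.μ q ∉ W → S.μ q ∉ Z ∨ q = S.μ a1 ∨ q = S.μ a2 ∨ q = S.μ a3 ∨ q = S.μ a4 := by
    intro q hq hm
    by_cases hz : S.μ q ∈ Z
    · right
      have : S.SC a0 (S.μ q) := by
        by_contra h; exact hm (mem_rest.2 ⟨hz, h⟩)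
      rcases pd.all this with h | h | h | h | h
      · exfalso; rw [← h, S.μμ] at hp; exact hp (hWZ q hq)
      all_goals rw [← h, S.μμ]; simp
    · exact Or.inl hz
  -- solve K24
  obtain ⟨-, -, k5⟩ := IH_use c (S.μ a2) m2
  obtain ⟨y, hy, hy2, hy4⟩ := k5 L (S.μ a4) (S.μ a2) (mem_comp.2 ⟨m4, c24⟩)
    (by rw [S.μμ]; exact fun h => zw _ pd.sc4 (comp_sub h)) (mem_comp.2 ⟨m2, .rfl⟩)
    (by rw [S.μμ]; exact fun h => zw _ pd.sc2 (comp_sub h)) (fun h => n24 (minj _ _ h).symm)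
    (by
      intro u hu hm h4 h2
      have huW := comp_sub hu
      rcases portW u huW (fun h => hm ((mu_mem_comp hu).2 h)) with h | h | h | h | h
      · exact c.hcard u (hWZ u huW) (mem_rest.1 huW).2 h
      · exfalso; rw [h] at hu; exact nc (mem_comp.1 hu).2.symm
      · exact absurd h h2
      · exfalso; rw [h] at hu; exact nc (c13.trans (mem_comp.1 hu).2.symm)
      · exact absurd h h4)
  refine ⟨y (S.μ a2), hy2, ?_⟩
  generalize hρ : y (S.μ a2) = ρ at *
  intro L' hL1 hL2 ⟨a, haL, haρ⟩
  let L2 : V → Finset SignType := fun u => if u = S.μ a2 then {ρ} else if u = S.μ a4 then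
    Finset.univ \ {ρ} else if u = S.μ a3 then {ρ} else if u = S.μ a1 then Finset.univ else L' u
  have i12 : S.μ a1 ≠ S.μ a2 := fun h => n12 (minj _ _ h)
  have i13 : S.μ a1 ≠ S.μ a3 := fun h => n13 (minj _ _ h)
  have i14 : S.μ a1 ≠ S.μ a4 := fun h => n14 (minj _ _ h)
  have i23 : S.μ a2 ≠ S.μ a3 := fun h => n23 (minj _ _ h)
  have i24 : S.μ a2 ≠ S.μ a4 := fun h => n24 (minj _ _ h)
  have i34 : S.μ a3 ≠ S.μ a4 := fun h => n34 (minj _ _ h)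
  have l1 : L2 (S.μ a1) = Finset.univ := by simp [L2, i12, i13, i14]
  have l2 : L2 (S.μ a2) = {ρ} := by simp [L2]
  have l3 : L2 (S.μ a3) = {ρ} := by simp [L2, i34, i23.symm]
  have l4 : L2 (S.μ a4) = Finset.univ \ {ρ} := by simp [L2, i24.symm]
  have lo : ∀ q, S.μ q ∉ Z → L2 q = L' q := by
    intro q hq
    have : ∀ i, S.SC a0 i → q ≠ S.μ i := by
      rintro i hi rfl; rw [S.μμ] at hq; exact hq (zi i hi)
    simp only [L2, this _ pd.sc1, this _ pd.sc2, this _ pd.sc3, this _ pd.sc4, if_false]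
  have hWs : ∃ z, S.Sol W L2 z := by
    apply CSys.glue hzw
    intro b hb
    by_cases hb2 : S.Conn W b (S.μ a2)
    · rw [comp_eq hb2]
      refine ⟨y, hy.mono ?_⟩
      intro u hu hm hyu
      have huW := comp_sub hu
      rcases portW u huW (fun h => hm ((mu_mem_comp hu).2 h)) with h | h | h | h | h
      · rw [lo u h, hL2 u huW h (mem_comp.1 hu).2]
        have e1 : u ≠ S.μ a4 := by rintro rfl; rw [S.μμ] at h; exact h (zi _ pd.sc4)
        have e2 : u ≠ S.μ a2 := by rintro rfl; rw [S.μμ] at h; exact h (zi _ pd.sc2)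
        simpa [e1, e2] using hyu
      · exfalso; rw [h] at hu; exact nc (mem_comp.1 hu).2.symm
      · rw [h, l2, hρ]; simp
      · exfalso; rw [h] at hu; exact nc (c13.trans (mem_comp.1 hu).2.symm)
      · rw [h, l4]; simpa using hy4
    · obtain ⟨kA, kB, -⟩ := IH_use c b hb
      by_cases hb3 : S.Conn W b (S.μ a3)
      · apply kB L2 (S.μ a3) ρ (mem_comp.2 ⟨m3, hb3⟩)
          (by rw [S.μμ]; exact fun h => zw _ pd.sc3 (comp_sub h)) hy2 (by rw [l3]; simp)
        · intro u hu hm h3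
          have huW := comp_sub hu
          rcases portW u huW (fun h => hm ((mu_mem_comp hu).2 h)) with h | h | h | h | h
          · rw [lo u h]; exact hL1 u huW h
          · rw [h, l1]; decide
          · exfalso; rw [h] at hu; exact hb2 (mem_comp.1 hu).2
          · exact absurd h h3
          · rw [h, l4]; exact card_two_sdiff ρ
        · left
          refine ⟨S.μ a1, mem_comp.2 ⟨m1, hb3.trans c13.symm⟩, ?_, i13, ?_⟩
          · rw [S.μμ]; exact fun h => zw _ pd.sc1 (comp_sub h)
          · rw [l1]; simp
      · apply kA
        intro u hu hm
        have huW := comp_sub hu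
        rcases portW u huW (fun h => hm ((mu_mem_comp hu).2 h)) with h | h | h | h | h
        · rw [lo u h]; exact hL1 u huW h
        · rw [h, l1]; decide
        · exfalso; rw [h] at hu; exact hb2 (mem_comp.1 hu).2
        · exfalso; rw [h] at hu; exact hb3 (mem_comp.1 hu).2
        · rw [h, l4]; exact card_two_sdiff ρ
  obtain ⟨z, hz1, hz2, hz3⟩ := hWs
  let x : V → SignType := fun u => if u ∈ W then z u else if S.μ u ∈ W then z (S.μ u) else a
  have xW : ∀ u ∈ W, x u = z u := fun u hu => by simp only [x, hu, if_true]
  have xB : ∀ u, S.SC a0 u → S.μ u ∈ W → x u = z (S.μ u) := fun u hu hm => by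
    simp only [x, zw u hu, hm, if_true, if_false]
  have x0 : x a0 = a := by
    have : S.μ a0 ∉ W := fun h => hp (hWZ _ h)
    simp only [x, zw a0 .rfl, this, if_false]
  have v2 : x a2 = ρ := by
    rw [xB _ pd.sc2 m2]
    have := hz1 _ m2 (by rw [S.μμ]; exact zw _ pd.sc2)
    rwa [l2, Finset.mem_singleton] at this
  have v3 : x a3 = ρ := by
    rw [xB _ pd.sc3 m3]
    have := hz1 _ m3 (by rw [S.μμ]; exact zw _ pd.sc3)
    rwa [l3, Finset.mem_singleton] at this
  have v4 : x a4 ≠ ρ := by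
    rw [xB _ pd.sc4 m4]
    have := hz1 _ m4 (by rw [S.μμ]; exact zw _ pd.sc4)
    rw [l4] at this
    simpa using this
  refine ⟨x, ?_, ?_, ?_⟩
  · intro u hu hm
    by_cases huC : S.SC a0 u
    · have : u = a0 := by
        rcases pd.all huC with h | h | h | h | h
        · exact h
        all_goals exfalso; rw [h] at hm
        · exact hm (hWZ _ m1)
        · exact hm (hWZ _ m2)
        · exact hm (hWZ _ m3)
        · exact hm (hWZ _ m4)
      rw [this, x0]; exact haL
    · have huW : u ∈ W := mem_rest.2 ⟨hu, huC⟩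
      rw [xW u huW, ← lo u hm]
      exact hz1 u huW (fun h => hm (hWZ _ h))
  · intro u hu hm
    by_cases hc : S.SC a0 u <;> by_cases hc' : S.SC a0 (S.μ u)
    · exact absurd (hc.symm.trans hc') (pd.nch u hc)
    · have hmW : S.μ u ∈ W := mem_rest.2 ⟨hm, hc'⟩
      rw [xW _ hmW, xB u hc hmW]
    · have hvW : u ∈ W := mem_rest.2 ⟨hu, hc⟩
      rw [xW _ hvW, xB (S.μ u) hc' (by rwa [S.μμ]), S.μμ]
    · have hmW : S.μ u ∈ W := mem_rest.2 ⟨hm, hc'⟩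
      have hvW : u ∈ W := mem_rest.2 ⟨hu, hc⟩
      rw [xW _ hmW, xW _ hvW]
      exact hz2 u hvW hmW
  · intro u hu
    by_cases hc : S.SC a0 u
    · refine ⟨a2, hc.symm.trans pd.sc2, ρ, hy2, d, pd.hd, v2, ?_, ?_, ?_⟩
      · rw [pd.e2]; exact v3
      · rw [pd.e2, pd.e3]; exact v4
      · rw [pd.e2, pd.e3, pd.e4, x0]; exact haρ
    · have hvW : u ∈ W := mem_rest.2 ⟨hu, hc⟩
      obtain ⟨w', hw', t, ht, d', hd', g⟩ := hz3 u hvW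
      have e : ∀ v, S.SC u v → x v = z v := fun v hv => xW v (hzw.cl _ _ hv hvW)
      refine ⟨w', hw', t, ht, d', hd', ?_⟩
      rw [e w' hw', e _ (hw'.trans (hd'.sc w')), e _ ((hw'.trans (hd'.sc w')).trans (hd'.sc _)),
        e _ (((hw'.trans (hd'.sc w')).trans (hd'.sc _)).trans (hd'.sc _))]
      exact g

end CSys

open Equiv
namespace CSys
open Classical
variable {V : Type*} {S : CSys V}
variable {d : Perm V} {a0 a1 a2 a3 a4 v0 : V} {Z : Finset V} {L : V → Finset SignType}

theorem ex_nonzero {A : Finset SignType} (h : 2 ≤ A.card) : ∃ s ∈ A, s ≠ 0 := by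
  obtain ⟨s, hs, h⟩ := Finset.exists_mem_ne (Nat.lt_of_lt_of_le one_lt_two h) 0
  exact ⟨s, hs, h⟩

theorem ex_ne {A : Finset SignType} (h : 2 ≤ A.card) (t : SignType) : ∃ s ∈ A, s ≠ t := by
  obtain ⟨s, hs, h⟩ := Finset.exists_mem_ne (Nat.lt_of_lt_of_le one_lt_two h) t
  exact ⟨s, hs, h⟩

theorem exists_port (hc : S.Cn Z) (hz : S.Zok Z) (hex : ∃ a, a ∉ Z) : ∃ p ∈ Z, S.μ p ∉ Z := by
  by_contra h
  push Not at h
  obtain ⟨a, ha, -⟩ := hc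
  obtain ⟨b, hb⟩ := hex
  exact hb (S.tr {v | v ∈ Z} ⟨a, ha⟩ (fun v hv => hz.cl _ _ (Dir.sc (Or.inl rfl) v) hv)
    (fun v hv => h v hv) b)

theorem Long.nd4 (h : S.Long v0) {w : V} (hw : S.SC v0 w) (hd : S.Dir d) :
    [w, d w, d (d w), d (d (d w))].Nodup := by
  have := h d hd w hw
  simp only [List.nodup_cons, List.mem_cons, List.not_mem_nil, or_false, not_or] at this ⊢
  tauto

theorem Pent.sc (h : S.Pent v0) {w : V} (hw : S.SC v0 w) : S.Pent w := by
  refine ⟨?_, ?_, fun b hb => h.2.2 b (hw.trans hb)⟩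
  · obtain ⟨i, rfl⟩ := hw
    have : (S.σ ^ (5:ℤ)) v0 = v0 := h.1
    show (S.σ ^ (5:ℤ)) _ = _
    rw [← Perm.mul_apply, ← zpow_add, add_comm, zpow_add, Perm.mul_apply, this]
  · obtain ⟨i, rfl⟩ := hw
    intro h'
    apply h.2.1
    have : (S.σ ^ (1:ℤ)) ((S.σ ^ i) v0) = (S.σ ^ i) v0 := by rwa [zpow_one]
    rw [← Perm.mul_apply, ← zpow_add, add_comm, zpow_add, Perm.mul_apply] at this
    have := (S.σ ^ i).injective this
    rwa [zpow_one] at this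

theorem nd4 (hg : S.Pent v0 ∨ S.Long v0) {w : V} (hw : S.SC v0 w) (hd : S.Dir d) :
    [w, d w, d (d w), d (d (d w))].Nodup := by
  rcases hg with h | h
  · obtain ⟨a1, a2, a3, a4, pd⟩ := (h.sc hw).pd hd
    rw [pd.e0, pd.e1, pd.e2]
    have := pd.nd
    simp only [List.nodup_cons, List.mem_cons, List.not_mem_nil, or_false, not_or] at this ⊢
    tauto
  · exact h.nd4 hw hd

theorem Ctx.block_of_pent (c : S.Ctx Z L v0) (pd : S.PD d v0 a1 a2 a3 a4) {u : V}
    (hu : S.SC v0 u) (hm : S.μ u ∈ Z) : S.μ u ∈ S.rest Z v0 :=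
  mem_rest.2 ⟨hm, fun h => pd.nch u hu (hu.symm.trans h)⟩

/-- pentagon with port at 0 and block 1: possible partners -/
theorem Ctx.part_pent (pd : S.PD d v0 a1 a2 a3 a4) (hp0 : S.μ v0 ∉ Z)
    (hm : S.μ a1 ∈ S.rest Z v0) (hp : S.HP Z v0 a1) :
    ((S.μ a2 ∈ S.rest Z v0 ∧ S.Conn (S.rest Z v0) (S.μ a1) (S.μ a2)) ∨
      (S.μ a4 ∈ S.rest Z v0 ∧ S.Conn (S.rest Z v0) (S.μ a1) (S.μ a4))) ∨
    (S.μ a3 ∈ S.rest Z v0 ∧ S.Conn (S.rest Z v0) (S.μ a1) (S.μ a3)) := by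
  obtain ⟨v', h1, h2, h3, h4⟩ := hp hm
  rcases pd.all h1 with h | h | h | h | h <;> subst h
  · exact absurd (mem_rest.1 h3).1 hp0
  · exact absurd rfl h2
  · exact Or.inl (Or.inl ⟨h3, h4⟩)
  · exact Or.inr ⟨h3, h4⟩
  · exact Or.inl (Or.inr ⟨h3, h4⟩)

theorem alternate (n : ℕ) (hn : Odd n) (sg : V → SignType) (a : V) (h0 : sg a ≠ 0)
    (h : ∀ i, sg ((S.σ ^ (i+1)) a) = - sg ((S.σ ^ i) a)) (hna : (S.σ ^ n) a = a) : False := by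
  have key : ∀ i, sg ((S.σ ^ i) a) = if Even i then sg a else - sg a := by
    intro i
    induction i with
    | zero => simp
    | succ i ih =>
      rw [h, ih]
      by_cases he : Even i <;> simp [Nat.even_add_one, he]
  have := key n
  rw [hna, if_neg (Nat.not_even_iff_odd.2 hn)] at this
  revert h0 this
  cases sg a <;> decide

theorem stepA (hZ : S.Zok Z) (hc : S.Cn Z) (hex : ∃ a, a ∉ Z)
    (IH : ∀ K : Finset V, K.card < Z.card → S.MC K) : S.MCA Z := by
  intro L hL
  obtain ⟨p, hpZ, hpm⟩ := exists_port hc hZ hex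
  by_cases hall : ∀ u, S.SC p u → S.μ u ∉ Z
  · -- all ports
    have c : S.Ctx Z L p := ⟨hZ, IH, hpZ, fun q hq _ hm => hL q hq hm, fun q hq _ hm =>
      Finset.card_pos.1 (by have := hL q hq hm; omega)⟩
    have : ∀ u, ∃ t : SignType, S.SC p u → t ∈ L u ∧ t ≠ 0 := by
      intro u
      by_cases hu : S.SC p u
      · obtain ⟨t, h1, h2⟩ := ex_nonzero (hL u (hZ.cl _ _ hu hpZ) (hall u hu))
        exact ⟨t, fun _ => ⟨h1, h2⟩⟩
      · exact ⟨0, fun h => absurd h hu⟩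
    choose sg hsg using this
    by_cases hw : ∃ w, S.SC p w ∧ sg (S.σ w) = sg w
    · obtain ⟨w, hw, he⟩ := hw
      have hd : S.Dir S.σ := Or.inl rfl
      have s1 := hw.trans (hd.sc w)
      have s2 := s1.trans (hd.sc _)
      have s3 := s2.trans (hd.sc _)
      refine c.fire (s := sg w) hd hw rfl rfl rfl (nd4 (hZ.good p hpZ) hw hd) (hsg w hw).2
        (Or.inl ⟨hall w hw, (hsg w hw).1⟩) (Or.inl ⟨hall _ s1, he ▸ (hsg _ s1).1⟩) ?_ ?_ ?_
      · exact fun h => absurd (mem_rest.1 h).1 (hall w hw)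
      · exact fun h => ex_ne (hL _ (hZ.cl _ _ s2 hpZ) h) _
      · exact fun h => ex_ne (hL _ (hZ.cl _ _ s3 hpZ) h) _
    · exfalso
      push Not at hw
      obtain ⟨n, hn, hnp⟩ := hZ.odd p hpZ
      refine alternate (S := S) n hn sg p (hsg p .rfl).2 ?_ hnp
      intro i
      have hi : S.SC p ((S.σ ^ i) p) := ⟨i, by simp⟩
      have h1 := hw _ hi
      have h2 := (hsg _ hi).2
      have h3 := (hsg _ (hi.trans (Dir.sc (Or.inl rfl) _))).2
      rw [pow_succ', Perm.mul_apply]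
      revert h1 h2 h3
      cases sg ((S.σ ^ i) p) <;> cases sg (S.σ ((S.σ ^ i) p)) <;> decide
  · -- adjacent port / nonport
    obtain ⟨v0, d, hd, hv0p, hm0, hm1⟩ : ∃ w d, S.Dir d ∧ S.SC p w ∧ S.μ w ∉ Z ∧ S.μ (d w) ∈ Z := by
      by_contra hcon
      push Not at hcon
      apply hall
      intro u hu
      exact sc_induct (S := S) (fun u => S.μ u ∉ Z) hpm
        (fun d hd w hw h => hcon w d hd hw h) hu
    have hv0 := hZ.cl _ _ hv0p hpZ
    have c : S.Ctx Z L v0 := ⟨hZ, IH, hv0, fun q hq _ hm => hL q hq hm, fun q hq _ hm =>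
      Finset.card_pos.1 (by have := hL q hq hm; omega)⟩
    by_cases hbr : ∃ v, S.SC v0 v ∧ S.μ v ∈ S.rest Z v0 ∧ S.NoPart Z v0 v
    · obtain ⟨v, h1, h2, h3⟩ := hbr
      exact (bridge_mk hZ hc hv0 h1 h2 h3).redA IH hL
    have hHP : ∀ v, S.SC v0 v → S.HP Z v0 v := by
      intro v hv hm
      by_contra hno
      refine hbr ⟨v, hv, hm, fun v' h1 h2 h3 h4 => hno ⟨v', h1, h2, h3, h4⟩⟩
    have hg : ∀ s : SignType, ∀ g, S.SC v0 g → S.μ g ∉ Z → ∃ a ∈ L g, a ≠ s :=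
      fun s g hg hm => ex_ne (hL g (hZ.cl _ _ hg hv0) hm) s
    obtain ⟨s, hsL, hs⟩ := ex_nonzero (hL v0 hv0 hm0)
    rcases hZ.good v0 hv0 with hP | hLg
    · obtain ⟨a1, a2, a3, a4, pd⟩ := hP.pd hd
      rw [pd.e0] at hm1
      have m1 := c.block_of_pent pd pd.sc1 hm1
      by_cases h1 : (S.μ a2 ∈ S.rest Z v0 ∧ S.Conn (S.rest Z v0) (S.μ a1) (S.μ a2)) ∨
        (S.μ a4 ∈ S.rest Z v0 ∧ S.Conn (S.rest Z v0) (S.μ a1) (S.μ a4))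
      · exact c.fire01 pd .rfl hs hm0 hsL m1 h1 (fun g h1 _ h2 => hg s g h1 h2)
      · obtain ⟨m3, c13⟩ := (Ctx.part_pent pd hm0 m1 (hHP _ pd.sc1)).resolve_left h1
        by_cases hp2 : S.μ a2 ∈ Z
        · have m2 := c.block_of_pent pd pd.sc2 hp2
          obtain ⟨v', k1, k2, k3, k4⟩ := hHP a2 pd.sc2 m2
          have n12 : ¬ S.Conn (S.rest Z v0) (S.μ a1) (S.μ a2) := fun h => h1 (Or.inl ⟨m2, h⟩)
          rcases pd.all k1 with h | h | h | h | h <;> subst h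
          · exact absurd (mem_rest.1 k3).1 hm0
          · exact absurd k4.symm n12
          · exact absurd rfl k2
          · exact absurd (c13.trans k4.symm) n12
          · obtain ⟨ρ, hρ, H⟩ := c.cross pd hm0 m1 m2 m3 k3 c13 k4 n12
            refine H L (fun q hq hm => hL q (mem_rest.1 hq).1 hm) (fun _ _ _ _ => rfl) ?_
            exact hg ρ _ .rfl hm0
        · obtain ⟨s, hsL, hs⟩ := ex_nonzero (hL a2 (hZ.cl _ _ pd.sc2 hv0) hp2)
          exact c.fire21 pd .rfl hs hp2 hsL m1 m3 c13 (hg s _ .rfl) (hg s _ pd.sc4)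
    · exact c.fire7P hLg hd .rfl hs hm0 hsL (hHP _ (hd.sc _)) hm1 (fun g h1 _ h2 => hg s g h1 h2)

end CSys

open Equiv
namespace CSys
open Classical
variable {V : Type*} {S : CSys V}
variable {d : Perm V} {a0 a1 a2 a3 a4 v0 : V} {Z : Finset V} {L : V → Finset SignType}

theorem strict_list {A : Finset SignType} {s : SignType} (h : 2 ≤ A.card) (hs : s ∉ A) (h0 : s ≠ 0) :
    0 ∈ A ∧ -s ∈ A := by
  have key : ∀ A : Finset SignType, ∀ s : SignType, 2 ≤ A.card → s ∉ A → s ≠ 0 → 0 ∈ A ∧ -s ∈ A := by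
    decide
  exact key A s h hs h0

theorem attach (hZ : S.Zok Z) (hc : S.Cn Z) (hv0 : v0 ∈ Z) {q : V} (hq : q ∈ S.rest Z v0) :
    ∃ v, S.SC v0 v ∧ S.μ v ∈ S.rest Z v0 ∧ S.Conn (S.rest Z v0) (S.μ v) q := by
  by_contra hno
  have key : ∀ u, S.Conn Z q u → u ∈ S.rest Z v0 ∧ S.Conn (S.rest Z v0) q u := by
    intro u hu
    induction hu with
    | refl => exact ⟨hq, .rfl⟩
    | @tail b c _ h2 ih =>
      obtain ⟨i1, i2⟩ := ih
      have hcR : c ∈ S.rest Z v0 := by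
        rcases h2.2.2 with h | h
        · exact (hZ.rest v0).cl _ _ h i1
        · by_contra hcR
          have : S.SC v0 c := by
            by_contra h'; exact hcR (mem_rest.2 ⟨h2.2.1, h'⟩)
          have hb : S.μ c = b := by rw [h, S.μμ]
          exact hno ⟨c, this, hb ▸ i1, hb ▸ i2.symm⟩
      exact ⟨hcR, i2.tail ⟨i1, hcR, h2.2.2⟩⟩
  exact (mem_rest.1 (key v0 (hc.conn (mem_rest.1 hq).1 hv0)).1).2 .rfl

/-- class of v contains a rich port -/
def Rich (S : CSys V) (Z : Finset V) (L : V → Finset SignType) (v0 v : V) : Prop :=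
  S.μ v ∈ S.rest Z v0 ∧ ∃ q ∈ S.rest Z v0, S.μ q ∉ Z ∧ S.Conn (S.rest Z v0) (S.μ v) q ∧
    1 ∈ L q ∧ -1 ∈ L q

theorem Rich.fok {v : V} (h : S.Rich Z L v0 v) (F : List V) (s : SignType) :
    S.FOK Z L v0 F s v := Or.inr (Or.inr ⟨h.1, Or.inr (Or.inl h.2)⟩)

theorem Rich.congr {v v' : V} (h : S.Rich Z L v0 v) (h' : S.μ v' ∈ S.rest Z v0)
    (hc : S.Conn (S.rest Z v0) (S.μ v) (S.μ v')) : S.Rich Z L v0 v' := by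
  obtain ⟨h1, q, h2, h3, h4, h5⟩ := h
  exact ⟨h', q, h2, h3, hc.symm.trans h4, h5⟩

theorem sign_pm {s : SignType} (hs : s ≠ 0) {A : Finset SignType} (h1 : 1 ∈ A) (h2 : -1 ∈ A) :
    s ∈ A := by
  cases s
  · exact absurd rfl hs
  · exact h2
  · exact h1

/-- data for case B -/
structure CtxB (S : CSys V) (Z : Finset V) (L : V → Finset SignType) (v0 : V) (s : SignType) : Prop where
  c : S.Ctx Z L v0
  hm0 : S.μ v0 ∉ Z
  hs : s ≠ 0
  hsL : s ∈ L v0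
  hL : ∀ q ∈ Z, S.μ q ∉ Z → q ≠ v0 → 2 ≤ (L q).card
  hHP : ∀ v, S.SC v0 v → S.HP Z v0 v

variable {s : SignType}

theorem CtxB.hgA (b : S.CtxB Z L v0 s) (t : SignType) (g : V) (hg : S.SC v0 g) (hgv : g ≠ v0)
    (hm : S.μ g ∉ Z) : ∃ a ∈ L g, a ≠ t :=
  ex_ne (b.hL g (b.c.hZ.cl _ _ hg b.c.hv0) hm hgv) t

theorem CtxB.hg0 (b : S.CtxB Z L v0 s) (g : V) (hg : S.SC v0 g)
    (hm : S.μ g ∉ Z) : ∃ a ∈ L g, a ≠ -s := by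
  by_cases h : g = v0
  · subst h
    refine ⟨s, b.hsL, ?_⟩
    have := b.hs
    revert this; cases s <;> decide
  · exact b.hgA _ g hg h hm

theorem CtxB.neg_ne (b : S.CtxB Z L v0 s) : -s ≠ 0 := by
  have := b.hs
  revert this; cases s <;> decide

/-- fire at v0 and its neighbour -/
theorem CtxB.nb (b : S.CtxB Z L v0 s) (hd : S.Dir d)
    (h : S.FOK Z L v0 [v0, d v0, d (d v0), d (d (d v0))] s (d v0)) : ∃ x, S.Sol Z L x := by
  have nd := nd4 (b.c.hZ.good v0 b.c.hv0) (SC.rfl (a := v0)) hd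
  have s1 := hd.sc v0
  have s2 := s1.trans (hd.sc _)
  have s3 := s2.trans (hd.sc _)
  refine b.c.fire hd .rfl rfl rfl rfl nd b.hs (Or.inl ⟨b.hm0, b.hsL⟩) h ?_ ?_ ?_
  · exact fun h => absurd (mem_rest.1 h).1 b.hm0
  all_goals
    simp only [List.nodup_cons, List.mem_cons, List.not_mem_nil, or_false, not_or] at nd
  · exact b.hgA _ _ s2 (fun h => nd.1.2.1 h.symm)
  · exact b.hgA _ _ s3 (fun h => nd.1.2.2 h.symm)

theorem CtxB.g21 (b : S.CtxB Z L v0 s) (hd : S.Dir d) (p1 : S.μ (d v0) ∉ Z) (l1 : -s ∈ L (d v0))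
    (p4 : S.μ (d⁻¹ v0) ∉ Z) (h2 : S.μ (d (d v0)) ∈ Z ∨ -s ∈ L (d (d v0))) : ∃ x, S.Sol Z L x := by
  have s1 := hd.sc v0
  have s2 := s1.trans (hd.sc _)
  have nd := nd4 (b.c.hZ.good v0 b.c.hv0) s2 hd.inv
  have i1 : d⁻¹ (d (d v0)) = d v0 := by simp
  have i2 : d⁻¹ (d v0) = v0 := by simp
  rw [i1, i2] at nd
  refine b.c.fire hd.inv s2 i1 i2 rfl nd b.neg_ne ?_ (Or.inl ⟨p1, l1⟩) ?_ ?_ ?_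
  · by_cases hz : S.μ (d (d v0)) ∈ Z
    · obtain ⟨m, m1, m2, m3, m4, -⟩ := mate (L := L) b.c.hv0 b.c.hZ (b.hHP _ s2) s2 hz
      apply m4
      simp only [List.mem_cons, List.not_mem_nil, or_false, not_or]
      refine ⟨m2, ?_, ?_, ?_⟩
      · rintro rfl; exact p1 m3
      · rintro rfl; exact b.hm0 m3
      · rintro rfl; exact p4 m3
    · exact Or.inl ⟨hz, h2.resolve_left hz⟩
  · exact fun _ h => absurd (mem_rest.1 h).1 p1
  · exact b.hg0 _ .rfl
  · exact b.hg0 _ (hd.inv.sc v0)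

theorem CtxB.long (b : S.CtxB Z L v0 s) (hc : S.Cn Z) (hl : S.Long v0)
    (ht : (∃ q ∈ Z, S.μ q ∉ Z ∧ q ≠ v0 ∧ 1 ∈ L q ∧ -1 ∈ L q) ∨
   (∀ q ∈ Z, S.μ q ∉ Z → q ≠ v0 → 0 ∈ L q ∧ -s ∈ L q) ∨
   (∀ q ∈ Z, S.μ q ∉ Z → q ≠ v0 → 0 ∈ L q ∧ s ∈ L q)) : ∃ x, S.Sol Z L x := by
  by_contra hno
  have hnb : ∀ d, S.Dir d → S.μ (d v0) ∉ Z ∧ s ∉ L (d v0) := by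
    intro d hd
    have p1 : S.μ (d v0) ∉ Z := by
      intro h
      exact hno (b.c.fire7P hl hd .rfl b.hs b.hm0 b.hsL (b.hHP _ (hd.sc _)) h
        (fun g h1 h2 h3 => b.hgA _ g h1 h2 h3))
    exact ⟨p1, fun h => hno (b.nb hd (Or.inl ⟨p1, h⟩))⟩
  have hneq : ∀ d, S.Dir d → d v0 ≠ v0 ∧ d (d v0) ≠ v0 := by
    intro d hd
    have := hl.nd4 (SC.rfl (a := v0)) hd
    simp only [List.nodup_cons, List.mem_cons, List.not_mem_nil, or_false, not_or] at this
    exact ⟨fun h => this.1.1 h.symm, fun h => this.1.2.1 h.symm⟩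
  have zz : ∀ u, S.SC v0 u → u ∈ Z := fun u hu => b.c.hZ.cl _ _ hu b.c.hv0
  have hd : S.Dir S.σ := Or.inl rfl
  rcases ht with ⟨q, q1, q2, q3, q4, q5⟩ | h | h
  · let Fl : V → Prop := fun u => (S.μ u ∉ Z ∧ u ≠ v0 ∧ 1 ∈ L u ∧ -1 ∈ L u) ∨ S.Rich Z L v0 u
    have flok : ∀ u, Fl u → ∀ F t, t ≠ 0 → S.FOK Z L v0 F t u := by
      rintro u (h | h) F t ht
      · exact Or.inl ⟨h.1, sign_pm ht h.2.2.1 h.2.2.2⟩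
      · exact h.fok F t
    have hex : ∃ u, S.SC v0 u ∧ Fl u := by
      by_cases hq : S.SC v0 q
      · exact ⟨q, hq, Or.inl ⟨q2, q3, q4, q5⟩⟩
      · have hqW : q ∈ S.rest Z v0 := mem_rest.2 ⟨q1, hq⟩
        obtain ⟨v, h1, h2, h3⟩ := attach b.c.hZ hc b.c.hv0 hqW
        exact ⟨v, h1, Or.inr ⟨h2, q, hqW, q2, h3, q4, q5⟩⟩
    obtain ⟨u, hu, hFu⟩ := hex
    have : ∃ d w, S.Dir d ∧ S.SC v0 w ∧ ¬ Fl w ∧ Fl (d w) := by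
      by_contra hcon
      push Not at hcon
      refine sc_induct (S := S) (fun u => ¬ Fl u) ?_ (fun d hd w hw h => hcon d w hd hw h) hu hFu
      rintro (h | h)
      · exact h.2.1 rfl
      · exact b.hm0 (mem_rest.1 h.1).1
    obtain ⟨d, w, hd, hw, hnw, hF⟩ := this
    by_cases hwv : w = v0
    · subst hwv
      exact hno (b.nb hd (flok _ hF _ _ b.hs))
    have hdw := hl d hd w hw
    simp only [List.nodup_cons, List.mem_cons, List.not_mem_nil, or_false, not_or] at hdw
    by_cases hwp : S.μ w ∈ Z
    · obtain ⟨m, m1, m2, m3, m4, m5⟩ := mate (L := L) b.c.hv0 b.c.hZ (b.hHP _ hw) hw hwp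
      have nc : S.μ w ∈ S.rest Z v0 → S.μ (d w) ∈ S.rest Z v0 →
          ¬ S.Conn (S.rest Z v0) (S.μ w) (S.μ (d w)) := by
        intro h1 h2 h3
        rcases hF with h | h
        · exact h.1 (mem_rest.1 h2).1
        · exact hnw (Or.inr (h.congr h1 h3.symm))
      refine hno (b.c.fire7 hl hd hw b.neg_ne (t := m) m2 ?_ (fun F h => m4 F _ h)
        (fun F _ => flok _ hF F _ b.neg_ne) nc (fun g g1 _ _ _ g2 => b.hg0 g g1 g2))
      rintro rfl
      rcases m5 with h | h
      · exact hd.mu_ne w h.symm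
      · exact nc h.1 h.2.1 h.2.2
    · obtain ⟨t, ht, ht0⟩ := ex_nonzero (b.hL w (zz w hw) hwp hwv)
      have hdv : d w ≠ v0 := by
        intro h
        rw [h] at hF
        rcases hF with h | h
        · exact h.2.1 rfl
        · exact b.hm0 (mem_rest.1 h.1).1
      refine hno (b.c.fire7 hl hd hw ht0 (t := v0) (Ne.symm hwv) hdv.symm (fun F _ => Or.inl ⟨hwp, ht⟩)
        (fun F _ => flok _ hF F _ ht0) (fun h => absurd (mem_rest.1 h).1 hwp) ?_)
      exact fun g g1 g2 _ _ g3 => b.hgA _ g g1 g2 g3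
  · obtain ⟨p1, l1⟩ := hnb _ hd
    obtain ⟨p4, l4⟩ := hnb _ hd.inv
    refine hno (b.g21 hd p1 (h _ (zz _ (hd.sc _)) p1 (hneq _ hd).1).2 p4 ?_)
    by_cases hz : S.μ (S.σ (S.σ v0)) ∈ Z
    · exact Or.inl hz
    · exact Or.inr (h _ (zz _ ((hd.sc _).trans (hd.sc _))) hz (hneq _ hd).2).2
  · obtain ⟨p1, l1⟩ := hnb _ hd
    exact l1 (h _ (zz _ (hd.sc _)) p1 (hneq _ hd).1).2

/-- what an unsolvable pentagon looks like at a neighbour of the special port -/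
theorem CtxB.pnb (b : S.CtxB Z L v0 s) (hno : ¬ ∃ x, S.Sol Z L x) (pd : S.PD d v0 a1 a2 a3 a4) :
    (S.μ a1 ∉ Z ∧ s ∉ L a1 ∧ 0 ∈ L a1 ∧ -s ∈ L a1) ∨
    (S.μ a1 ∈ S.rest Z v0 ∧ S.μ a3 ∈ S.rest Z v0 ∧ S.Conn (S.rest Z v0) (S.μ a1) (S.μ a3) ∧
      ¬ (S.μ a2 ∈ S.rest Z v0 ∧ S.Conn (S.rest Z v0) (S.μ a1) (S.μ a2)) ∧
      ¬ (S.μ a4 ∈ S.rest Z v0 ∧ S.Conn (S.rest Z v0) (S.μ a1) (S.μ a4)) ∧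
      ¬ S.Rich Z L v0 a1 ∧
      ¬ (∀ q ∈ Z, S.μ q ∉ Z → q ≠ v0 → 0 ∈ L q ∧ -s ∈ L q)) := by
  have nd := pd.nd
  simp only [List.nodup_cons, List.mem_cons, List.not_mem_nil, or_false, not_or] at nd
  have nb := b.nb pd.hd
  rw [pd.e0] at nb
  by_cases hz : S.μ a1 ∈ Z
  · right
    have m1 := b.c.block_of_pent pd pd.sc1 hz
    have hpp : ¬ ((S.μ a2 ∈ S.rest Z v0 ∧ S.Conn (S.rest Z v0) (S.μ a1) (S.μ a2)) ∨
            (S.μ a4 ∈ S.rest Z v0 ∧ S.Conn (S.rest Z v0) (S.μ a1) (S.μ a4))) := by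
      intro h
      exact hno (b.c.fire01 pd .rfl b.hs b.hm0 b.hsL m1 h (fun g g1 g2 g3 => b.hgA _ g g1 g2 g3))
    obtain ⟨m3, c13⟩ := (Ctx.part_pent pd b.hm0 m1 (b.hHP _ pd.sc1)).resolve_left hpp
    push Not at hpp
    refine ⟨m1, m3, c13, fun h => hpp.1 h.1 h.2, fun h => hpp.2 h.1 h.2,
      fun h => hno (nb (h.fok _ _)), fun h => hno (nb (Or.inr (Or.inr ⟨m1, Or.inr (Or.inr ?_)⟩)))⟩
    intro q hq hm _
    refine h q (mem_rest.1 hq).1 hm ?_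
    rintro rfl
    exact (mem_rest.1 hq).2 .rfl
  · left
    have hs1 : s ∉ L a1 := fun h => hno (nb (Or.inl ⟨hz, h⟩))
    exact ⟨hz, hs1, strict_list (b.hL a1 (b.c.hZ.cl _ _ pd.sc1 b.c.hv0) hz (fun h => nd.1.1 h.symm)) hs1 b.hs⟩

theorem CtxB.pF (b : S.CtxB Z L v0 s) (hc : S.Cn Z) (hno : ¬ ∃ x, S.Sol Z L x)
    (pd : S.PD d v0 a1 a2 a3 a4)
    (m1 : S.μ a1 ∈ S.rest Z v0) (p4 : S.μ a4 ∉ Z) (l4 : s ∉ L a4) (hnr : ¬ S.Rich Z L v0 a1)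
    (m3 : S.μ a3 ∈ S.rest Z v0) (c13 : S.Conn (S.rest Z v0) (S.μ a1) (S.μ a3))
    (n12 : ¬ (S.μ a2 ∈ S.rest Z v0 ∧ S.Conn (S.rest Z v0) (S.μ a1) (S.μ a2)))
    (ht : ∃ q ∈ Z, S.μ q ∉ Z ∧ q ≠ v0 ∧ 1 ∈ L q ∧ -1 ∈ L q) : False := by
  have p2 : S.μ a2 ∉ Z := by
    intro h
    have m2 := b.c.block_of_pent pd pd.sc2 h
    obtain ⟨v', h1, h2, h3, h4⟩ := b.hHP a2 pd.sc2 m2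
    rcases pd.all h1 with h | h | h | h | h <;> subst h
    · exact b.hm0 (mem_rest.1 h3).1
    · exact n12 ⟨m2, h4.symm⟩
    · exact h2 rfl
    · exact n12 ⟨m2, c13.trans h4.symm⟩
    · exact p4 (mem_rest.1 h3).1
  obtain ⟨q, q1, q2, q3, q4, q5⟩ := ht
  by_cases hq : S.SC v0 q
  · rcases pd.all hq with h | h | h | h | h <;> subst h
    · exact q3 rfl
    · exact q2 (mem_rest.1 m1).1
    · exact hno (b.c.fire21 pd .rfl b.neg_ne p2 (sign_pm b.neg_ne q4 q5) m1 m3 c13 (b.hg0 _ .rfl)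
        (b.hg0 _ pd.sc4))
    · exact q2 (mem_rest.1 m3).1
    · exact l4 (sign_pm b.hs q4 q5)
  · have hqW : q ∈ S.rest Z v0 := mem_rest.2 ⟨q1, hq⟩
    obtain ⟨v, h1, h2, h3⟩ := attach b.c.hZ hc b.c.hv0 hqW
    have hr : S.Rich Z L v0 v := ⟨h2, q, hqW, q2, h3, q4, q5⟩
    rcases pd.all h1 with h | h | h | h | h <;> subst h
    · exact b.hm0 (mem_rest.1 h2).1
    · exact hnr hr
    · exact p2 (mem_rest.1 h2).1
    · exact hnr (hr.congr m1 c13.symm)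
    · exact p4 (mem_rest.1 h2).1

theorem CtxB.pent (b : S.CtxB Z L v0 s) (hc : S.Cn Z) (hl : S.Pent v0)
    (ht : (∃ q ∈ Z, S.μ q ∉ Z ∧ q ≠ v0 ∧ 1 ∈ L q ∧ -1 ∈ L q) ∨
   (∀ q ∈ Z, S.μ q ∉ Z → q ≠ v0 → 0 ∈ L q ∧ -s ∈ L q) ∨
   (∀ q ∈ Z, S.μ q ∉ Z → q ≠ v0 → 0 ∈ L q ∧ s ∈ L q)) : ∃ x, S.Sol Z L x := by
  by_contra hno
  have hd : S.Dir S.σ := Or.inl rfl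
  obtain ⟨a1, a2, a3, a4, pd⟩ := hl.pd hd
  have nd := pd.nd
  simp only [List.nodup_cons, List.mem_cons, List.not_mem_nil, or_false, not_or] at nd
  obtain ⟨⟨n01, n02, n03, n04⟩, -⟩ := nd
  have zz : ∀ u, S.SC v0 u → u ∈ Z := fun u hu => b.c.hZ.cl _ _ hu b.c.hv0
  have k1 := b.pnb hno pd
  have k4 := b.pnb hno pd.flip
  have g1 := b.g21 pd.hd
  rw [pd.e0, pd.e1, pd.flip.e0] at g1
  have g4 := b.g21 pd.flip.hd
  rw [pd.flip.e0, pd.flip.e1, inv_inv, pd.e0] at g4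
  rcases k1 with ⟨p1, ls1, l10, l1⟩ | ⟨m1, m3, c13, n12, n14, nr1, nM⟩ <;>
  rcases k4 with ⟨p4, ls4, l40, l4⟩ | ⟨m4, m2, c42, n43, n41, nr4, nM'⟩
  · -- both strict ports
    have G1 : ¬ (S.μ a2 ∈ Z ∨ -s ∈ L a2) := fun h => hno (g1 p1 l1 p4 h)
    have G4 : ¬ (S.μ a3 ∈ Z ∨ -s ∈ L a3) := fun h => hno (g4 p4 l4 p1 h)
    push Not at G1 G4
    rcases ht with ⟨q, q1, q2, q3, q4, q5⟩ | h | h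
    · by_cases hq : S.SC v0 q
      · rcases pd.all hq with h | h | h | h | h <;> subst h
        · exact q3 rfl
        · exact ls1 (sign_pm b.hs q4 q5)
        · exact G1.2 (sign_pm b.neg_ne q4 q5)
        · exact G4.2 (sign_pm b.neg_ne q4 q5)
        · exact ls4 (sign_pm b.hs q4 q5)
      · have hqW : q ∈ S.rest Z v0 := mem_rest.2 ⟨q1, hq⟩
        obtain ⟨v, h1, h2, h3⟩ := attach b.c.hZ hc b.c.hv0 hqW
        have h2' := (mem_rest.1 h2).1
        rcases pd.all h1 with h | h | h | h | h <;> subst h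
        · exact b.hm0 h2'
        · exact p1 h2'
        · exact G1.1 h2'
        · exact G4.1 h2'
        · exact p4 h2'
    · exact G1.2 (h a2 (zz _ pd.sc2) G1.1 (Ne.symm n02)).2
    · exact ls1 (h a1 (zz _ pd.sc1) p1 (Ne.symm n01)).2
  · rcases ht with h | h | h
    · exact b.pF hc hno pd.flip m4 p1 ls1 nr4 m2 c42 n43 h
    · exact nM' h
    · exact ls1 (h a1 (zz _ pd.sc1) p1 (Ne.symm n01)).2
  · rcases ht with h | h | h
    · exact b.pF hc hno pd m1 p4 ls4 nr1 m3 c13 n12 h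
    · exact nM h
    · exact ls4 (h a4 (zz _ pd.sc4) p4 (Ne.symm n04)).2
  · rcases ht with ⟨q, q1, q2, q3, q4, q5⟩ | h | h
    · by_cases hq : S.SC v0 q
      · rcases pd.all hq with h | h | h | h | h <;> subst h
        · exact q3 rfl
        · exact q2 (mem_rest.1 m1).1
        · exact q2 (mem_rest.1 m2).1
        · exact q2 (mem_rest.1 m3).1
        · exact q2 (mem_rest.1 m4).1
      · have hqW : q ∈ S.rest Z v0 := mem_rest.2 ⟨q1, hq⟩
        obtain ⟨v, h1, h2, h3⟩ := attach b.c.hZ hc b.c.hv0 hqW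
        have hr : S.Rich Z L v0 v := ⟨h2, q, hqW, q2, h3, q4, q5⟩
        rcases pd.all h1 with h | h | h | h | h <;> subst h
        · exact b.hm0 (mem_rest.1 h2).1
        · exact nr1 hr
        · exact nr4 (hr.congr m4 c42.symm)
        · exact nr1 (hr.congr m1 c13.symm)
        · exact nr4 hr
    · exact nM h
    · refine hno (b.c.fireP pd.flip.rot.rot.rot pd.sc2 b.neg_ne ?_ ?_ ?_ (b.hg0 _ .rfl) (b.hg0 _ pd.sc4))
      · refine Or.inr (Or.inr ⟨m2, Or.inr (Or.inr ?_)⟩)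
        intro q hq hm _
        rw [neg_neg]
        refine h q (mem_rest.1 hq).1 hm ?_
        rintro rfl
        exact (mem_rest.1 hq).2 .rfl
      · refine Or.inr (Or.inr ⟨m1, Or.inl ⟨a3, pd.sc3, ?_, m3, c13⟩⟩)
        have := pd.nd
        simp at this ⊢; grind
      · exact fun _ _ h => n12 ⟨m2, h.symm⟩

theorem stepB (hZ : S.Zok Z) (hc : S.Cn Z)
    (IH : ∀ K : Finset V, K.card < Z.card → S.MC K) : S.MCB Z := by
  intro L v0 s hv0 hm0 hs hsL hL ht
  by_cases hbr : ∃ v, S.SC v0 v ∧ S.μ v ∈ S.rest Z v0 ∧ S.NoPart Z v0 v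
  · obtain ⟨v, h1, h2, h3⟩ := hbr
    exact (bridge_mk hZ hc hv0 h1 h2 h3).redB IH hm0 hs hsL hL ht
  have hHP : ∀ v, S.SC v0 v → S.HP Z v0 v := by
    intro v hv hm
    by_contra hno
    refine hbr ⟨v, hv, hm, fun v' h1 h2 h3 h4 => hno ⟨v', h1, h2, h3, h4⟩⟩
  have c : S.Ctx Z L v0 := by
    refine ⟨hZ, IH, hv0, fun q hq hsc hm => hL q hq hm ?_, fun q hq _ hm => ?_⟩
    · rintro rfl; exact hsc .rfl
    · by_cases h : q = v0
      · subst h; exact ⟨s, hsL⟩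
      · exact Finset.card_pos.1 (by have := hL q hq hm h; omega)
  have b : S.CtxB Z L v0 s := ⟨c, hm0, hs, hsL, hL, hHP⟩
  rcases hZ.good v0 hv0 with h | h
  · exact b.pent hc h ht
  · exact b.long hc h ht

end CSys

open Equiv
namespace CSys
open Classical
variable {V : Type*} {S : CSys V}
variable {d : Perm V} {a0 a1 a2 a3 a4 v0 p : V} {Z : Finset V} {L : V → Finset SignType}

theorem neg_ne0 {s : SignType} (h : s ≠ 0) : -s ≠ 0 := by revert s; decide
theorem neg_ne_self {s : SignType} (h : s ≠ 0) : -s ≠ s := by revert s; decide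

noncomputable def LH (L : V → Finset SignType) (p q : V) (τ : SignType) (u : V) : Finset SignType :=
  if u = q then {τ} else if u = p then Finset.univ \ {τ} else L u

structure CtxH (S : CSys V) (Z : Finset V) (L : V → Finset SignType) (p v0 : V) : Prop where
  hZ : S.Zok Z
  hc : S.Cn Z
  IH : ∀ K : Finset V, K.card < Z.card → S.MC K
  hv0 : v0 ∈ Z
  hm0 : S.μ v0 ∉ Z
  hp : p ∈ Z
  hmp : S.μ p ∉ Z
  hpq : p ≠ v0
  hL : ∀ u ∈ Z, S.μ u ∉ Z → u ≠ p → u ≠ v0 → 2 ≤ (L u).card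
  nb : ∀ v v', S.SC v0 v → S.SC v0 v' → v ≠ v' → (v ≠ p ∧ S.HP Z v0 v) ∨ (v' ≠ p ∧ S.HP Z v0 v')

theorem CtxH.card (b : S.CtxH Z L p v0) (τ : SignType) (u : V) (hu : u ∈ Z) (hm : S.μ u ∉ Z)
    (h : u ≠ v0) : 2 ≤ (LH L p v0 τ u).card := by
  unfold LH
  rw [if_neg h]
  split_ifs with hp
  · revert τ; decide
  · exact b.hL u hu hm hp h

theorem CtxH.c (b : S.CtxH Z L p v0) (τ : SignType) : S.Ctx Z (LH L p v0 τ) v0 := by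
  refine ⟨b.hZ, b.IH, b.hv0, fun q hq hs hm => b.card τ q hq hm ?_, fun q hq hs hm => ?_⟩
  · rintro rfl; exact hs .rfl
  · by_cases h : q = v0
    · subst h; simp [LH]
    · exact Finset.card_pos.1 (by have := b.card τ q hq hm h; omega)

theorem CtxH.hg (b : S.CtxH Z L p v0) (τ s : SignType) (g : V) (hg : S.SC v0 g) (hne : g ≠ v0)
    (hm : S.μ g ∉ Z) : ∃ a ∈ LH L p v0 τ g, a ≠ s :=
  ex_ne (b.card τ g (b.hZ.cl _ _ hg b.hv0) hm hne) s

def Win (S : CSys V) (Z : Finset V) (L : V → Finset SignType) (p v0 : V) : Prop :=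
  ∃ τ : SignType, τ ≠ 0 ∧ ∃ x, S.Sol Z (LH L p v0 τ) x

theorem CtxH.port (b : S.CtxH Z L p v0) (hd : S.Dir d) (hg : S.Pent v0 ∨ S.Long v0)
    (hp : d v0 ≠ p) (hm : S.μ (d v0) ∉ Z) : S.Win Z L p v0 := by
  have hnd := nd4 hg .rfl hd
  have nd := hnd
  simp only [List.nodup_cons, List.mem_cons, List.not_mem_nil, or_false, not_or] at nd
  obtain ⟨⟨n01, n02, n03⟩, -⟩ := nd
  have s1 := hd.sc (S := S) v0
  have s2 := s1.trans (hd.sc _)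
  have s3 := s2.trans (hd.sc _)
  obtain ⟨τ, h1, h2⟩ := ex_nonzero (b.hL _ (b.hZ.cl _ _ s1 b.hv0) hm hp (Ne.symm n01))
  refine ⟨τ, h2, (b.c τ).fire hd .rfl rfl rfl rfl hnd h2 (Or.inl ⟨b.hm0, ?_⟩) (Or.inl ⟨hm, ?_⟩)
    ?_ (b.hg _ _ _ s2 (Ne.symm n02)) (b.hg _ _ _ s3 (Ne.symm n03))⟩
  · simp [LH]
  · simp only [LH]; rw [if_neg (Ne.symm n01), if_neg hp]; exact h1
  · exact fun h => absurd (mem_rest.1 h).1 b.hm0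

theorem CtxH.long (b : S.CtxH Z L p v0) (hl : S.Long v0) : S.Win Z L p v0 := by
  have key : ∀ d, S.Dir d → d v0 ≠ p → S.HP Z v0 (d v0) → S.Win Z L p v0 := by
    intro d hd h1 h2
    by_cases hm : S.μ (d v0) ∈ Z
    · exact ⟨1, by decide, (b.c 1).fire7P (s := 1) hl hd .rfl (by decide) b.hm0 (by simp [LH]) h2 hm
        (b.hg _ _)⟩
    · exact b.port hd (Or.inr hl) h1 hm
  have hd : S.Dir S.σ := Or.inl rfl
  have hnd := hl S.σ hd v0 .rfl
  have hne : S.σ v0 ≠ S.σ⁻¹ v0 := by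
    intro h; simp [h] at hnd
  rcases b.nb _ _ (hd.sc v0) (hd.inv.sc v0) hne with h | h
  · exact key _ hd h.1 h.2
  · exact key _ hd.inv h.1 h.2

def E13 (S : CSys V) (Z : Finset V) (v0 a1 a2 a3 a4 : V) : Prop :=
  S.μ a1 ∈ S.rest Z v0 ∧ S.μ a3 ∈ S.rest Z v0 ∧ S.Conn (S.rest Z v0) (S.μ a1) (S.μ a3) ∧
      ¬ (S.μ a2 ∈ S.rest Z v0 ∧ S.Conn (S.rest Z v0) (S.μ a1) (S.μ a2)) ∧
      ¬ (S.μ a4 ∈ S.rest Z v0 ∧ S.Conn (S.rest Z v0) (S.μ a1) (S.μ a4))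

theorem CtxH.pnb (b : S.CtxH Z L p v0) (hno : ¬ S.Win Z L p v0) (hl : S.Pent v0)
    (pd : S.PD d v0 a1 a2 a3 a4) (h1 : a1 ≠ p) (h2 : S.HP Z v0 a1) :
    S.E13 Z v0 a1 a2 a3 a4 := by
  by_cases hm : S.μ a1 ∈ Z
  · have hm' := (b.c 1).block_of_pent pd pd.sc1 hm
    have hf := fun hpar => hno ⟨1, by decide, (b.c 1).fire01 (s := 1) pd .rfl (by decide) b.hm0 (by simp [LH])
      hm' hpar (b.hg _ _)⟩
    rcases Ctx.part_pent pd b.hm0 hm' h2 with h | h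
    · exact absurd h hf
    · exact ⟨hm', h.1, h.2, fun h => hf (Or.inl h), fun h => hf (Or.inr h)⟩
  · exact absurd (b.port pd.hd (Or.inl hl) (by rw [pd.e0]; exact h1) (by rw [pd.e0]; exact hm)) hno

theorem CtxH.bad1 (b : S.CtxH Z L p v0) (hno : ¬ S.Win Z L p v0) (hl : S.Pent v0)
    (pd : S.PD d v0 a1 a2 a3 a4) (h : ¬ (a1 ≠ p ∧ S.HP Z v0 a1)) : False := by
  have nd := pd.nd
  simp only [List.nodup_cons, List.mem_cons, List.not_mem_nil, or_false, not_or] at nd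
  obtain ⟨⟨n01, n02, n03, n04⟩, ⟨n12, n13, n14⟩, ⟨n23, n24⟩, n34, -⟩ := nd
  have h3 := (b.nb a1 a3 pd.sc1 pd.sc3 n13).resolve_left h
  have h4 := (b.nb a1 a4 pd.sc1 pd.sc4 n14).resolve_left h
  obtain ⟨m4, m2, c42, n43, n41⟩ := b.pnb hno hl pd.flip h4.1 h4.2
  by_cases hm : S.μ a3 ∈ Z
  · have hm' := (b.c 1).block_of_pent pd pd.sc3 hm
    obtain ⟨v', k1, k2, k3, k4⟩ := h3.2 hm'
    rcases pd.all k1 with e | e | e | e | e <;> subst e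
    · exact b.hm0 (mem_rest.1 k3).1
    · apply h
      refine ⟨?_, fun _ => ⟨a3, pd.sc3, Ne.symm n13, hm', k4.symm⟩⟩
      rintro rfl
      exact b.hmp (mem_rest.1 k3).1
    · exact n43 ⟨hm', c42.trans k4.symm⟩
    · exact k2 rfl
    · exact n43 ⟨hm', k4.symm⟩
  · obtain ⟨ρ, r1, r2⟩ := ex_nonzero (b.hL _ (b.hZ.cl _ _ pd.sc3 b.hv0) hm h3.1 (Ne.symm n03))
    have hρ : -ρ ≠ 0 := neg_ne0 r2
    have hρ' : -ρ ≠ ρ := neg_ne_self r2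
    refine hno ⟨-ρ, hρ, (b.c (-ρ)).fire21 pd.rot pd.sc1 (s := ρ) r2 hm ?_ m2 m4 c42.symm
      (b.hg _ _ _ pd.sc1 (Ne.symm n01)) (fun _ => ⟨-ρ, by simp [LH], hρ'⟩)⟩
    simp only [LH]; rw [if_neg (Ne.symm n03), if_neg h3.1]; exact r1

theorem CtxH.bad2 (b : S.CtxH Z L p v0) (hno : ¬ S.Win Z L p v0)
    (pd : S.PD d v0 a1 a2 a3 a4) (h1 : S.E13 Z v0 a1 a2 a3 a4) (h4 : S.E13 Z v0 a4 a3 a2 a1)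
    (hr : p ∈ S.rest Z v0) (hk : S.Conn (S.rest Z v0) (S.μ a1) p) : False := by
  obtain ⟨m1, m3, c13, n12, n14⟩ := h1
  obtain ⟨m4, m2, c42, n43, n41⟩ := h4
  obtain ⟨ρ, r1, r2⟩ := (b.c 1).cross pd b.hm0 m1 m2 m3 m4 c13 c42.symm (fun h => n12 ⟨m2, h⟩)
  have hρ : -ρ ≠ 0 := neg_ne0 r1
  have hρ' : -ρ ≠ ρ := neg_ne_self r1
  refine hno ⟨-ρ, hρ, r2 _ ?_ ?_ ⟨-ρ, by simp [LH], hρ'⟩⟩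
  · intro q hq hm
    refine b.card _ q (mem_rest.1 hq).1 hm ?_
    rintro rfl
    exact (mem_rest.1 hq).2 .rfl
  · intro q hq hm hcq
    have e1 : q ≠ v0 := by rintro rfl; exact (mem_rest.1 hq).2 .rfl
    have e2 : q ≠ p := by rintro rfl; exact n12 ⟨m2, hk.trans hcq.symm⟩
    simp [LH, e1, e2]

theorem CtxH.pent (b : S.CtxH Z L p v0) (hl : S.Pent v0) : S.Win Z L p v0 := by
  by_contra hno
  have hd : S.Dir S.σ := Or.inl rfl
  obtain ⟨a1, a2, a3, a4, pd⟩ := hl.pd hd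
  by_cases h1 : a1 ≠ p ∧ S.HP Z v0 a1
  swap
  · exact b.bad1 hno hl pd h1
  by_cases h4 : a4 ≠ p ∧ S.HP Z v0 a4
  swap
  · exact b.bad1 hno hl pd.flip h4
  have k1 := b.pnb hno hl pd h1.1 h1.2
  have k4 := b.pnb hno hl pd.flip h4.1 h4.2
  have hpo : ¬ S.SC v0 p := by
    intro h
    rcases pd.all h with e | e | e | e | e
    · exact b.hpq e
    · exact b.hmp (e ▸ (mem_rest.1 k1.1).1)
    · exact b.hmp (e ▸ (mem_rest.1 k4.2.1).1)
    · exact b.hmp (e ▸ (mem_rest.1 k1.2.1).1)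
    · exact b.hmp (e ▸ (mem_rest.1 k4.1).1)
  have hr : p ∈ S.rest Z v0 := mem_rest.2 ⟨b.hp, hpo⟩
  obtain ⟨v, q1, q2, q3⟩ := attach b.hZ b.hc b.hv0 hr
  rcases pd.all q1 with h | h | h | h | h <;> subst h
  · exact b.hm0 (mem_rest.1 q2).1
  · exact b.bad2 hno pd k1 k4 hr q3
  · exact b.bad2 hno pd.flip k4 k1 hr (k4.2.2.1.trans q3)
  · exact b.bad2 hno pd k1 k4 hr (k1.2.2.1.trans q3)
  · exact b.bad2 hno pd.flip k4 k1 hr q3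

theorem stepH (hZ : S.Zok Z) (hc : S.Cn Z)
    (IH : ∀ K : Finset V, K.card < Z.card → S.MC K) : S.H5 Z := by
  intro L p v0 hp hmp hv0 hm0 hpq hL
  by_cases hbr : ∃ v, S.SC v0 v ∧ S.μ v ∈ S.rest Z v0 ∧ S.NoPart Z v0 v ∧
      p ∉ S.comp (S.rest Z v0) (S.μ v)
  · obtain ⟨v, h1, h2, h3, h4⟩ := hbr
    exact (bridge_mk hZ hc hv0 h1 h2 h3).redH IH hm0 hp hmp hpq h4 hL
  have hbr' : ∀ v, S.SC v0 v → ¬ S.HP Z v0 v → S.NoPart Z v0 v ∧ S.μ v ∈ S.rest Z v0 ∧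
      p ∈ S.comp (S.rest Z v0) (S.μ v) := by
    intro v hv hm
    have hm' : S.μ v ∈ S.rest Z v0 := by
      by_contra h; exact hm (fun h' => absurd h' h)
    have hn : S.NoPart Z v0 v := fun v' h1 h2 h3 h4 => hm (fun _ => ⟨v', h1, h2, h3, h4⟩)
    refine ⟨hn, hm', ?_⟩
    by_contra h
    exact hbr ⟨v, hv, hm', hn, h⟩
  have b : S.CtxH Z L p v0 := by
    refine ⟨hZ, hc, IH, hv0, hm0, hp, hmp, hpq, hL, ?_⟩
    intro v v' hv hv' hne
    by_contra hcon
    rw [not_or] at hcon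
    have h1 : v = p ∨ ¬ S.HP Z v0 v := by
      by_contra h; push Not at h; exact hcon.1 h
    have h2 : v' = p ∨ ¬ S.HP Z v0 v' := by
      by_contra h; push Not at h; exact hcon.2 h
    have f : ∀ u, S.SC v0 u → ¬ S.HP Z v0 u → ¬ S.SC v0 p := fun u hu h =>
      (mem_rest.1 (comp_sub (hbr' u hu h).2.2)).2
    rcases h1 with h1 | h1 <;> rcases h2 with h2 | h2
    · exact hne (h1.trans h2.symm)
    · exact f _ hv' h2 (h1 ▸ hv)
    · exact f _ hv h1 (h2 ▸ hv')
    · obtain ⟨e1, e2, e3⟩ := hbr' _ hv h1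
      obtain ⟨g1, g2, g3⟩ := hbr' _ hv' h2
      exact e1 v' hv' (Ne.symm hne) g2 ((mem_comp.1 e3).2.trans (mem_comp.1 g3).2.symm)
  have w : S.Win Z L p v0 := by
    rcases hZ.good v0 hv0 with h | h
    · exact b.pent h
    · exact b.long h
  obtain ⟨τ, ht, x, hx⟩ := w
  have e0 : x v0 = τ := by
    have := hx.1 v0 hv0 hm0
    simpa [LH] using this
  have e1 : x p ≠ τ := by
    have := hx.1 p hp hmp
    simpa [LH, hpq] using this
  refine ⟨x, hx.mono ?_, e0 ▸ ht, e0 ▸ e1⟩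
  intro v hv hm h
  simp only [LH] at h
  split_ifs with h' 
  · simp
  · push Not at h'
    rwa [if_neg h'.2, if_neg h'.1] at h

theorem mc_all (Z : Finset V) : S.MC Z := by
  induction h : Z.card using Nat.strong_induction_on generalizing Z with
  | _ n ih =>
    have IH : ∀ K : Finset V, K.card < Z.card → S.MC K := fun K hK => ih _ (h ▸ hK) K rfl
    intro hZ hc hex
    exact ⟨stepA hZ hc hex IH, stepB hZ hc IH, stepH hZ hc IH⟩

end CSys

open Equiv
namespace CSys
open Classical
variable {V : Type*} {S : CSys V}

def IsOdd (S : CSys V) (a : V) : Prop := ∃ n : ℕ, Odd n ∧ (S.σ ^ n) a = a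

theorem IsOdd.sc {a b : V} (h : S.IsOdd a) (hab : S.SC a b) : S.IsOdd b := by
  obtain ⟨n, hn, h⟩ := h
  obtain ⟨i, rfl⟩ := hab
  refine ⟨n, hn, ?_⟩
  rw [← Perm.mul_apply, ← zpow_natCast, ← zpow_add, add_comm, zpow_add, Perm.mul_apply, zpow_natCast, h]

/-- what we want -/
def Vals (S : CSys V) : Prop := ∃ x : V → SignType, (∀ v, x (S.μ v) = x v) ∧
  ∀ a, S.IsOdd a → ∃ w, S.SC a w ∧ S.Good x w

variable [Fintype V]

theorem Good.congr {x y : V → SignType} {w : V} (h : S.Good x w) (he : ∀ u, S.SC w u → x u = y u) :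
    S.Good y w := by
  obtain ⟨s, hs, d, hd, h1, h2, h3, h4⟩ := h
  have s1 := hd.sc (S := S) w
  have s2 := s1.trans (hd.sc _)
  have s3 := s2.trans (hd.sc _)
  refine ⟨s, hs, d, hd, ?_, ?_, ?_, ?_⟩
  · rwa [← he _ .rfl]
  · rwa [← he _ s1]
  · rwa [← he _ s2]
  · rwa [← he _ s3]

theorem vals_even (hg : ∀ a, S.IsOdd a → S.Pent a ∨ S.Long a) (he : ∃ a, ¬ S.IsOdd a) : S.Vals := by
  obtain ⟨a0, ha0⟩ := he
  let Z : Finset V := Finset.univ.filter S.IsOdd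
  have hm : ∀ v, v ∈ Z ↔ S.IsOdd v := fun v => by simp [Z]
  have hZ : S.Zok Z := ⟨fun a b hab ha => (hm _).2 (((hm _).1 ha).sc hab), fun a ha => hg a ((hm _).1 ha),
    fun a ha => (hm _).1 ha⟩
  obtain ⟨x, hx⟩ := glue (S := S) hZ (L := fun _ => Finset.univ) (by
    intro a ha
    refine (mc_all (S.comp Z a) (hZ.comp a) (cn_comp ha) ⟨a0, fun h => ha0 ((hm _).1 (comp_sub h))⟩).1 _ ?_
    intro p _ _
    decide)
  refine ⟨fun v => if v ∈ Z then x v else if S.μ v ∈ Z then x (S.μ v) else 0, ?_, ?_⟩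
  · intro v
    simp only [S.μμ]
    by_cases h1 : v ∈ Z <;> by_cases h2 : S.μ v ∈ Z <;> simp [h1, h2]
    exact hx.2.1 v h1 h2
  · intro a ha
    obtain ⟨w, hw, hgd⟩ := hx.2.2 a ((hm a).2 ha)
    refine ⟨w, hw, hgd.congr ?_⟩
    intro u hu
    have : u ∈ Z := (hm _).2 (ha.sc (hw.trans hu))
    simp [this]

/-- the TOP lemma -/
theorem top (hodd : ∀ a, S.IsOdd a) (hg : ∀ a, S.Pent a ∨ S.Long a) (Y F G : V → Prop)
    (hY : ∃ a, Y a) (hcl : ∀ a b, S.SC a b → Y a → Y b) (hdis : ∀ v, F v → ¬ G v)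
    (hmu : ∀ v, F v → ¬ G (S.μ v)) (huq : ∀ v v', F v → F v' → ¬ Y (S.μ v) → ¬ Y (S.μ v') → v = v')
    (hwin : ∀ v, Y v → ∃ w d, S.SC v w ∧ S.Dir d ∧ F w ∧ F (d w) ∧ G (d (d w)) ∧ G (d (d (d w)))) :
    S.Vals := by
  obtain ⟨a0, ha0⟩ := hY
  let Z : Finset V := Finset.univ.filter (fun v => ¬ Y v)
  have hm : ∀ v, v ∈ Z ↔ ¬ Y v := fun v => by simp [Z]
  have hZ : S.Zok Z := ⟨fun a b hab ha => (hm _).2 (fun h => (hm _).1 ha (hcl _ _ hab.symm h)),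
    fun a _ => hg a, fun a _ => hodd a⟩
  let L : V → Finset SignType := fun u => if F (S.μ u) then {1} else if G (S.μ u) then {0, -1} else Finset.univ
  obtain ⟨x, hx⟩ := glue (S := S) hZ (L := L) (by
    intro a ha
    have M := mc_all (S.comp Z a) (hZ.comp a) (cn_comp ha)
      ⟨a0, fun h => (hm _).1 (comp_sub h) ha0⟩
    have hport : ∀ p ∈ S.comp Z a, S.μ p ∉ S.comp Z a → Y (S.μ p) := by
      intro p hp hmp
      by_contra h
      exact hmp ((mu_mem_comp hp).2 ((hm _).2 h))
    have hYp : ∀ p ∈ S.comp Z a, ¬ Y p := fun p hp => (hm _).1 (comp_sub hp)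
    by_cases hF : ∃ p ∈ S.comp Z a, S.μ p ∉ S.comp Z a ∧ F (S.μ p)
    · obtain ⟨p, hp, hmp, hFp⟩ := hF
      have hother : ∀ q ∈ S.comp Z a, q ≠ p → ¬ F (S.μ q) := by
        intro q hq hqp h
        apply hqp
        have := huq _ _ h hFp (by rw [S.μμ]; exact hYp q hq) (by rw [S.μμ]; exact hYp p hp)
        rw [← S.μμ q, this, S.μμ]
      refine M.2.1 L p 1 hp hmp (by decide) ?_ ?_ ?_
      · simp [L, hFp]
      · intro q hq _ hqp
        simp only [L, if_neg (hother q hq hqp)]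
        split_ifs <;> decide
      · by_cases hall : ∃ q ∈ S.comp Z a, S.μ q ∉ S.comp Z a ∧ q ≠ p ∧ ¬ G (S.μ q)
        · obtain ⟨q, h1, h2, h3, h4⟩ := hall
          refine Or.inl ⟨q, h1, h2, h3, ?_⟩
          simp only [L, if_neg (hother q h1 h3), if_neg h4]
          decide
        · push Not at hall
          refine Or.inr (Or.inl ?_)
          intro q h1 h2 h3
          simp only [L, if_neg (hother q h1 h3), if_pos (hall q h1 h2 h3)]
          decide
    · push Not at hF
      refine M.1 L ?_
      intro q h1 h2
      simp only [L, if_neg (hF q h1 h2)]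
      split_ifs <;> decide)
  have hxL : ∀ v, Y v → ¬ Y (S.μ v) → x (S.μ v) ∈ L (S.μ v) := fun v h1 h2 =>
    hx.1 _ ((hm _).2 h2) (by rw [S.μμ, hm]; exact not_not.2 h1)
  let y : V → SignType := fun v => if Y v then (if Y (S.μ v) then (if F v ∨ F (S.μ v) then 1 else 0)
    else x (S.μ v)) else x v
  have yF : ∀ v, Y v → F v → y v = 1 := by
    intro v h1 h2
    by_cases h3 : Y (S.μ v)
    · simp [y, h1, h2, h3]
    · have := hxL v h1 h3
      simp only [L, S.μμ, if_pos h2, Finset.mem_singleton] at this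
      simp [y, h1, h3, this]
  have yG : ∀ v, Y v → G v → y v ≠ 1 := by
    intro v h1 h2
    have hFv : ¬ F v := fun h => hdis v h h2
    have hFm : ¬ F (S.μ v) := fun h => hmu _ h (by rwa [S.μμ])
    by_cases h3 : Y (S.μ v)
    · simp [y, h1, hFv, hFm, h3]
    · have := hxL v h1 h3
      simp only [L, S.μμ, if_neg hFv, if_pos h2, Finset.mem_insert, Finset.mem_singleton] at this
      simp only [y, h1, h3, if_true, if_false]
      rcases this with h | h <;> rw [h] <;> decide
  refine ⟨y, ?_, ?_⟩
  · intro v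
    simp only [y, S.μμ]
    by_cases h1 : Y v <;> by_cases h2 : Y (S.μ v) <;> simp [h1, h2, or_comm]
    exact hx.2.1 v ((hm _).2 h1) ((hm _).2 h2)
  · intro a _
    by_cases ha : Y a
    · obtain ⟨w, d, h1, hd, h2, h3, h4, h5⟩ := hwin a ha
      have s1 := h1.trans (hd.sc (S := S) w)
      have s2 := s1.trans (hd.sc _)
      have s3 := s2.trans (hd.sc _)
      exact ⟨w, h1, 1, by decide, d, hd, yF _ (hcl _ _ h1 ha) h2, yF _ (hcl _ _ s1 ha) h3,
        yG _ (hcl _ _ s2 ha) h4, yG _ (hcl _ _ s3 ha) h5⟩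
    · obtain ⟨w, hw, hgd⟩ := hx.2.2 a ((hm _).2 ha)
      refine ⟨w, hw, hgd.congr ?_⟩
      intro u hu
      have : ¬ Y u := fun h => ha (hcl _ _ (hw.trans hu).symm h)
      simp [y, this]

theorem not_all_chord {a : V} (h : S.IsOdd a) (hfix : S.σ a ≠ a) : ∃ b, S.SC a b ∧ ¬ S.SC b (S.μ b) := by
  by_contra hall
  push Not at hall
  let T : Finset V := Finset.univ.filter (S.SC a)
  have hT : T = (S.σ.cycleOf a).support := by
    ext u
    simp only [T, Finset.mem_filter, Finset.mem_univ, true_and]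
    rw [Perm.mem_support_cycleOf_iff' hfix]
    exact Iff.rfl
  have hc : (S.σ.cycleOf a).IsCycle := Perm.isCycle_cycleOf _ hfix
  obtain ⟨n, hn, hna⟩ := h
  have h1 : (S.σ.cycleOf a) ^ n = 1 := by
    rw [hc.pow_eq_one_iff]
    refine ⟨a, ?_, ?_⟩
    · rw [Perm.cycleOf_apply_self]; exact hfix
    · rw [Perm.cycleOf_pow_apply_self]; exact hna
  have h2 : T.card ∣ n := by
    rw [hT, ← hc.orderOf]
    exact orderOf_dvd_of_pow_eq_one h1
  have h3 : Odd T.card := by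
    rw [← Nat.not_even_iff_odd]
    intro he
    rw [← Nat.not_even_iff_odd] at hn
    exact hn (he.trans_dvd h2 |> fun h => h)
  have h4 : Even T.card := by
    have := Finset.sum_involution (s := T) (f := fun _ => (1 : ZMod 2)) (fun v _ => S.μ v)
      (fun _ _ => by decide) (fun v _ _ => S.μne v) (fun v hv => by
        simp only [T, Finset.mem_filter, Finset.mem_univ, true_and] at hv ⊢
        exact hv.trans (hall v hv)) (fun v _ => S.μμ v)
    simp at this
    exact (ZMod.natCast_eq_zero_iff_even).1 this
  exact (Nat.not_even_iff_odd.2 h3) h4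

theorem vals_chord (hodd : ∀ a, S.IsOdd a) (hg : ∀ a, S.Pent a ∨ S.Long a)
    (hch : ∃ b, S.SC b (S.μ b)) : S.Vals := by
  obtain ⟨a, ha⟩ := hch
  have hL : S.Long a := by
    rcases hg a with h | h
    · exact absurd ha (h.2.2 a .rfl)
    · exact h
  have hdσ : S.Dir S.σ := Or.inl rfl
  have hfix : S.σ a ≠ a := by
    intro h
    have := hL _ hdσ a .rfl
    simp [h] at this
  obtain ⟨b, hb, hbn⟩ := not_all_chord (hodd a) hfix
  obtain ⟨w, d, hd, hw, hw1, hw2⟩ : ∃ w d, S.Dir d ∧ S.SC a w ∧ S.SC w (S.μ w) ∧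
      ¬ S.SC (d w) (S.μ (d w)) := by
    by_contra hcon
    push Not at hcon
    exact hbn (sc_induct (S := S) (fun u => S.SC u (S.μ u)) ha (fun d hd w hw h => hcon w d hd hw h) hb)
  have hnd := hL d hd w hw
  simp only [List.nodup_cons, List.mem_cons, List.not_mem_nil, or_false, not_or] at hnd
  obtain ⟨⟨n1, n2, n3, n4, n5⟩, ⟨n6, n7, n8, n9⟩, ⟨n10, n11, n12⟩, ⟨n13, n14⟩, n15, -⟩ := hnd
  obtain ⟨w', d', hd', hww, hg1, hg2⟩ : ∃ w' d', S.Dir d' ∧ ((w' = w ∧ d' w' = d w) ∨ (w' = d w ∧ d' w' = w)) ∧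
      d' (d' w') ∉ [w, d w, S.μ w] ∧ d' (d' (d' w')) ∉ [w, d w, S.μ w] := by
    by_cases hcase : S.μ w = d (d w) ∨ S.μ w = d (d (d w))
    · refine ⟨d w, d⁻¹, hd.inv, Or.inr ⟨rfl, by simp⟩, ?_, ?_⟩
      · rw [show d⁻¹ (d w) = w by simp]; simp only [List.mem_cons, List.not_mem_nil, or_false]; grind
      · rw [show d⁻¹ (d w) = w by simp]; simp only [List.mem_cons, List.not_mem_nil, or_false]; grind
    · refine ⟨w, d, hd, Or.inl ⟨rfl, rfl⟩, ?_, ?_⟩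
      · simp; grind
      · simp; grind
  have hs1 : S.SC a w' := by
    rcases hww with h | h
    · rw [h.1]; exact hw
    · rw [h.1]; exact hw.trans (hd.sc w)
  have s2 := (hs1.trans (hd'.sc w')).trans (hd'.sc _)
  have s3 := s2.trans (hd'.sc _)
  refine top hodd hg (S.SC a) (fun v => v ∈ [w, d w, S.μ w])
    (fun v => v = d' (d' w') ∨ v = d' (d' (d' w'))) ⟨a, .rfl⟩ (fun u v h1 h2 => h2.trans h1) ?_ ?_ ?_ ?_
  · rintro v hv (rfl | rfl)
    · exact hg1 hv
    · exact hg2 hv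
  · intro v hv
    have hG : ∀ u, (u = d' (d' w') ∨ u = d' (d' (d' w'))) → S.SC a u ∧ u ∉ [w, d w, S.μ w] := by
      rintro u (rfl | rfl)
      · exact ⟨s2, hg1⟩
      · exact ⟨s3, hg2⟩
    intro hh
    obtain ⟨g1, g2⟩ := hG _ hh
    simp only [List.mem_cons, List.not_mem_nil, or_false] at hv g2
    rcases hv with rfl | rfl | rfl
    · exact g2 (Or.inr (Or.inr rfl))
    · exact hw2 ((hw.trans (hd.sc w)).symm.trans g1)
    · exact g2 (Or.inl (S.μμ w))
  · have : ∀ v, v ∈ [w, d w, S.μ w] → ¬ S.SC a (S.μ v) → v = d w := by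
      intro v hv hn
      simp only [List.mem_cons, List.not_mem_nil, or_false] at hv
      rcases hv with rfl | rfl | rfl
      · exact absurd (hw.trans hw1) hn
      · rfl
      · rw [S.μμ] at hn; exact absurd hw hn
    intro v v' h1 h2 h3 h4
    rw [this v h1 h3, this v' h2 h4]
  · intro v hv
    refine ⟨w', d', hv.symm.trans hs1, hd', ?_, ?_, Or.inl rfl, Or.inr rfl⟩
    · rcases hww with h | h <;> simp [h.1]
    · rcases hww with h | h <;> simp [h.2]

end CSys

open Equiv
namespace CSys
open Classical
variable {V : Type*} {S : CSys V}

structure Chain (S : CSys V) (m : ℕ) (a b : ℕ → V) : Prop where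
  sc : ∀ i ≤ m, S.SC (a i) (b i)
  nx : ∀ i < m, S.μ (b i) = a (i+1)
  lst : S.μ (b m) = a 0
  adj : ∀ i, 1 ≤ i → i ≤ m → ∃ d, S.Dir d ∧ b i = d (a i)
  ne0 : a 0 ≠ b 0
  dj : ∀ i ≤ m, ∀ j ≤ m, S.SC (a i) (a j) → i = j

variable {m : ℕ} {a b : ℕ → V} {d : Perm V}

/-- a window at an adjacent pair, avoiding q -/
theorem pair_window (hg : ∀ a, S.Pent a ∨ S.Long a) {u v : V} (hd : S.Dir d) (h : v = d u) (q : V) :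
    (∃ w e, S.Dir e ∧ ((w = u ∧ e w = v) ∨ (w = v ∧ e w = u)) ∧
      (e (e w) ≠ u ∧ e (e w) ≠ v ∧ e (e w) ≠ q) ∧
      (e (e (e w)) ≠ u ∧ e (e (e w)) ≠ v ∧ e (e (e w)) ≠ q)) ∨
    (∃ e x y, S.PD e u v x q y) := by
  subst h
  rcases hg u with hp | hl
  · obtain ⟨a1, a2, a3, a4, pd⟩ := hp.pd hd
    have nd := pd.nd
    simp only [List.nodup_cons, List.mem_cons, List.not_mem_nil, or_false, not_or] at nd
    obtain ⟨⟨n01, n02, n03, n04⟩, ⟨n12, n13, n14⟩, ⟨n23, n24⟩, n34, -⟩ := nd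
    have e0 := pd.e0
    by_cases h3 : q = a3
    · right
      rw [e0, h3]
      exact ⟨d, a2, a4, pd⟩
    · left
      by_cases h2 : q = a2
      · refine ⟨a1, d⁻¹, hd.inv, Or.inr ⟨e0.symm, pd.flip.e4⟩, ?_, ?_⟩
        · rw [pd.flip.e4, pd.flip.e0, e0]; grind
        · rw [pd.flip.e4, pd.flip.e0, pd.flip.e1, e0]; grind
      · refine ⟨u, d, hd, Or.inl ⟨rfl, rfl⟩, ?_, ?_⟩
        · rw [e0, pd.e1]; grind
        · rw [e0, pd.e1, pd.e2]; grind
  · left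
    have hnd := hl d hd u .rfl
    simp only [List.nodup_cons, List.mem_cons, List.not_mem_nil, or_false, not_or] at hnd
    obtain ⟨⟨n1, n2, n3, n4, n5⟩, ⟨n6, n7, n8, n9⟩, ⟨n10, n11, n12⟩, ⟨n13, n14⟩, n15, -⟩ := hnd
    by_cases hcase : q = d (d u) ∨ q = d (d (d u))
    · refine ⟨d u, d⁻¹, hd.inv, Or.inr ⟨rfl, by simp⟩, ?_, ?_⟩
      · rw [show d⁻¹ (d u) = u by simp]; grind
      · rw [show d⁻¹ (d u) = u by simp]; grind
    · refine ⟨u, d, hd, Or.inl ⟨rfl, rfl⟩, ?_, ?_⟩ <;> grind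

variable [Fintype V]

theorem Chain.prev (c : S.Chain m a b) : ∀ i ≤ m, ∃ j ≤ m, S.μ (a i) = b j := by
  intro i hi
  rcases i with _ | i
  · exact ⟨m, le_rfl, by rw [← c.lst, S.μμ]⟩
  · exact ⟨i, by omega, by rw [← c.nx i (by omega), S.μμ]⟩

theorem Chain.next (c : S.Chain m a b) : ∀ i ≤ m, ∃ j ≤ m, S.μ (b i) = a j := by
  intro i hi
  rcases Nat.lt_or_ge i m with h | h
  · exact ⟨i+1, by omega, c.nx i h⟩
  · have : i = m := by omega
    subst this
    exact ⟨0, by omega, c.lst⟩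

theorem Chain.top (c : S.Chain m a b) (hodd : ∀ a, S.IsOdd a) (hg : ∀ a, S.Pent a ∨ S.Long a)
    (hnc : ∀ v, ¬ S.SC v (S.μ v)) {p w : V} (hd : S.Dir d) (hw : S.SC (a 0) w)
    (hp : S.SC (a 0) p)
    (hF1 : w ∈ [a 0, b 0, p]) (hF2 : d w ∈ [a 0, b 0, p]) (hG1 : d (d w) ∉ [a 0, b 0, p])
    (hG2 : d (d (d w)) ∉ [a 0, b 0, p]) :
    S.Vals ∨ ∃ r, 1 ≤ r ∧ r ≤ m ∧ ∃ e x y, S.PD e (a r) (b r) x (S.μ p) y := by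
  by_contra hcon
  rw [not_or] at hcon
  obtain ⟨hnv, hno⟩ := hcon
  have hw' : ∀ i, ∃ u e, 1 ≤ i → i ≤ m → S.Dir e ∧ ((u = a i ∧ e u = b i) ∨ (u = b i ∧ e u = a i)) ∧
      (e (e u) ≠ a i ∧ e (e u) ≠ b i ∧ e (e u) ≠ S.μ p) ∧
      (e (e (e u)) ≠ a i ∧ e (e (e u)) ≠ b i ∧ e (e (e u)) ≠ S.μ p) := by
    intro i
    by_cases hi : 1 ≤ i ∧ i ≤ m
    · obtain ⟨e, he, h⟩ := c.adj i hi.1 hi.2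
      rcases pair_window hg he h (S.μ p) with ⟨u, e, h⟩ | h
      · exact ⟨u, e, fun _ _ => h⟩
      · exact absurd ⟨i, hi.1, hi.2, h⟩ hno
    · exact ⟨a 0, d, fun h1 h2 => absurd ⟨h1, h2⟩ hi⟩
  choose u e hue using hw'
  have hsc : ∀ i, 1 ≤ i → i ≤ m → S.SC (a i) (u i) := by
    intro i h1 h2
    rcases (hue i h1 h2).2.1 with h | h
    · rw [h.1]; exact .rfl
    · rw [h.1]; exact c.sc i h2
  let F : V → Prop := fun v => (∃ i ≤ m, v = a i ∨ v = b i) ∨ v = p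
  let G : V → Prop := fun v => (v = d (d w) ∨ v = d (d (d w))) ∨
    ∃ i, 1 ≤ i ∧ i ≤ m ∧ (v = e i (e i (u i)) ∨ v = e i (e i (e i (u i))))
  let Y : V → Prop := fun v => ∃ i ≤ m, S.SC (a i) v
  have s2 := (hw.trans (hd.sc w)).trans (hd.sc _)
  have s3 := s2.trans (hd.sc _)
  -- facts about G
  have hGG : ∀ v, G v → ∃ i ≤ m, S.SC (a i) v ∧ v ≠ a i ∧ v ≠ b i ∧ (i = 0 → v ≠ p) ∧
      (i ≠ 0 → v ≠ S.μ p) := by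
    rintro v ((h | h) | ⟨i, h1, h2, h3⟩)
    · refine ⟨0, by omega, h ▸ s2, ?_⟩
      subst h; simp at hG1; grind
    · refine ⟨0, by omega, h ▸ s3, ?_⟩
      subst h; simp at hG2; grind
    · obtain ⟨he, -, h4, h5⟩ := hue i h1 h2
      have t2 := ((hsc i h1 h2).trans (he.sc _)).trans (he.sc _)
      have t3 := t2.trans (he.sc _)
      rcases h3 with h3 | h3
      · exact ⟨i, h2, h3 ▸ t2, h3 ▸ h4.1, h3 ▸ h4.2.1, fun h => by omega, fun _ => h3 ▸ h4.2.2⟩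
      · exact ⟨i, h2, h3 ▸ t3, h3 ▸ h5.1, h3 ▸ h5.2.1, fun h => by omega, fun _ => h3 ▸ h5.2.2⟩
  have hnab : ∀ v, G v → ∀ j ≤ m, v ≠ a j ∧ v ≠ b j := by
    intro v hv j hj
    obtain ⟨i, hi, h1, h2, h3, -⟩ := hGG v hv
    constructor
    · rintro rfl
      exact h2 (by rw [c.dj i hi j hj h1])
    · rintro rfl
      exact h3 (by rw [c.dj i hi j hj (h1.trans (c.sc j hj).symm)])
  apply hnv
  refine CSys.top hodd hg Y F G ⟨a 0, 0, by omega, .rfl⟩ ?_ ?_ ?_ ?_ ?_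
  · rintro x y hxy ⟨i, hi, h⟩
    exact ⟨i, hi, h.trans hxy⟩
  · rintro v (⟨i, hi, h⟩ | h) hv
    · have := hnab v hv i hi
      tauto
    · obtain ⟨i, hi, h1, h2, h3, h4, h5⟩ := hGG v hv
      subst h
      have := c.dj i hi 0 (by omega) (h1.trans hp.symm)
      exact h4 this rfl
  · rintro v (⟨i, hi, h⟩ | h) hv
    · rcases h with h | h
      · obtain ⟨j, hj, h'⟩ := c.prev i hi
        rw [h] at hv
        exact (hnab _ hv j hj).2 h'
      · obtain ⟨j, hj, h'⟩ := c.next i hi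
        rw [h] at hv
        exact (hnab _ hv j hj).1 h'
    · obtain ⟨i, hi, h1, h2, h3, h4, h5⟩ := hGG _ hv
      subst h
      by_cases h0 : i = 0
      · subst h0
        exact hnc v (hp.symm.trans h1)
      · exact h5 h0 rfl
  · have key : ∀ v, F v → ¬ Y (S.μ v) → v = p := by
      rintro v (⟨i, hi, h⟩ | h) hv
      · exfalso
        apply hv
        rcases h with h | h
        · obtain ⟨j, hj, h'⟩ := c.prev i hi
          exact ⟨j, hj, by rw [h, h']; exact c.sc j hj⟩
        · obtain ⟨j, hj, h'⟩ := c.next i hi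
          exact ⟨j, hj, by rw [h, h']; exact .rfl⟩
      · exact h
    intro v v' h1 h2 h3 h4
    rw [key v h1 h3, key v' h2 h4]
  · rintro v ⟨i, hi, h⟩
    rcases Nat.eq_zero_or_pos i with h0 | h0
    · subst h0
      have hF : ∀ v, v ∈ [a 0, b 0, p] → F v := by
        intro v hv
        simp only [List.mem_cons, List.not_mem_nil, or_false] at hv
        rcases hv with h | h | h
        · exact Or.inl ⟨0, by omega, Or.inl h⟩
        · exact Or.inl ⟨0, by omega, Or.inr h⟩
        · exact Or.inr h
      exact ⟨w, d, h.symm.trans hw, hd, hF _ hF1, hF _ hF2, Or.inl (Or.inl rfl), Or.inl (Or.inr rfl)⟩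
    · obtain ⟨he, h3, -⟩ := hue i h0 hi
      refine ⟨u i, e i, h.symm.trans (hsc i h0 hi), he, ?_, ?_, Or.inr ⟨i, h0, hi, Or.inl rfl⟩,
        Or.inr ⟨i, h0, hi, Or.inr rfl⟩⟩
      · left; refine ⟨i, hi, ?_⟩; tauto
      · left; refine ⟨i, hi, ?_⟩; tauto

theorem PD.opp_unique {e e' : Perm V} {u v x q y x' q' y' : V} (h : S.PD e u v x q y)
    (h' : S.PD e' u v x' q' y') : q = q' := by
  have k1 : e' = e → q = q' := by
    rintro rfl
    rw [← h.e2, ← h.e1, ← h'.e2, ← h'.e1]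
  have k2 : e' = e⁻¹ → q = q' := by
    rintro rfl
    have nd := h.nd
    have h1 := h'.e0
    rw [h.flip.e0] at h1
    simp [h1] at nd
  rcases h.hd with rfl | rfl <;> rcases h'.hd with rfl | rfl
  · exact k1 rfl
  · exact k2 rfl
  · exact k2 (by simp)
  · exact k1 rfl

/-- existence of chains -/
theorem exists_chain [Nonempty V] (hg : ∀ a, S.Pent a ∨ S.Long a) (hnc : ∀ v, ¬ S.SC v (S.μ v)) :
    ∃ m a b, S.Chain m a b := by
  obtain ⟨v⟩ := ‹Nonempty V›
  have hfix : ∀ a, S.σ a ≠ a := by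
    intro a
    rcases hg a with h | h
    · exact h.2.1
    · intro h'
      have := h _ (Or.inl rfl) a .rfl
      simp [h'] at this
  let t : ℕ → V := fun i => (fun z => S.μ (S.σ z))^[i] v
  have ht : ∀ i, t (i+1) = S.μ (S.σ (t i)) := fun i => Function.iterate_succ_apply' _ _ _
  have hex : ∃ j, ∃ i < j, S.SC (t i) (t j) := by
    obtain ⟨i, j, hne, h⟩ := Finite.exists_ne_map_eq_of_infinite t
    rcases Nat.lt_or_gt_of_ne hne with h' | h'
    · exact ⟨j, i, h', h ▸ .rfl⟩
    · exact ⟨i, j, h', h ▸ .rfl⟩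
  let j := Nat.find hex
  obtain ⟨i, hij, hsc⟩ := Nat.find_spec hex
  have hmin : ∀ k < j, ∀ l < k, ¬ S.SC (t l) (t k) := fun k hk l hl h =>
    Nat.find_min hex hk ⟨l, hl, h⟩
  have hmin' : ∀ k < j, ∀ l < j, S.SC (t l) (t k) → l = k := by
    intro k hk l hl h
    rcases Nat.lt_trichotomy l k with h1 | h1 | h1
    · exact absurd h (hmin k hk l h1)
    · exact h1
    · exact absurd h.symm (hmin l hl k h1)
  change i < j at hij
  change S.SC (t i) (t j) at hsc
  have hij2 : i + 1 < j := by
    rcases Nat.lt_or_ge (i+1) j with h | h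
    · exact h
    · exfalso
      have : j = i + 1 := by omega
      rw [this, ht] at hsc
      exact hnc (S.σ (t i)) ((Dir.sc (Or.inl rfl) (t i)).symm.trans hsc)
  obtain ⟨m, hm⟩ : ∃ m, j = i + (m + 1) := ⟨j - i - 1, by omega⟩
  let a : ℕ → V := fun k => if k = 0 then t j else t (i + k)
  have ha0 : a 0 = t j := by simp [a]
  have hak : ∀ k, 0 < k → a k = t (i + k) := fun k hk => by simp [a, Nat.pos_iff_ne_zero.1 hk]
  have hsa : ∀ k, S.SC (a k) (t (i + k)) := by
    intro k
    rcases Nat.eq_zero_or_pos k with h | h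
    · subst h; rw [ha0]; exact hsc.symm
    · rw [hak k h]; exact .rfl
  refine ⟨m, a, fun k => S.σ (t (i + k)), ?_, ?_, ?_, ?_, ?_, ?_⟩
  · intro k hk
    exact (hsa k).trans (Dir.sc (Or.inl rfl) _)
  · intro k hk
    rw [hak _ (by omega), ← ht]; rfl
  · rw [ha0, hm, ← ht]; rfl
  · intro k h1 h2
    exact ⟨S.σ, Or.inl rfl, by rw [hak k h1]⟩
  · intro h
    rw [ha0] at h
    have h1 : S.μ (t j) = t (i+1) := by rw [h, Nat.add_zero, ← ht]
    have h2 : S.μ (t j) = S.σ (t (i+m)) := by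
      rw [hm, ← Nat.add_assoc, ht, S.μμ]
    rw [h2] at h1
    have h3 := hmin' (i+1) (by omega) (i+m) (by omega) (h1 ▸ Dir.sc (Or.inl rfl) _)
    rw [h3] at h1
    exact hfix _ h1
  · intro k hk l hl h
    have := hmin' (i + l) (by omega) (i + k) (by omega) (((hsa k).symm.trans h).trans (hsa l))
    omega

/-- reroute: minimality forces r = m -/
theorem Chain.reroute (c : S.Chain m a b) (hmin : ∀ m' a' b', S.Chain m' a' b' → m ≤ m')
    {p : V} (hp : ∃ e, S.Dir e ∧ b 0 = e p) {r : ℕ} (h1 : 1 ≤ r) (h2 : r ≤ m)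
    (hsc : S.SC (a r) (S.μ p)) (hne : S.μ p ≠ a r) : r = m := by
  have hp0 : S.SC p (a 0) := by
    obtain ⟨e, he, h⟩ := hp
    exact (he.sc p).trans (h ▸ (c.sc 0 (by omega)).symm)
  have := hmin r (fun k => if k = 0 then a r else if k = 1 then p else a (k-1))
    (fun k => if k = 0 then S.μ p else b (k-1)) ⟨?_, ?_, ?_, ?_, ?_, ?_⟩
  · omega
  · intro k hk
    rcases k with _ | _ | k
    · simpa using hsc
    · simpa using hp0.trans (c.sc 0 (by omega))
    · simpa using c.sc (k+1) (by omega)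
  · intro k hk
    rcases k with _ | k
    · simp [S.μμ]
    · have := c.nx k (by omega)
      simpa using this
  · obtain ⟨k, rfl⟩ : ∃ k, r = k + 1 := ⟨r - 1, by omega⟩
    simpa using c.nx k (by omega)
  · intro k hk1 hk2
    obtain ⟨k, rfl⟩ : ∃ l, k = l + 1 := ⟨k - 1, by omega⟩
    rcases k with _ | k
    · simpa using hp
    · simpa using c.adj (k+1) (by omega) (by omega)
  · simpa using hne.symm
  · have key : ∀ k ≤ r, S.SC (if k = 0 then a r else if k = 1 then p else a (k-1))
        (a (if k = 0 then r else k - 1)) := by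
      intro k hk
      rcases k with _ | _ | k
      · simpa using SC.rfl
      · simpa using hp0
      · simpa using SC.rfl
    intro k hk l hl h
    have := c.dj _ (by split_ifs <;> omega) _ (by split_ifs <;> omega)
      (((key k hk).symm.trans h).trans (key l hl))
    split_ifs at this <;> omega

theorem opt1 (hodd : ∀ a, S.IsOdd a) (hg : ∀ a, S.Pent a ∨ S.Long a)
    (hnc : ∀ v, ¬ S.SC v (S.μ v)) {e : Perm V} {a0 c b0 y1 y2 a1 b1 x2 w x4 : V}
    (pd : S.PD d a0 c b0 y1 y2) (pe : S.PD e a1 b1 x2 w x4) (h1 : S.μ b0 = a1) (h2 : S.μ b1 = a0)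
    (h3 : S.μ c = w) (hdj : ¬ S.SC a0 a1) (hno : ¬ S.Vals) : S.μ x4 = y2 := by
  by_contra hbad
  apply hno
  have nd := pd.nd
  have ne := pe.nd
  simp only [List.nodup_cons, List.mem_cons, List.not_mem_nil, or_false, not_or] at nd ne
  have hA : ∀ u, u ∈ [a0, c, b0, y1, y2] → S.SC a0 u := by
    intro u hu
    simp only [List.mem_cons, List.not_mem_nil, or_false] at hu
    rcases hu with rfl | rfl | rfl | rfl | rfl
    exacts [.rfl, pd.sc1, pd.sc2, pd.sc3, pd.sc4]
  have hB : ∀ u, u ∈ [a1, b1, x2, w, x4] → S.SC a1 u := by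
    intro u hu
    simp only [List.mem_cons, List.not_mem_nil, or_false] at hu
    rcases hu with rfl | rfl | rfl | rfl | rfl
    exacts [.rfl, pe.sc1, pe.sc2, pe.sc3, pe.sc4]
  have hAB : ∀ u u', u ∈ [a0, c, b0, y1, y2] → u' ∈ [a1, b1, x2, w, x4] → u ≠ u' := by
    rintro u u' h h' rfl
    exact hdj ((hA u h).trans (hB u h').symm)
  have h1' : S.μ a1 = b0 := by rw [← h1, S.μμ]
  have h3' : S.μ w = c := by rw [← h3, S.μμ]
  have hx4 : ∀ u, u ∈ [a1, b1, x2, w, x4] → S.μ x4 ≠ u := by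
    rintro u hu rfl
    exact hnc x4 ((hB x4 (by simp)).symm.trans (hB _ hu))
  have hx4a : S.μ x4 ≠ a0 := by
    rw [← h2]
    intro h
    have := congrArg S.μ h
    rw [S.μμ, S.μμ] at this
    grind
  simp only [List.mem_cons, List.not_mem_nil, or_false] at hAB hx4
  refine top hodd hg (fun v => S.SC a0 v ∨ S.SC a1 v) (fun v => v ∈ [c, b0, a1, w, x4])
    (fun v => v ∈ [a0, y2, b1, x2]) ⟨a0, Or.inl .rfl⟩ ?_ ?_ ?_ ?_ ?_
  · rintro x y h (h' | h')
    · exact Or.inl (h'.trans h)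
    · exact Or.inr (h'.trans h)
  · intro v hv hv'
    simp only [List.mem_cons, List.not_mem_nil, or_false] at hv hv'
    grind
  · intro v hv hv'
    simp only [List.mem_cons, List.not_mem_nil, or_false] at hv hv'
    rcases hv with rfl | rfl | rfl | rfl | rfl
    · rw [h3] at hv'; grind
    · rw [h1] at hv'; grind
    · rw [h1'] at hv'; grind
    · rw [h3'] at hv'; grind
    · grind
  · have key : ∀ v, v ∈ [c, b0, a1, w, x4] → ¬ (S.SC a0 (S.μ v) ∨ S.SC a1 (S.μ v)) → v = x4 := by
      intro v hv hn
      simp only [List.mem_cons, List.not_mem_nil, or_false] at hv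
      rcases hv with rfl | rfl | rfl | rfl | rfl
      · exact absurd (Or.inr (h3 ▸ pe.sc3)) hn
      · exact absurd (Or.inr (h1 ▸ .rfl)) hn
      · exact absurd (Or.inl (h1' ▸ pd.sc2)) hn
      · exact absurd (Or.inl (h3' ▸ pd.sc1)) hn
      · rfl
    intro v v' k1 k2 k3 k4
    rw [key v k1 k3, key v' k2 k4]
  · rintro v (hv | hv)
    · refine ⟨b0, d⁻¹, hv.symm.trans pd.sc2, pd.hd.inv, by simp, ?_, ?_, ?_⟩
      · rw [pd.flip.e3]; simp
      · rw [pd.flip.e3, pd.flip.e4]; simp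
      · rw [pd.flip.e3, pd.flip.e4, pd.flip.e0]; simp
    · refine ⟨x4, e, hv.symm.trans pe.sc4, pe.hd, by simp, ?_, ?_, ?_⟩
      · rw [pe.e4]; simp
      · rw [pe.e4, pe.e0]; simp
      · rw [pe.e4, pe.e0, pe.e1]; simp

theorem petersen (hodd : ∀ a, S.IsOdd a) (hg : ∀ a, S.Pent a ∨ S.Long a)
    (hnc : ∀ v, ¬ S.SC v (S.μ v)) {e : Perm V} {a0 c b0 y1 y2 a1 b1 x2 w x4 : V}
    (pd : S.PD d a0 c b0 y1 y2) (pe : S.PD e a1 b1 x2 w x4) (h1 : S.μ b0 = a1) (h2 : S.μ b1 = a0)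
    (h3 : S.μ c = w) (hdj : ¬ S.SC a0 a1) : S.Vals := by
  by_contra hno
  have k1 := opt1 hodd hg hnc pd pe h1 h2 h3 hdj hno
  have k2 := opt1 hodd hg hnc pd.flip.rot.rot.rot pe.flip.rot.rot.rot.rot (by rw [← h2, S.μμ])
    (by rw [← h1, S.μμ]) h3 (fun h => hdj ((pd.sc2.trans h).trans pe.sc1.symm)) hno
  have h1' : S.μ a1 = b0 := by rw [← h1, S.μμ]
  have h2' : S.μ a0 = b1 := by rw [← h2, S.μμ]
  have h3' : S.μ w = c := by rw [← h3, S.μμ]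
  have k1' : S.μ y2 = x4 := by rw [← k1, S.μμ]
  have k2' : S.μ y1 = x2 := by rw [← k2, S.μμ]
  have nd := pd.nd
  have ne := pe.nd
  simp only [List.nodup_cons, List.mem_cons, List.not_mem_nil, or_false, not_or] at nd ne
  have hA : ∀ u, u ∈ [a0, c, b0, y1, y2] → S.SC a0 u := by
    intro u hu
    simp only [List.mem_cons, List.not_mem_nil, or_false] at hu
    rcases hu with rfl | rfl | rfl | rfl | rfl
    exacts [.rfl, pd.sc1, pd.sc2, pd.sc3, pd.sc4]
  have hB : ∀ u, u ∈ [a1, b1, x2, w, x4] → S.SC a1 u := by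
    intro u hu
    simp only [List.mem_cons, List.not_mem_nil, or_false] at hu
    rcases hu with rfl | rfl | rfl | rfl | rfl
    exacts [.rfl, pe.sc1, pe.sc2, pe.sc3, pe.sc4]
  have hAB : ∀ u u', u ∈ [a0, c, b0, y1, y2] → u' ∈ [a1, b1, x2, w, x4] → u ≠ u' := by
    rintro u u' h h' rfl
    exact hdj ((hA u h).trans (hB u h').symm)
  simp only [List.mem_cons, List.not_mem_nil, or_false] at hAB
  have hall : ∀ v, S.SC a0 v ∨ S.SC a1 v := by
    refine S.tr {v | S.SC a0 v ∨ S.SC a1 v} ⟨a0, Or.inl .rfl⟩ ?_ ?_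
    · rintro v (h | h)
      · exact Or.inl (h.trans (Dir.sc (Or.inl rfl) v))
      · exact Or.inr (h.trans (Dir.sc (Or.inl rfl) v))
    · rintro v (h | h)
      · right
        rcases pd.all h with h | h | h | h | h <;> rw [h]
        · exact h2' ▸ pe.sc1
        · exact h3 ▸ pe.sc3
        · exact h1 ▸ .rfl
        · exact k2' ▸ pe.sc2
        · exact k1' ▸ pe.sc4
      · left
        rcases pe.all h with h | h | h | h | h <;> rw [h]
        · exact h1' ▸ pd.sc2
        · exact h2 ▸ .rfl
        · exact k2 ▸ pd.sc3
        · exact h3' ▸ pd.sc1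
        · exact k1 ▸ pd.sc4
  let x : V → SignType := fun v => if v = a0 ∨ v = y1 ∨ v = b1 ∨ v = x2 then 1 else
    if v = y2 ∨ v = x4 then 0 else -1
  apply hno
  have q1 : x a0 = 1 := by simp [x]
  have q2 : x c = -1 := by simp [x]; grind
  have q3 : x b0 = -1 := by simp [x]; grind
  have q4 : x y1 = 1 := by simp [x]
  have q5 : x y2 = 0 := by simp [x]; grind
  have r1 : x a1 = -1 := by simp [x]; grind
  have r2 : x b1 = 1 := by simp [x]
  have r3 : x x2 = 1 := by simp [x]
  have r4 : x w = -1 := by simp [x]; grind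
  have r5 : x x4 = 0 := by simp [x]; grind
  refine ⟨x, ?_, ?_⟩
  · intro v
    rcases hall v with h | h
    · rcases pd.all h with h | h | h | h | h <;> rw [h]
      · rw [h2', q1, r2]
      · rw [h3, q2, r4]
      · rw [h1, q3, r1]
      · rw [k2', q4, r3]
      · rw [k1', q5, r5]
    · rcases pe.all h with h | h | h | h | h <;> rw [h]
      · rw [h1', q3, r1]
      · rw [h2, q1, r2]
      · rw [k2, q4, r3]
      · rw [h3', q2, r4]
      · rw [k1, q5, r5]
  · intro v _
    rcases hall v with h | h
    · refine ⟨c, h.symm.trans pd.sc1, -1, by decide, d, pd.hd, q2, ?_, ?_, ?_⟩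
      · rw [pd.e1, q3]
      · rw [pd.e1, pd.e2, q4]; decide
      · rw [pd.e1, pd.e2, pd.e3, q5]; decide
    · refine ⟨b1, h.symm.trans pe.sc1, 1, by decide, e, pe.hd, r2, ?_, ?_, ?_⟩
      · rw [pe.e1, r3]
      · rw [pe.e1, pe.e2, r4]; decide
      · rw [pe.e1, pe.e2, pe.e3, r5]; decide

theorem vals_nochord [Nonempty V] (hodd : ∀ a, S.IsOdd a) (hg : ∀ a, S.Pent a ∨ S.Long a)
    (hnc : ∀ v, ¬ S.SC v (S.μ v)) : S.Vals := by
  by_contra hno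
  have hex := exists_chain hg hnc
  obtain ⟨a, b, c⟩ := Nat.find_spec hex
  have hmin : ∀ m' a' b', S.Chain m' a' b' → Nat.find hex ≤ m' := fun m' a' b' h =>
    Nat.find_min' hex ⟨a', b', h⟩
  generalize Nat.find hex = m at c hmin
  have hm1 : 1 ≤ m := by
    rcases Nat.eq_zero_or_pos m with h | h
    · subst h
      have h1 := c.lst
      exact absurd ((c.sc 0 le_rfl).symm.trans (h1 ▸ .rfl)) (hnc (b 0))
    · exact h
  have hT := fun {d : Perm V} {p w : V} => c.top (d := d) (p := p) (w := w) hodd hg hnc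
  -- case 1
  have case1 : ∀ d, S.Dir d → b 0 ≠ d (a 0) := by
    intro d hd h
    have hnd := nd4 (hg (a 0)) .rfl hd
    simp only [List.nodup_cons, List.mem_cons, List.not_mem_nil, or_false, not_or] at hnd
    obtain ⟨⟨n01, n02, n03⟩, ⟨n12, n13⟩, -⟩ := hnd
    rcases hT (p := a 0) hd .rfl .rfl (by simp) (by simp [h]) (by simp [h]; grind)
      (by simp [h]; grind) with hv | ⟨r, h1, h2, e, x, y, pd⟩
    · exact hno hv
    · have e1 : S.μ (a 0) = b m := by rw [← c.lst, S.μμ]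
      have e2 : r = m := by
        apply c.dj r h2 m le_rfl
        refine pd.sc3.trans ?_
        rw [e1]
        exact (c.sc m le_rfl).symm
      subst e2
      have := pd.nd
      rw [e1] at this
      simp at this
  rcases hg (a 0) with hP | hLg
  · obtain ⟨a1, a2, a3, a4, pd⟩ := hP.pd (Or.inl rfl)
    have hd2 : ∃ d u y1 y2, S.PD d (a 0) u (b 0) y1 y2 := by
      rcases pd.all (c.sc 0 (by omega)) with h | h | h | h | h
      · exact absurd h.symm c.ne0
      · exact absurd (h.trans pd.e0.symm) (case1 _ pd.hd)
      · exact ⟨_, a1, a3, a4, h ▸ pd⟩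
      · exact ⟨_, a4, a2, a1, h ▸ pd.flip⟩
      · exact absurd (h.trans pd.flip.e0.symm) (case1 _ pd.flip.hd)
    obtain ⟨d, u, y1, y2, pd⟩ := hd2
    have nd := pd.nd
    simp only [List.nodup_cons, List.mem_cons, List.not_mem_nil, or_false, not_or] at nd
    rcases hT (p := u) (w := u) pd.hd pd.sc1 pd.sc1 (by simp) (by rw [pd.e1]; simp)
      (by rw [pd.e1, pd.e2]; simp; grind) (by rw [pd.e1, pd.e2, pd.e3]; simp; grind)
      with hv | ⟨r, h1, h2, e, x, y, pe⟩
    · exact hno hv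
    · have nde := pe.nd
      simp only [List.nodup_cons, List.mem_cons, List.not_mem_nil, or_false, not_or] at nde
      have hr : r = m := c.reroute hmin ⟨d, pd.hd, pd.e1.symm⟩ h1 h2 pe.sc3 (by grind)
      subst hr
      have hdj : ¬ S.SC (a 0) (a r) := fun h => by
        have := c.dj 0 (by omega) r le_rfl h; omega
      have hr1 : r = 1 := by
        have := hmin 1 (fun k => if k = 0 then S.μ u else a 0) (fun k => if k = 0 then b r else u)
          ⟨?_, ?_, ?_, ?_, ?_, ?_⟩
        · omega
        · intro k hk
          rcases k with _ | k
          · simpa using pe.sc3.symm.trans pe.sc1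
          · simpa using pd.sc1
        · intro k hk
          obtain rfl : k = 0 := by omega
          simpa using c.lst
        · simp
        · intro k hk1 hk2
          obtain rfl : k = 1 := by omega
          simpa using ⟨d, pd.hd, pd.e0.symm⟩
        · simp; grind
        · have hn : ¬ S.SC (S.μ u) (a 0) := fun h => hdj (h.symm.trans pe.sc3.symm)
          intro k hk l hl h
          have hk' : k = 0 ∨ k = 1 := by omega
          have hl' : l = 0 ∨ l = 1 := by omega
          rcases hk' with rfl | rfl <;> rcases hl' with rfl | rfl
          · rfl
          · exact absurd (by simpa using h) hn
          · exact absurd (by simpa using h.symm) hn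
          · rfl
      subst hr1
      exact hno (petersen hodd hg hnc pd pe (c.nx 0 (by omega)) c.lst rfl hdj)
  · -- long
    have hb := c.sc 0 (by omega)
    have key : ∀ d, S.Dir d → ∃ e x y, S.PD e (a m) (b m) x (S.μ (d (b 0))) y := by
      intro d hd
      have hnd := hLg d hd (b 0) hb
      simp only [List.nodup_cons, List.mem_cons, List.not_mem_nil, or_false, not_or] at hnd
      obtain ⟨⟨n1, n2, n3, n4, n5⟩, ⟨n6, n7, n8, n9⟩, ⟨n10, n11, n12⟩, ⟨n13, n14⟩, n15, -⟩ := hnd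
      have hne := c.ne0
      have hadj : a 0 ≠ d (b 0) := fun h => case1 d⁻¹ hd.inv (by rw [h]; simp)
      have hbp := hb.trans (hd.sc (b 0))
      have hh : ∃ r, 1 ≤ r ∧ r ≤ m ∧ ∃ e x y, S.PD e (a r) (b r) x (S.μ (d (b 0))) y := by
        by_cases hcase : a 0 = d (d (b 0)) ∨ a 0 = d (d (d (b 0)))
        · have e1 : d⁻¹ (d (b 0)) = b 0 := by simp
          exact (hT (p := d (b 0)) (w := d (b 0)) hd.inv hbp hbp (by simp) (by rw [e1]; simp)
            (by rw [e1]; simp only [List.mem_cons, List.not_mem_nil, or_false]; grind)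
            (by rw [e1]; simp only [List.mem_cons, List.not_mem_nil, or_false]; grind)).resolve_left hno
        · exact (hT (p := d (b 0)) (w := b 0) hd hb hbp (by simp) (by simp)
            (by simp only [List.mem_cons, List.not_mem_nil, or_false]; grind)
            (by simp only [List.mem_cons, List.not_mem_nil, or_false]; grind)).resolve_left hno
      obtain ⟨r, h1, h2, e, x, y, pe⟩ := hh
      have nde := pe.nd
      simp only [List.nodup_cons, List.mem_cons, List.not_mem_nil, or_false, not_or] at nde
      have hr : r = m := c.reroute hmin ⟨d⁻¹, hd.inv, by simp⟩ h1 h2 pe.sc3 (by grind)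
      subst hr
      exact ⟨e, x, y, pe⟩
    have hd : S.Dir S.σ := Or.inl rfl
    obtain ⟨e, x, y, pe⟩ := key _ hd
    obtain ⟨e', x', y', pe'⟩ := key _ hd.inv
    have hnd := hLg _ hd (b 0) hb
    have hne : S.σ (b 0) ≠ S.σ⁻¹ (b 0) := by
      intro h; simp [h] at hnd
    apply hne
    have := pe.opp_unique pe'
    have := congrArg S.μ this
    rwa [S.μμ, S.μμ] at this

theorem vals [Nonempty V] (hg : ∀ a, S.IsOdd a → S.Pent a ∨ S.Long a) : S.Vals := by
  by_cases h : ∃ a, ¬ S.IsOdd a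
  · exact vals_even hg h
  · push Not at h
    have hg' := fun a => hg a (h a)
    by_cases hc : ∃ b, S.SC b (S.μ b)
    · exact vals_chord h hg' hc
    · push Not at hc
      exact vals_nochord h hg' hc

end CSys

open Equiv
namespace CSys
open Classical
variable {V : Type*} {S : CSys V}

def OKn (a b : ℕ) : Prop := (3:ℤ) ≤ |(a:ℤ) - b| ∧ |(a:ℤ) - b| ≤ 8

theorem OKn.symm {a b : ℕ} (h : OKn a b) : OKn b a := by
  unfold OKn at *
  rwa [abs_sub_comm]

instance (a b : ℕ) : Decidable (OKn a b) := by unfold OKn; infer_instance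

def mcol (s : SignType) : ℕ := if s = 0 then 0 else if s = 1 then 1 else 10

variable [Fintype V]

theorem orb (d : Perm V) (w : V) (x : V → SignType) (E : ℕ → ℕ) (n : ℕ)
    (hn : n = Function.minimalPeriod d w) (hlt : ∀ i, E i < 11)
    (h1 : ∀ i, i + 1 < n → OKn (E i) (E (i+1))) (h2 : OKn (E (n-1)) (E 0))
    (h3 : ∀ i < n, OKn (E i) (mcol (x (d^[i] w))) ∧ OKn (E i) (mcol (x (d^[i+1] w)))) :
    ∃ e : V → ℕ, ∀ u, d.SameCycle w u → e u < 11 ∧ OKn (e u) (e (d u)) ∧ OKn (e u) (mcol (x u)) ∧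
      OKn (e u) (mcol (x (d u))) := by
  have hper : w ∈ Function.periodicPts d := by
    refine ⟨orderOf d, orderOf_pos d, ?_⟩
    rw [Function.IsPeriodicPt, Function.IsFixedPt, ← Perm.coe_pow, pow_orderOf_eq_one]; rfl
  have hpos : 0 < n := hn ▸ Function.minimalPeriod_pos_of_mem_periodicPts hper
  have hidx : ∀ u, ∃ i, d.SameCycle w u → i < n ∧ d^[i] w = u := by
    intro u
    by_cases h : d.SameCycle w u
    · obtain ⟨i, hi⟩ := h.exists_nat_pow_eq
      refine ⟨i % n, fun _ => ⟨Nat.mod_lt _ hpos, ?_⟩⟩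
      rw [hn, Function.iterate_mod_minimalPeriod_eq, ← Perm.coe_pow]; exact hi
    · exact ⟨0, fun h' => absurd h' h⟩
  choose idx hi using hidx
  have huniq : ∀ i j, i < n → j < n → d^[i] w = d^[j] w → i = j := by
    intro i j hi hj h
    exact Function.iterate_injOn_Iio_minimalPeriod (hn ▸ hi) (hn ▸ hj) h
  refine ⟨fun u => E (idx u), ?_⟩
  intro u hu
  obtain ⟨k1, k2⟩ := hi u hu
  have hu' : d.SameCycle w (d u) := Perm.sameCycle_apply_right.2 hu
  obtain ⟨l1, l2⟩ := hi (d u) hu'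
  have hs : d^[idx u + 1] w = d u := by rw [Function.iterate_succ_apply', k2]
  refine ⟨hlt _, ?_, ?_, ?_⟩
  · by_cases hlast : idx u + 1 < n
    · have := huniq _ _ l1 hlast (l2.trans hs.symm)
      show OKn (E (idx u)) (E (idx (d u)))
      rw [this]
      exact h1 _ hlast
    · have e1 : idx u = n - 1 := by omega
      have e2 : d^[0] w = d u := by
        rw [← hs, e1, Nat.sub_add_cancel hpos, hn, Function.iterate_minimalPeriod]; rfl
      have := huniq _ _ l1 hpos (l2.trans e2.symm)
      show OKn (E (idx u)) (E (idx (d u)))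
      rw [this, e1]
      exact h2
  · have := (h3 _ k1).1
    rwa [k2] at this
  · have := (h3 _ k1).2
    rwa [hs] at this

theorem ok_mid {c : ℕ} (h1 : 4 ≤ c) (h2 : c ≤ 7) (s : SignType) : OKn c (mcol s) := by
  interval_cases c <;> revert s <;> decide

theorem orb_even (d : Perm V) (w : V) (x : V → SignType) (he : Even (Function.minimalPeriod d w)) 
    : ∃ e : V → ℕ, ∀ u, d.SameCycle w u → e u < 11 ∧ OKn (e u) (e (d u)) ∧ OKn (e u) (mcol (x u)) ∧
      OKn (e u) (mcol (x (d u))) := by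
  have hE : ∀ i : ℕ, 4 ≤ (if Even i then 4 else 7 : ℕ) ∧ (if Even i then 4 else 7 : ℕ) ≤ 7 := by
    intro i; split_ifs <;> simp
  have hper : w ∈ Function.periodicPts d := by
    refine ⟨orderOf d, orderOf_pos d, ?_⟩
    rw [Function.IsPeriodicPt, Function.IsFixedPt, ← Perm.coe_pow, pow_orderOf_eq_one]; rfl
  have hpos := Function.minimalPeriod_pos_of_mem_periodicPts hper
  refine orb d w x (fun i => if Even i then 4 else 7) _ rfl ?_ ?_ ?_ ?_
  · intro i; have := (hE i).2; show (if Even i then 4 else 7 : ℕ) < 11; omega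
  · intro i _
    by_cases h : Even i
    · simp [h, Nat.even_add_one]; decide
    · simp [h, Nat.even_add_one]; decide
  · have : ¬ Even (Function.minimalPeriod d w - 1) := by
      intro h
      obtain ⟨a, ha⟩ := h
      obtain ⟨b, hb⟩ := he
      omega
    simp [this]; decide
  · intro i _
    exact ⟨ok_mid (hE i).1 (hE i).2 _, ok_mid (hE i).1 (hE i).2 _⟩

def Eodd : ℕ → ℕ
  | 0 => 9
  | 1 => 6
  | 2 => 3
  | i+3 => if Even i then 7 else 4

theorem orb_odd (d : Perm V) (w : V) (x : V → SignType) (ho : Odd (Function.minimalPeriod d w))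
    (h5 : 5 ≤ Function.minimalPeriod d w) {s : SignType} (hs : s ≠ 0) (h0 : x w = s) (h1 : x (d w) = s)
    (h2 : x (d (d w)) ≠ s) (h3 : x (d (d (d w))) ≠ s) :
    ∃ e : V → ℕ, ∀ u, d.SameCycle w u → e u < 11 ∧ OKn (e u) (e (d u)) ∧ OKn (e u) (mcol (x u)) ∧
      OKn (e u) (mcol (x (d u))) := by
  have hE : ∀ i, Eodd (i+1+1+1) = 7 ∨ Eodd (i+1+1+1) = 4 := by
    intro i; simp only [Eodd]; split_ifs <;> simp
  have hB : ∀ i, 3 ≤ Eodd i ∧ Eodd i ≤ 9 := by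
    intro i
    rcases i with _ | _ | _ | i
    · decide
    · decide
    · decide
    · have := hE i; omega
  have hO1 : ∀ i, OKn (Eodd i) (Eodd (i+1)) := by
    intro i
    rcases i with _ | _ | _ | i
    · decide
    · decide
    · decide
    · simp only [Eodd, Nat.even_add_one]
      by_cases h : Even i <;> simp [h] <;> decide
  have hO2 : OKn (Eodd (Function.minimalPeriod d w - 1)) (Eodd 0) := by
    obtain ⟨k, hk⟩ := ho
    have : Function.minimalPeriod d w - 1 = (2 * (k - 2) + 1) + 3 := by omega
    rw [this]
    have h : ¬ Even (2 * (k-2) + 1) := by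
      rw [Nat.not_even_iff_odd]; exact ⟨_, rfl⟩
    simp only [Eodd, if_neg h]; decide
  have hs0 : ∀ t : SignType, t ≠ 0 → t = 1 ∨ t = -1 := by decide
  have hs' := hs0 s hs
  rcases hs' with rfl | rfl
  · refine orb d w x Eodd _ rfl ?_ ?_ ?_ ?_
    · intro i; have := hB i; omega
    · intro i _; exact hO1 i
    · exact hO2
    · intro i _
      rcases i with _ | _ | _ | i
      · simp only [Function.iterate_zero, id, Function.iterate_succ, Function.comp, h0, h1]; decide
      · simp only [Function.iterate_zero, id, Function.iterate_succ, Function.comp, h1]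
        refine ⟨by decide, ok_mid (by decide) (by decide) _⟩
      · simp only [Function.iterate_zero, id, Function.iterate_succ, Function.comp]
        revert h2 h3
        generalize x (d (d w)) = p
        generalize x (d (d (d w))) = q
        revert p q; decide
      · have := hE i
        constructor <;> apply ok_mid <;> omega
  · have hneg : ∀ a b, a ≤ 11 → b ≤ 11 → OKn a b → OKn (11 - a) (11 - b) := by
      intro a b ha hb h
      unfold OKn at *
      rw [Nat.cast_sub ha, Nat.cast_sub hb, abs_sub_comm] 
      convert h using 3 <;> push_cast <;> ring
    refine orb d w x (fun i => 11 - Eodd i) _ rfl ?_ ?_ ?_ ?_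
    · intro i; have := hB i; show 11 - Eodd i < 11; omega
    · intro i _; exact hneg _ _ (by have := hB i; omega) (by have := hB (i+1); omega) (hO1 i)
    · exact hneg _ _ (by have := hB (Function.minimalPeriod d w - 1); omega) (by decide) hO2
    · intro i _
      rcases i with _ | _ | _ | i
      · simp only [Function.iterate_zero, id, Function.iterate_succ, Function.comp, h0, h1]; decide
      · simp only [Function.iterate_zero, id, Function.iterate_succ, Function.comp, h1]
        refine ⟨by decide, ok_mid (by decide) (by decide) _⟩
      · simp only [Function.iterate_zero, id, Function.iterate_succ, Function.comp]
        revert h2 h3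
        generalize x (d (d w)) = p
        generalize x (d (d (d w))) = q
        revert p q; decide
      · have := hE i
        constructor <;> apply ok_mid <;> omega

theorem coloring [Nonempty V] (hg : ∀ a, S.IsOdd a → S.Pent a ∨ S.Long a) :
    ∃ (e c : V → ℕ), (∀ v, e v < 11) ∧ (∀ v, c v < 11) ∧ (∀ v, c (S.μ v) = c v) ∧
      ∀ v, OKn (e v) (e (S.σ v)) ∧ OKn (e v) (c v) ∧ OKn (e v) (c (S.σ v)) := by
  obtain ⟨x, hx, hw⟩ := vals hg
  have key : ∀ a, ∃ e : V → ℕ, ∀ u, S.SC a u → e u < 11 ∧ OKn (e u) (e (S.σ u)) ∧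
      OKn (e u) (mcol (x u)) ∧ OKn (e u) (mcol (x (S.σ u))) := by
    intro a
    by_cases ho : S.IsOdd a
    · obtain ⟨w, haw, s, hs, d, hd, k1, k2, k3, k4⟩ := hw a ho
      have ho' := ho.sc haw
      have hdodd : ∃ n : ℕ, Odd n ∧ (d ^ n) w = w := by
        obtain ⟨n, hn, h⟩ := ho'
        rcases hd with rfl | rfl
        · exact ⟨n, hn, h⟩
        · refine ⟨n, hn, ?_⟩
          rw [inv_pow, Perm.inv_eq_iff_eq, h]
      obtain ⟨n, hn, h⟩ := hdodd
      have hdvd : Function.minimalPeriod d w ∣ n := by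
        apply Function.IsPeriodicPt.minimalPeriod_dvd
        rw [Function.IsPeriodicPt, Function.IsFixedPt, ← Perm.coe_pow]; exact h
      have hodd : Odd (Function.minimalPeriod d w) := hn.of_dvd_nat hdvd
      have h5 : 5 ≤ Function.minimalPeriod d w := by
        have hnd := nd4 (hg a ho) haw hd
        simp only [List.nodup_cons, List.mem_cons, List.not_mem_nil, or_false, not_or] at hnd
        have hp := Function.iterate_minimalPeriod (f := d) (x := w)
        by_contra hlt
        have : Function.minimalPeriod d w = 1 ∨ Function.minimalPeriod d w = 3 := by
          obtain ⟨k, hk⟩ := hodd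
          omega
        rcases this with h | h <;> rw [h] at hp
        · exact hnd.1.1 hp.symm
        · exact hnd.1.2.2 hp.symm
      obtain ⟨e, he⟩ := orb_odd d w x hodd h5 hs k1 k2 k3 k4
      rcases hd with rfl | rfl
      · exact ⟨e, fun u hu => he u (haw.symm.trans hu)⟩
      · refine ⟨fun u => e (S.σ u), ?_⟩
        intro u hu
        have hu1 : S.SC w (S.σ u) := haw.symm.trans (hu.trans (Dir.sc (Or.inl rfl) u))
        have hu2 : S.SC w (S.σ (S.σ u)) := hu1.trans (Dir.sc (Or.inl rfl) _)
        obtain ⟨p1, p2, p3, p4⟩ := he (S.σ u) (Perm.sameCycle_inv.2 hu1)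
        obtain ⟨q1, q2, q3, q4⟩ := he (S.σ (S.σ u)) (Perm.sameCycle_inv.2 hu2)
        simp only [Perm.coe_inv, symm_apply_apply] at p4 q2
        exact ⟨p1, q2.symm, p4, p3⟩
    · refine orb_even S.σ a x ?_
      rw [← Nat.not_odd_iff_even]
      intro h
      exact ho ⟨_, h, by rw [Perm.coe_pow]; exact Function.iterate_minimalPeriod⟩
  choose E hE using key
  let st : Setoid V := Perm.SameCycle.setoid S.σ
  let r : V → V := fun a => (Quotient.mk st a).out
  have hr : ∀ a, S.SC (r a) a := fun a => Quotient.exact (Quotient.out_eq (Quotient.mk st a))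
  have hr2 : ∀ a b, S.SC a b → r a = r b := fun a b hab => by
    have : Quotient.mk st a = Quotient.mk st b := Quotient.sound hab
    simp only [r, this]
  have hmc : ∀ s, mcol s < 11 := by decide
  refine ⟨fun v => E (r v) v, fun v => mcol (x v), fun v => (hE (r v) v (hr v)).1, fun v => hmc _, fun v => by
    simp only [hx], ?_⟩
  intro v
  obtain ⟨-, h2, h3, h4⟩ := hE (r v) v (hr v)
  have := hr2 v (S.σ v) (Dir.sc (Or.inl rfl) v)
  refine ⟨?_, h3, h4⟩
  show OKn (E (r v) v) (E (r (S.σ v)) (S.σ v))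
  rw [← this]; exact h2

end CSys

open Equiv
namespace CSys
open Classical
variable {V : Type*}

/-- orientation of a 2-regular relation -/
theorem orient [Fintype V] (H : V → V → Prop) (hs : ∀ x y, H x y → H y x) (hi : ∀ x, ¬ H x x)
    (n1 n2 : V → V) (hne : ∀ v, n1 v ≠ n2 v) (hn : ∀ v y, H v y ↔ y = n1 v ∨ y = n2 v) :
    ∃ σ : Perm V, ∀ v, H v (σ v) ∧ σ (σ v) ≠ v := by
  let oth : V → V → V := fun y x => if x = n1 y then n2 y else n1 y
  have o1 : ∀ y x, H y (oth y x) := by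
    intro y x; simp only [oth]; split_ifs <;> simp [hn]
  have o2 : ∀ y x, H y x → oth y x ≠ x := by
    intro y x h; rw [hn] at h; simp only [oth]
    split_ifs with h1
    · rw [h1]; exact (hne y).symm
    · exact fun h => h1 h.symm
  have o3 : ∀ y x, H y x → oth y (oth y x) = x := by
    intro y x h; rw [hn] at h; simp only [oth]
    rcases h with rfl | rfl
    · simp [(hne y).symm]
    · simp [(hne y).symm]
  have o4 : ∀ y x z, H y x → H y z → x ≠ z → z = oth y x := by
    intro y x z h h' hxz; rw [hn] at h h'; simp only [oth]
    rcases h with rfl | rfl <;> rcases h' with rfl | rfl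
    · exact absurd rfl hxz
    · simp
    · simp [(hne y).symm]
    · exact absurd rfl hxz
  let D := {p : V × V // H p.1 p.2}
  let φ : Perm D :=
    { toFun := fun p => ⟨(p.1.2, oth p.1.2 p.1.1), o1 _ _⟩
      invFun := fun p => ⟨(oth p.1.1 p.1.2, p.1.1), hs _ _ (o1 _ _)⟩
      left_inv := by
        rintro ⟨⟨x, y⟩, h⟩
        apply Subtype.ext
        simp only [Prod.mk.injEq, and_true]
        exact o3 _ _ (hs _ _ h)
      right_inv := by
        rintro ⟨⟨x, y⟩, h⟩
        apply Subtype.ext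
        simp only [Prod.mk.injEq, true_and]
        exact o3 _ _ h }
  let r : Perm D :=
    { toFun := fun p => ⟨(p.1.2, p.1.1), hs _ _ p.2⟩
      invFun := fun p => ⟨(p.1.2, p.1.1), hs _ _ p.2⟩
      left_inv := fun p => rfl
      right_inv := fun p => rfl }
  have hrr : ∀ d, r (r d) = d := fun d => rfl
  have hr : r * r = 1 := by ext1 d; rfl
  have hr' : r⁻¹ = r := inv_eq_of_mul_eq_one_left hr
  have hrφ : r * φ * r⁻¹ = φ⁻¹ := by
    rw [hr']; ext1 d; rfl
  have hrφk : ∀ (k : ℤ) d, r ((φ ^ k) d) = (φ ^ (-k)) (r d) := by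
    intro k d
    have : r * φ ^ k * r⁻¹ = φ ^ (-k) := by
      rw [← conj_zpow, hrφ, inv_zpow, zpow_neg]
    rw [← this]
    simp
  have hnsc : ∀ d, ¬ φ.SameCycle d (r d) := by
    rintro d ⟨k, hk⟩
    obtain ⟨m, hm | hm⟩ := Int.even_or_odd' k
    · have h1 : (φ ^ m) d = r ((φ ^ m) d) := by
        rw [hrφk, ← hk, ← Perm.mul_apply, ← zpow_add]
        congr 2; omega
      have := congrArg (fun p : D => p.1.1) h1
      have h2 : ((φ ^ m) d).1.1 = ((φ ^ m) d).1.2 := this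
      have h3 := ((φ ^ m) d).2
      rw [h2] at h3
      exact hi _ h3
    · have h1 : φ ((φ ^ m) d) = r ((φ ^ m) d) := by
        rw [hrφk, ← hk, ← Perm.mul_apply, ← Perm.mul_apply, ← zpow_one_add, ← zpow_add]
        congr 2; omega
      have := congrArg (fun p : D => p.1.2) h1
      have h2 : oth ((φ ^ m) d).1.2 ((φ ^ m) d).1.1 = ((φ ^ m) d).1.1 := this
      exact o2 _ _ (hs _ _ ((φ ^ m) d).2) h2
  let st : Setoid D := Perm.SameCycle.setoid φ
  let lin : LinearOrder (Quotient st) := WellOrderingRel.isWellOrder.linearOrder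
  let q : D → Quotient st := fun d => Quotient.mk st d
  have hq1 : ∀ d, q (φ d) = q d := fun d => Quotient.sound (Perm.sameCycle_apply_left.2 (Perm.SameCycle.refl _ _))
  have hq2 : ∀ d, q (r (φ d)) = q (r d) := by
    intro d
    apply Quotient.sound
    have := hrφk 1 d
    rw [zpow_one] at this
    rw [this]
    exact Perm.SameCycle.symm ⟨-1, rfl⟩
  have hq3 : ∀ d, q d ≠ q (r d) := fun d h => hnsc d (Quotient.exact h)
  let P : D → Prop := fun d => q d < q (r d)
  have hP1 : ∀ d, P (φ d) ↔ P d := by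
    intro d; simp only [P, hq1, hq2]
  have hP2 : ∀ d, P (r d) ↔ ¬ P d := by
    intro d; simp only [P, hrr, not_lt]
    exact ⟨le_of_lt, fun h => lt_of_le_of_ne h (hq3 d).symm⟩
  have hex : ∀ v, ∃ y, ∃ h : H v y, P ⟨(v, y), h⟩ := by
    intro v
    have h1 : H v (n1 v) := (hn _ _).2 (Or.inl rfl)
    by_cases hp : P ⟨(v, n1 v), h1⟩
    · exact ⟨_, h1, hp⟩
    · refine ⟨_, o1 v (n1 v), ?_⟩
      have := (hP1 ⟨(n1 v, v), hs _ _ h1⟩).2 ((hP2 ⟨(v, n1 v), h1⟩).2 hp)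
      exact this
  choose f hf hfP using hex
  have hinj : Function.Injective f := by
    intro v w hvw
    by_contra hne
    have hw : H v (f w) := hvw ▸ hf v
    have hwP : P ⟨(v, f w), hw⟩ := by
      have := hfP v
      convert this using 3
      rw [hvw]
    have h1 := (hP1 _).2 hwP
    have e : oth (f w) v = w := (o4 (f w) v w (hs _ _ hw) (hs _ _ (hf w)) hne).symm
    have h2 : φ ⟨(v, f w), hw⟩ = r ⟨(w, f w), hf w⟩ := by
      apply Subtype.ext
      show (f w, oth (f w) v) = (f w, w)
      rw [e]
    rw [h2] at h1
    exact (hP2 _).1 h1 (hfP w)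
  refine ⟨Equiv.ofBijective f (Finite.injective_iff_bijective.1 hinj), ?_⟩
  intro v
  refine ⟨hf v, ?_⟩
  intro h
  have h : f (f v) = v := h
  have h1 := hfP (f v)
  have h2 : (⟨(f v, f (f v)), hf (f v)⟩ : D) = r ⟨(v, f v), hf v⟩ := by
    apply Subtype.ext
    show (f v, f (f v)) = (f v, v)
    rw [h]
  rw [h2] at h1
  exact (hP2 _).1 h1 (hfP v)

end CSys

open Equiv
namespace CSys
open Classical
variable {V : Type*}

def NoCut1 (G : SimpleGraph V) : Prop := ∀ (C : Set V) a b, G.Adj a b → a ∈ C → b ∉ C →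
  ∃ x y, G.Adj x y ∧ x ∈ C ∧ y ∉ C ∧ ¬ (x = a ∧ y = b)

def Tran (G : SimpleGraph V) : Prop := ∀ A : Set V, A.Nonempty →
  (∀ v ∈ A, ∀ y, G.Adj v y → y ∈ A) → ∀ v, v ∈ A

def Cub (G : SimpleGraph V) [Fintype V] : Prop := ∀ v, (Finset.univ.filter (fun y => G.Adj v y)).card = 3

variable [Fintype V]

noncomputable def cutset (G : SimpleGraph V) (C : Set V) : Finset (V × V) :=
  Finset.univ.filter (fun p => G.Adj p.1 p.2 ∧ p.1 ∈ C ∧ p.2 ∉ C)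

theorem sum_deg {G : SimpleGraph V} (hc : Cub G) (C : Finset V) :
    (Finset.univ.filter (fun p : V × V => G.Adj p.1 p.2 ∧ p.1 ∈ C)).card = 3 * C.card := by
  have : (Finset.univ.filter (fun p : V × V => G.Adj p.1 p.2 ∧ p.1 ∈ C)) =
      C.biUnion (fun x => (Finset.univ.filter (fun y => G.Adj x y)).map ⟨fun y => (x, y), Prod.mk_right_injective x⟩) := by
    ext ⟨x, y⟩
    simp
    tauto
  rw [this, Finset.card_biUnion]
  · simp only [Finset.card_map, hc _]
    simp [mul_comm]
  · intro x _ x' _ hne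
    simp only [Function.onFun]
    rw [Finset.disjoint_left]
    rintro ⟨p, q⟩ h h'
    simp at h h'
    exact hne (h.2.trans h'.2.symm)

theorem cut_odd {G : SimpleGraph V} (hc : Cub G) (C : Finset V) (ho : Odd C.card) :
    Odd (cutset G (C : Set V)).card := by
  have h1 := sum_deg hc C
  have h2 : (Finset.univ.filter (fun p : V × V => G.Adj p.1 p.2 ∧ p.1 ∈ C)) =
    (Finset.univ.filter (fun p : V × V => G.Adj p.1 p.2 ∧ p.1 ∈ C ∧ p.2 ∈ C)) ∪ cutset G C := by
    ext ⟨x, y⟩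
    simp [cutset]
    tauto
  have h3 : Disjoint (Finset.univ.filter (fun p : V × V => G.Adj p.1 p.2 ∧ p.1 ∈ C ∧ p.2 ∈ C)) (cutset G C) := by
    rw [Finset.disjoint_left]
    rintro ⟨p, q⟩ h h'
    simp [cutset] at h h'
    tauto
  have h4 : Even (Finset.univ.filter (fun p : V × V => G.Adj p.1 p.2 ∧ p.1 ∈ C ∧ p.2 ∈ C)).card := by
    rw [← ZMod.natCast_eq_zero_iff_even, Finset.card_eq_sum_ones, Nat.cast_sum]
    apply Finset.sum_involution (fun p _ => (p.2, p.1))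
    · intro a ha; decide
    · intro a ha _ h
      simp at ha
      apply ha.1.ne
      have := congrArg Prod.fst h
      exact this.symm
    · intro a ha
      simp at ha ⊢
      exact ⟨ha.1.symm, ha.2.2, ha.2.1⟩
    · intro a ha; rfl
  rw [h2, Finset.card_union_of_disjoint h3] at h1
  rw [Nat.odd_iff] at *
  rw [Nat.even_iff] at h4
  omega

theorem cut_three {G : SimpleGraph V} (hc : Cub G) (hn : NoCut1 G) (C : Finset V) (ho : Odd C.card) :
    3 ≤ (cutset G (C : Set V)).card := by
  have h := cut_odd hc C ho
  have h1 : (cutset G (C : Set V)).card ≠ 1 := by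
    intro h1
    obtain ⟨⟨a, b⟩, hab⟩ := Finset.card_eq_one.1 h1
    have hm : (a, b) ∈ cutset G (C : Set V) := by rw [hab]; simp
    simp only [cutset, Finset.mem_filter, Finset.mem_univ, true_and] at hm
    obtain ⟨x, y, hx, hxC, hy, hne⟩ := hn C a b hm.1 hm.2.1 hm.2.2
    have : (x, y) ∈ cutset G (C : Set V) := by
      simp only [cutset, Finset.mem_filter, Finset.mem_univ, true_and]; exact ⟨hx, hxC, hy⟩
    rw [hab] at this
    simp at this
    exact hne this
  rw [Nat.odd_iff] at h
  omega

theorem petersen_mu {G : SimpleGraph V} (hc : Cub G) (hn : NoCut1 G) :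
    ∃ μ : V → V, (∀ v, μ (μ v) = v) ∧ ∀ v, G.Adj v (μ v) := by
  have : ∃ M : G.Subgraph, M.IsPerfectMatching := by
    rw [SimpleGraph.tutte]
    intro u hu
    unfold SimpleGraph.IsTutteViolator at hu
    let K := ((⊤ : G.Subgraph).deleteVerts u).coe
    let U : Finset V := u.toFinset
    let B : Finset K.ConnectedComponent := K.oddComponents.toFinset
    let T : K.ConnectedComponent → Finset V := fun c => (Subtype.val '' c.supp : Set V).toFinset
    have hT : ∀ c v, v ∈ T c ↔ ∃ h, (⟨v, h⟩ : ((⊤ : G.Subgraph).deleteVerts u).verts) ∈ c.supp := by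
      intro c v; simp [T]
    have hTc : ∀ c ∈ B, Odd (T c).card := by
      intro c hcB
      have : Odd c.supp.ncard := by simpa [B] using hcB
      rwa [← Set.ncard_image_of_injective _ Subtype.val_injective, Set.ncard_eq_toFinset_card'] at this
    have hsub : B.biUnion (fun c => cutset G (T c : Set V)) ⊆
        (Finset.univ.filter (fun p : V × V => G.Adj p.1 p.2 ∧ p.1 ∈ U)).map
          ⟨Prod.swap, Prod.swap_injective⟩ := by
      rintro ⟨x, y⟩ h
      simp only [Finset.mem_biUnion, cutset, Finset.mem_filter, Finset.mem_univ, true_and] at h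
      obtain ⟨c, hcB, hadj, hx, hy⟩ := h
      rw [Finset.mem_map]
      refine ⟨(y, x), ?_, rfl⟩
      simp only [Finset.mem_filter, Finset.mem_univ, true_and]
      refine ⟨hadj.symm, ?_⟩
      by_contra hyU
      apply hy
      obtain ⟨hxv, hxc⟩ := (hT c x).1 hx
      have hyv : y ∈ ((⊤ : G.Subgraph).deleteVerts u).verts := by
        simp [U] at hyU ⊢; exact hyU
      refine (hT c y).2 ⟨hyv, ?_⟩
      refine c.mem_supp_of_adj_mem_supp hxc ?_
      simp [K] at hxv hyv ⊢
      exact ⟨hxv, hyv, hadj⟩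
    have hcard := Finset.card_le_card hsub
    rw [Finset.card_map, sum_deg hc, Finset.card_biUnion] at hcard
    · have h1 : ∑ c ∈ B, 3 ≤ ∑ c ∈ B, (cutset G (T c : Set V)).card :=
        Finset.sum_le_sum (fun c hcB => cut_three hc hn _ (hTc c hcB))
      have hB : B.card = K.oddComponents.ncard := by rw [Set.ncard_eq_toFinset_card']
      have hU : U.card = u.ncard := by rw [Set.ncard_eq_toFinset_card']
      simp only [Finset.sum_const, smul_eq_mul] at h1
      have : u.ncard < K.oddComponents.ncard := hu
      omega
    · intro c _ c' _ hne
      simp only [Function.onFun]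
      rw [Finset.disjoint_left]
      rintro ⟨p, q⟩ h h'
      simp only [cutset, Finset.mem_filter, Finset.mem_univ, true_and] at h h'
      obtain ⟨k1, k2⟩ := (hT _ _).1 h.2.1
      obtain ⟨k1', k2'⟩ := (hT _ _).1 h'.2.1
      exact hne (SimpleGraph.ConnectedComponent.eq_of_common_vertex k2 k2')
  obtain ⟨M, hM, hsp⟩ := this
  have : ∀ v, ∃ w, M.Adj v w := fun v => (hM (hsp v)).exists
  choose μ hμ using this
  refine ⟨μ, fun v => ?_, fun v => (hμ v).adj_sub⟩
  exact hM.eq_of_adj_left (hμ (μ v)) (hμ v).symm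

end CSys

open Equiv
namespace CSys
open Classical
variable {V : Type*}

structure IsoTri (G : SimpleGraph V) (u v w u' v' w' : V) : Prop where
  uv : G.Adj u v
  vw : G.Adj v w
  uw : G.Adj u w
  uu : G.Adj u u'
  vv : G.Adj v v'
  ww : G.Adj w w'
  n1 : u' ≠ v'
  n2 : u' ≠ w'
  n3 : v' ≠ w'
  m1 : u' ≠ v
  m2 : u' ≠ w
  m3 : v' ≠ u
  m4 : v' ≠ w
  m5 : w' ≠ u
  m6 : w' ≠ v

def EC (G : SimpleGraph V) : Prop := ∃ c : V → V → ℕ, (∀ x y, G.Adj x y → c x y = c y x) ∧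
  (∀ x y, G.Adj x y → c x y < 11) ∧ ∀ x y z, G.Adj x y → G.Adj x z → y ≠ z → OKn (c x y) (c x z)

variable [Fintype V]

theorem chord_false {G : SimpleGraph V} (hn : NoCut1 G)
    (hiso : ∀ u v w u' v' w', ¬ IsoTri G u v w u' v' w') (S : CSys V)
    (hadj : ∀ v y, G.Adj v y ↔ y = S.μ v ∨ y = S.σ v ∨ y = S.σ⁻¹ v)
    (h1 : ∀ v, S.σ v ≠ v) (h2 : ∀ v, S.σ (S.σ v) ≠ v) (b : V)
    (h5 : S.σ (S.σ (S.σ (S.σ (S.σ b)))) = b) (hμ : S.μ b = S.σ (S.σ b)) : False := by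
  have hinj : ∀ x y, S.μ x = S.μ y → x = y := fun x y h => by rw [← S.μμ x, h, S.μμ]
  have hi : ∀ z, S.σ⁻¹ (S.σ z) = z := fun z => by simp
  have aσ : ∀ v, G.Adj v (S.σ v) := fun v => (hadj _ _).2 (Or.inr (Or.inl rfl))
  have aμ : ∀ v, G.Adj v (S.μ v) := fun v => (hadj _ _).2 (Or.inl rfl)
  obtain ⟨v1, e1⟩ : ∃ v, v = S.σ b := ⟨_, rfl⟩
  obtain ⟨v2, e2⟩ : ∃ v, v = S.σ v1 := ⟨_, rfl⟩
  obtain ⟨v3, e3⟩ : ∃ v, v = S.σ v2 := ⟨_, rfl⟩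
  obtain ⟨v4, e4⟩ : ∃ v, v = S.σ v3 := ⟨_, rfl⟩
  rw [← e1, ← e2] at hμ
  rw [← e1, ← e2, ← e3, ← e4] at h5
  have n01 : b ≠ v1 := e1 ▸ (h1 b).symm
  have n12 : v1 ≠ v2 := e2 ▸ (h1 v1).symm
  have n23 : v2 ≠ v3 := e3 ▸ (h1 v2).symm
  have n34 : v3 ≠ v4 := e4 ▸ (h1 v3).symm
  have n40 : v4 ≠ b := h5 ▸ (h1 v4).symm
  have n02 : b ≠ v2 := by rw [e2, e1]; exact (h2 b).symm
  have n13 : v1 ≠ v3 := by rw [e3, e2]; exact (h2 _).symm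
  have n24 : v2 ≠ v4 := by rw [e4, e3]; exact (h2 _).symm
  have n30 : v3 ≠ b := by rw [← h5, e4]; exact (h2 _).symm
  have n41 : v4 ≠ v1 := by rw [e1, ← h5]; exact (h2 _).symm
  have i1 : S.σ⁻¹ v1 = b := by rw [e1, hi]
  have i2 : S.σ⁻¹ v2 = v1 := by rw [e2, hi]
  have i3 : S.σ⁻¹ v3 = v2 := by rw [e3, hi]
  have i4 : S.σ⁻¹ v4 = v3 := by rw [e4, hi]
  have i0 : S.σ⁻¹ b = v4 := by rw [← h5, hi]
  have hμ2 : S.μ v2 = b := by rw [← hμ, S.μμ]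
  have m10 : S.μ v1 ≠ b := by
    intro h; rw [← hμ2] at h; exact n12 (hinj _ _ h)
  have m12 : S.μ v1 ≠ v2 := by
    intro h; rw [← hμ] at h; exact n01 (hinj _ _ h).symm
  by_cases c3 : S.μ v1 = v3
  · have c3' : S.μ v3 = v1 := by rw [← c3, S.μμ]
    obtain ⟨x, y, hxy, hx, hy, hne⟩ := hn {b, v1, v2, v3, v4} v4 (S.μ v4) (aμ _) (by simp) (by
      simp only [Set.mem_insert_iff, Set.mem_singleton_iff, not_or]
      refine ⟨?_, ?_, ?_, ?_, S.μne v4⟩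
      · intro h; rw [← hμ2] at h; exact n24 (hinj _ _ h).symm
      · intro h; rw [← c3'] at h; exact n34 (hinj _ _ h).symm
      · intro h; rw [← hμ] at h; exact n40 (hinj _ _ h)
      · intro h; rw [← c3] at h; exact n41 (hinj _ _ h))
    rw [hadj] at hxy
    simp only [Set.mem_insert_iff, Set.mem_singleton_iff] at hx hy
    rcases hx with hx | hx | hx | hx | hx <;> rcases hxy with hxy | hxy | hxy <;>
      first
      | (rw [hx] at hxy; exact hne ⟨hx, hxy⟩)
      | (rw [hx] at hxy
         first | rw [hμ] at hxy | rw [hμ2] at hxy | rw [c3] at hxy | rw [c3'] at hxy | rw [← e1] at hxy | rw [← e2] at hxy | rw [← e3] at hxy | rw [← e4] at hxy | rw [h5] at hxy | rw [i0] at hxy | rw [i1] at hxy | rw [i2] at hxy | rw [i3] at hxy | rw [i4] at hxy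
         exact hy (by simp [hxy]))
  by_cases c4 : S.μ v1 = v4
  · have c4' : S.μ v4 = v1 := by rw [← c4, S.μμ]
    obtain ⟨x, y, hxy, hx, hy, hne⟩ := hn {b, v1, v2, v3, v4} v3 (S.μ v3) (aμ _) (by simp) (by
      simp only [Set.mem_insert_iff, Set.mem_singleton_iff, not_or]
      refine ⟨?_, ?_, ?_, S.μne v3, ?_⟩
      · intro h; rw [← hμ2] at h; exact n23 (hinj _ _ h).symm
      · intro h; rw [← c4'] at h; exact n34 (hinj _ _ h)
      · intro h; rw [← hμ] at h; exact n30 (hinj _ _ h)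
      · intro h; rw [← c4] at h; exact n13 (hinj _ _ h).symm)
    rw [hadj] at hxy
    simp only [Set.mem_insert_iff, Set.mem_singleton_iff] at hx hy
    rcases hx with hx | hx | hx | hx | hx <;> rcases hxy with hxy | hxy | hxy <;>
      first
      | (rw [hx] at hxy; exact hne ⟨hx, hxy⟩)
      | (rw [hx] at hxy
         first | rw [hμ] at hxy | rw [hμ2] at hxy | rw [c4] at hxy | rw [c4'] at hxy | rw [← e1] at hxy | rw [← e2] at hxy | rw [← e3] at hxy | rw [← e4] at hxy | rw [h5] at hxy | rw [i0] at hxy | rw [i1] at hxy | rw [i2] at hxy | rw [i3] at hxy | rw [i4] at hxy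
         exact hy (by simp [hxy]))
  · refine hiso b v1 v2 v4 (S.μ v1) v3 ⟨e1 ▸ aσ b, e2 ▸ aσ v1, hμ ▸ aμ b, ?_, aμ _, e3 ▸ aσ v2,
      fun h => c4 h.symm, n34.symm, c3, n41, n24.symm, m10, m12, n30, n13.symm⟩
    have := aσ v4
    rw [h5] at this
    exact this.symm

theorem hg_of {G : SimpleGraph V} (hn : NoCut1 G)
    (hiso : ∀ u v w u' v' w', ¬ IsoTri G u v w u' v' w') (S : CSys V)
    (hadj : ∀ v y, G.Adj v y ↔ y = S.μ v ∨ y = S.σ v ∨ y = S.σ⁻¹ v)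
    (h1 : ∀ v, S.σ v ≠ v) (h2 : ∀ v, S.σ (S.σ v) ≠ v) (a : V) (ho : S.IsOdd a) :
    S.Pent a ∨ S.Long a := by
  have hinj : ∀ x y, S.μ x = S.μ y → x = y := fun x y h => by rw [← S.μμ x, h, S.μμ]
  have aσ : ∀ v, G.Adj v (S.σ v) := fun v => (hadj _ _).2 (Or.inr (Or.inl rfl))
  have aμ : ∀ v, G.Adj v (S.μ v) := fun v => (hadj _ _).2 (Or.inl rfl)
  obtain ⟨n, hnn, h⟩ := ho
  have hdvd : Function.minimalPeriod S.σ a ∣ n := by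
    apply Function.IsPeriodicPt.minimalPeriod_dvd
    rw [Function.IsPeriodicPt, Function.IsFixedPt, ← Perm.coe_pow]; exact h
  have hodd : Odd (Function.minimalPeriod S.σ a) := hnn.of_dvd_nat hdvd
  have hp := Function.iterate_minimalPeriod (f := S.σ) (x := a)
  have htr : ∀ b k, S.SC a b → (S.σ ^ k) b = b → (S.σ ^ k) a = a := by
    rintro b k ⟨i, rfl⟩ hb
    rw [← Perm.mul_apply, (Commute.pow_left (Commute.zpow_right (Commute.refl _) i) k).eq, Perm.mul_apply] at hb
    exact (S.σ ^ i).injective hb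
  have htr2 : ∀ b k, S.SC a b → (S.σ ^ k) a = a → (S.σ ^ k) b = b := by
    rintro b k ⟨i, rfl⟩ hb
    rw [← Perm.mul_apply, (Commute.pow_left (Commute.zpow_right (Commute.refl _) i) k).eq, Perm.mul_apply, hb]
  have cases : Function.minimalPeriod S.σ a = 1 ∨ Function.minimalPeriod S.σ a = 3 ∨
      Function.minimalPeriod S.σ a = 5 ∨ 7 ≤ Function.minimalPeriod S.σ a := by
    obtain ⟨k, hk⟩ := hodd; omega
  rcases cases with c | c | c | c
  · rw [c] at hp; exact absurd hp (h1 a)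
  · rw [c] at hp
    have hp : S.σ (S.σ (S.σ a)) = a := hp
    exfalso
    refine hiso a (S.σ a) (S.σ (S.σ a)) (S.μ a) (S.μ (S.σ a)) (S.μ (S.σ (S.σ a)))
      ⟨aσ _, aσ _, ?_, aμ _, aμ _, aμ _, fun h => h1 _ (hinj _ _ h).symm, fun h => h2 _ (hinj _ _ h).symm,
       fun h => h1 _ (hinj _ _ h).symm, S.μσ _, ?_, ?_, S.μσ _, ?_, ?_⟩
    · have := aσ (S.σ (S.σ a)); rw [hp] at this; exact this.symm
    · intro h; apply S.μσ (S.σ (S.σ a)); rw [hp, ← h, S.μμ]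
    · intro h; apply S.μσ a; rw [← S.μμ (S.σ a), h]
    · intro h; apply S.μσ (S.σ (S.σ a)); rw [hp, h]
    · intro h; apply S.μσ (S.σ a); rw [← S.μμ (S.σ (S.σ a)), h]
  · left
    rw [c] at hp
    have hp : S.σ (S.σ (S.σ (S.σ (S.σ a)))) = a := hp
    refine ⟨hp, h1 a, ?_⟩
    have h5 : ∀ b, S.SC a b → S.σ (S.σ (S.σ (S.σ (S.σ b)))) = b := fun b hb => htr2 b 5 hb hp
    intro b hab hbm
    have hb5 := h5 b hab
    obtain ⟨i, hi⟩ := Perm.SameCycle.exists_nat_pow_eq hbm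
    have hi' : (S.σ ^ (i % 5)) b = S.μ b := by
      rw [← hi, ← Nat.mod_add_div i 5]
      simp only [Nat.add_mul_mod_self_left, Nat.mod_mod, pow_add, pow_mul, Perm.mul_apply]
      congr 1
      symm
      have : ∀ k, (((S.σ ^ 5) ^ k) b) = b := by
        intro k
        induction k with
        | zero => rfl
        | succ k ih => rw [pow_succ, Perm.mul_apply]; rw [show (S.σ ^ 5) b = b from hb5, ih]
      exact this _
    have hlt := Nat.mod_lt i (show 0 < 5 by norm_num)
    interval_cases hk : i % 5
    · exact S.μne b hi'.symm
    · exact S.μσ b hi'.symm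
    · exact chord_false hn hiso S hadj h1 h2 b hb5 hi'.symm
    · have hi' : S.σ (S.σ (S.σ b)) = S.μ b := hi'
      refine chord_false hn hiso S hadj h1 h2 (S.μ b) (h5 _ (hab.trans hbm)) ?_
      rw [S.μμ, ← hi', hb5]
    · have hi' : S.σ (S.σ (S.σ (S.σ b))) = S.μ b := hi'
      apply S.μσ (S.μ b)
      rw [S.μμ, ← hi', hb5]
  · right
    have hk : ∀ b, S.SC a b → ∀ k, 1 ≤ k → k < 7 → (S.σ ^ k) b ≠ b := by
      intro b hb k k1 k2 h
      have := htr b k hb h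
      have hd : Function.minimalPeriod S.σ a ∣ k := by
        apply Function.IsPeriodicPt.minimalPeriod_dvd
        rw [Function.IsPeriodicPt, Function.IsFixedPt, ← Perm.coe_pow]; exact this
      have := Nat.le_of_dvd (by omega) hd
      omega
    intro d hd b hb
    have hkd : ∀ b, S.SC a b → ∀ k, 1 ≤ k → k < 7 → (d ^ k) b ≠ b := by
      intro b hb k k1 k2 h
      rcases hd with rfl | rfl
      · exact hk b hb k k1 k2 h
      · rw [inv_pow, Perm.inv_eq_iff_eq] at h
        exact hk b hb k k1 k2 h.symm
    obtain ⟨c, hc⟩ : ∃ c, c = d⁻¹ (d⁻¹ b) := ⟨_, rfl⟩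
    have hbc : b = d (d c) := by rw [hc]; simp
    have hac : S.SC a c := by
      rw [hc]
      exact (hb.trans (hd.inv.sc _)).trans (hd.inv.sc _)
    have hi : ∀ z, d⁻¹ (d z) = z := fun z => by simp
    have q1 := hkd c hac 1 (by norm_num) (by norm_num)
    have q2 := hkd c hac 2 (by norm_num) (by norm_num)
    have q3 := hkd c hac 3 (by norm_num) (by norm_num)
    have q4 := hkd c hac 4 (by norm_num) (by norm_num)
    have q5 := hkd c hac 5 (by norm_num) (by norm_num)
    simp only [pow_succ, pow_zero, one_mul, Perm.mul_apply] at q1 q2 q3 q4 q5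
    rw [← hc, hbc, hi]
    simp [q1, q2, q3, q4, q5, Ne.symm q1, Ne.symm q2, Ne.symm q3, Ne.symm q4, Ne.symm q5]

theorem base_case {G : SimpleGraph V} [Nonempty V] (hc : Cub G) (ht : Tran G) (hn : NoCut1 G)
    (hiso : ∀ u v w u' v' w', ¬ IsoTri G u v w u' v' w') : EC G := by
  obtain ⟨μ, μμ, aμ⟩ := petersen_mu hc hn
  let H : V → V → Prop := fun x y => G.Adj x y ∧ y ≠ μ x
  have hsym : ∀ x y, H x y → H y x := by
    rintro x y ⟨h1, h2⟩
    exact ⟨h1.symm, fun h => h2 (by rw [h, μμ])⟩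
  have hex : ∀ v, ∃ p : V × V, p.1 ≠ p.2 ∧ ∀ y, H v y ↔ y = p.1 ∨ y = p.2 := by
    intro v
    have h3 := hc v
    have hm : μ v ∈ Finset.univ.filter (fun y => G.Adj v y) := by simp [aμ]
    have h2 : ((Finset.univ.filter (fun y => G.Adj v y)).erase (μ v)).card = 2 := by
      rw [Finset.card_erase_of_mem hm, h3]
    obtain ⟨p, q, hpq, he⟩ := Finset.card_eq_two.1 h2
    refine ⟨(p, q), hpq, ?_⟩
    intro y
    have : y ∈ (Finset.univ.filter (fun y => G.Adj v y)).erase (μ v) ↔ y ∈ ({p, q} : Finset V) := by rw [he]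
    simp at this
    rw [← this]
    simp only [H]; tauto
  choose n hne hn2 using hex
  obtain ⟨σ, hσ⟩ := orient H hsym (fun x h => h.1.ne rfl) (fun v => (n v).1) (fun v => (n v).2) hne hn2
  have hσ' : ∀ v, H v (σ⁻¹ v) := by
    intro v
    have := hsym _ _ (hσ (σ⁻¹ v)).1
    simpa using this
  have hH : ∀ v y, H v y ↔ y = σ v ∨ y = σ⁻¹ v := by
    intro v y
    constructor
    · intro h
      have h1 := (hσ v).1
      have h2 := hσ' v
      have h3 : σ v ≠ σ⁻¹ v := by
        intro h
        apply (hσ v).2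
        rw [h]; simp
      rw [hn2] at h h1 h2
      rcases h with h | h <;> rcases h1 with h1 | h1 <;> rcases h2 with h2 | h2 <;> 
        first
        | exact Or.inl (h.trans h1.symm)
        | exact Or.inr (h.trans h2.symm)
        | exact absurd (h1.trans h2.symm) h3
    · rintro (rfl | rfl)
      · exact (hσ v).1
      · exact hσ' v
  have hadj : ∀ v y, G.Adj v y ↔ y = μ v ∨ y = σ v ∨ y = σ⁻¹ v := by
    intro v y
    rw [← hH]
    constructor
    · intro h
      by_cases hy : y = μ v
      · exact Or.inl hy
      · exact Or.inr ⟨h, hy⟩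
    · rintro (rfl | h)
      · exact aμ v
      · exact h.1
  let S : CSys V :=
    { σ := σ
      μ := μ
      μμ := μμ
      μne := fun v h => (aμ v).ne h.symm
      μσ := fun v h => (hσ v).1.2 h.symm
      tr := by
        intro A hA h1 h2
        apply ht A hA
        intro v hv y hy
        rcases (hadj v y).1 hy with rfl | rfl | rfl
        · exact h2 v hv
        · exact h1 v hv
        · have hpow : ∀ k : ℕ, (σ ^ k) v ∈ A := by
            intro k
            induction k with
            | zero => exact hv
            | succ k ih => rw [pow_succ', Perm.mul_apply]; exact h1 _ ih
          have : σ⁻¹ = σ ^ (orderOf σ - 1) := by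
            rw [inv_eq_iff_mul_eq_one, ← pow_succ', Nat.sub_add_cancel (orderOf_pos σ), pow_orderOf_eq_one]
          rw [this]
          exact hpow _ }
  obtain ⟨e, c, he, hcc, hcμ, hok⟩ := coloring (S := S)
    (hg_of hn hiso S hadj (fun v h => (hσ v).1.1.ne h.symm) (fun v => (hσ v).2))
  have hi : ∀ z, σ⁻¹ (σ z) = z := fun z => by simp
  have hi' : ∀ z, σ (σ⁻¹ z) = z := fun z => by simp
  let K : V → V → ℕ := fun x y => if y = μ x then c x else if y = σ x then e x else e y
  have k1 : ∀ x, K x (μ x) = c x := fun x => by simp [K]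
  have k2 : ∀ x, K x (σ x) = e x := fun x => by
    have : σ x ≠ μ x := (hσ x).1.2
    simp [K, this]
  have k3 : ∀ x, K x (σ⁻¹ x) = e (σ⁻¹ x) := fun x => by
    have h1 : σ⁻¹ x ≠ μ x := (hσ' x).2
    have h3 : σ⁻¹ x ≠ σ x := by
        intro h
        apply (hσ x).2
        rw [← h]; simp
    simp only [K, if_neg h1, if_neg h3]
  refine ⟨K, ?_, ?_, ?_⟩
  · intro x y hxy
    rcases (hadj x y).1 hxy with rfl | rfl | rfl
    · have := k1 (μ x)
      rw [μμ] at this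
      rw [k1, this]; exact (hcμ x).symm
    · have := k3 (σ x)
      rw [hi] at this
      rw [k2, this]
    · have := k2 (σ⁻¹ x)
      rw [hi'] at this
      rw [k3, this]
  · intro x y hxy
    rcases (hadj x y).1 hxy with rfl | rfl | rfl
    · rw [k1]; exact hcc _
    · rw [k2]; exact he _
    · rw [k3]; exact he _
  · intro x y z hxy hxz hyz
    obtain ⟨p1, p2, p3⟩ := hok x
    obtain ⟨q1, q2, q3⟩ := hok (σ⁻¹ x)
    have p1 : OKn (e x) (e (σ x)) := p1
    have q1 : OKn (e (σ⁻¹ x)) (e (σ (σ⁻¹ x))) := q1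
    have q3 : OKn (e (σ⁻¹ x)) (c (σ (σ⁻¹ x))) := q3
    rw [hi'] at q1 q3
    rcases (hadj x y).1 hxy with rfl | rfl | rfl <;> rcases (hadj x z).1 hxz with rfl | rfl | rfl <;>
      first
      | exact absurd rfl hyz
      | (simp only [k1, k2, k3]; first | assumption | (apply OKn.symm; assumption))

end CSys

open Equiv
namespace CSys
open Classical

section
variable {V : Type*} {G : SimpleGraph V} {u v w u' v' w' : V}

theorem nb3 [Fintype V] (hc : Cub G) {x a b c : V} (ha : G.Adj x a) (hb : G.Adj x b) (hcc : G.Adj x c)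
    (h1 : a ≠ b) (h2 : a ≠ c) (h3 : b ≠ c) {y : V} (hy : G.Adj x y) : y = a ∨ y = b ∨ y = c := by
  have hs : ({a, b, c} : Finset V) ⊆ Finset.univ.filter (fun y => G.Adj x y) := by
    intro z hz
    simp at hz ⊢
    rcases hz with rfl | rfl | rfl <;> assumption
  have he := Finset.eq_of_subset_of_card_le hs (by
    rw [hc x, Finset.card_eq_three.2 ⟨a, b, c, h1, h2, h3, rfl⟩])
  have : y ∈ Finset.univ.filter (fun y => G.Adj x y) := by simp [hy]
  rw [← he] at this
  simpa using this

theorem cub_of [Fintype V] (h : ∀ x, ∃ a b c, a ≠ b ∧ a ≠ c ∧ b ≠ c ∧ ∀ y, G.Adj x y ↔ y = a ∨ y = b ∨ y = c) :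
    Cub G := by
  intro x
  obtain ⟨a, b, c, h1, h2, h3, h4⟩ := h x
  rw [Finset.card_eq_three]
  refine ⟨a, b, c, h1, h2, h3, ?_⟩
  ext y
  simp [h4]

theorem cub3 [Fintype V] (hc : Cub G) {x a : V} (ha : G.Adj x a) :
    ∃ b c, a ≠ b ∧ a ≠ c ∧ b ≠ c ∧ ∀ y, G.Adj x y ↔ y = a ∨ y = b ∨ y = c := by
  have hm : a ∈ Finset.univ.filter (fun y => G.Adj x y) := by simp [ha]
  have h2 : ((Finset.univ.filter (fun y => G.Adj x y)).erase a).card = 2 := by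
    rw [Finset.card_erase_of_mem hm, hc x]
  obtain ⟨b, c, hbc, he⟩ := Finset.card_eq_two.1 h2
  have hmem : ∀ y, y ≠ a ∧ G.Adj x y ↔ y = b ∨ y = c := by
    intro y
    have : y ∈ (Finset.univ.filter (fun y => G.Adj x y)).erase a ↔ y ∈ ({b, c} : Finset V) := by rw [he]
    simpa using this
  refine ⟨b, c, ((hmem b).2 (Or.inl rfl)).1.symm, ((hmem c).2 (Or.inr rfl)).1.symm, hbc, ?_⟩
  intro y
  rw [← hmem]
  by_cases h : y = a
  · simp [h, ha]
  · simp [h]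

/-- contraction of a triangle -/
def contr (G : SimpleGraph V) (v w : V) (u v' w' : V) (h1 : v' ≠ u) (h2 : w' ≠ u) :
    SimpleGraph {x : V // x ≠ v ∧ x ≠ w} where
  Adj a b := G.Adj a.1 b.1 ∨ (a.1 = u ∧ (b.1 = v' ∨ b.1 = w')) ∨ (b.1 = u ∧ (a.1 = v' ∨ a.1 = w'))
  symm := ⟨by
    rintro a b (h | h | h)
    · exact Or.inl h.symm
    · exact Or.inr (Or.inr h)
    · exact Or.inr (Or.inl h)⟩
  loopless := ⟨by
    rintro a (h | ⟨h, h' | h'⟩ | ⟨h, h' | h'⟩)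
    · exact G.loopless.irrefl _ h
    · exact h1 (h'.symm.trans h)
    · exact h2 (h'.symm.trans h)
    · exact h1 (h'.symm.trans h)
    · exact h2 (h'.symm.trans h)⟩

theorem contract_step [Fintype V] (hc : Cub G) (ht : Tran G) (hn : NoCut1 G)
    (I : IsoTri G u v w u' v' w')
    (ih : Cub (contr G v w u v' w' I.m3 I.m5) → Tran (contr G v w u v' w' I.m3 I.m5) →
      NoCut1 (contr G v w u v' w' I.m3 I.m5) → EC (contr G v w u v' w' I.m3 I.m5)) : EC G := by
  obtain ⟨uv, vw, uw, uu, vv, ww, n1, n2, n3, m1, m2, m3, m4, m5, m6⟩ := I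
  have Nu : ∀ y, G.Adj u y → y = v ∨ y = w ∨ y = u' := fun y => nb3 hc uv uw uu vw.ne m1.symm m2.symm
  have Nv : ∀ y, G.Adj v y → y = u ∨ y = w ∨ y = v' := fun y => nb3 hc uv.symm vw vv uw.ne m3.symm m4.symm
  have Nw : ∀ y, G.Adj w y → y = u ∨ y = v ∨ y = w' := fun y => nb3 hc uw.symm vw.symm ww uv.ne m5.symm m6.symm
  have hu0 : u ≠ v ∧ u ≠ w := ⟨uv.ne, uw.ne⟩
  have hu0' : u' ≠ v ∧ u' ≠ w := ⟨m1, m2⟩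
  have hv0' : v' ≠ v ∧ v' ≠ w := ⟨vv.ne.symm, m4⟩
  have hw0' : w' ≠ v ∧ w' ≠ w := ⟨m6, ww.ne.symm⟩
  have uu'ne : u' ≠ u := uu.ne.symm
  obtain ⟨G', hG'⟩ : ∃ G', G' = contr G v w u v' w' m3 m5 := ⟨_, rfl⟩
  rw [← hG'] at ih
  have A' : ∀ a b, G'.Adj a b ↔ (G.Adj a.1 b.1 ∨ (a.1 = u ∧ (b.1 = v' ∨ b.1 = w')) ∨ (b.1 = u ∧ (a.1 = v' ∨ a.1 = w'))) := by
    intro a b; rw [hG']; rfl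
  let U : {x : V // x ≠ v ∧ x ≠ w} := ⟨u, hu0⟩
  let π : V → {x : V // x ≠ v ∧ x ≠ w} := fun x => if h : x ≠ v ∧ x ≠ w then ⟨x, h⟩ else U
  have π1 : ∀ x (h : x ≠ v ∧ x ≠ w), π x = ⟨x, h⟩ := fun x h => dif_pos h
  have πu : π u = U := π1 u hu0
  have πv : π v = U := dif_neg (by simp)
  have πw : π w = U := dif_neg (by simp)
  have πs : ∀ a, π a.1 = a := fun a => π1 a.1 a.2
  have πU : ∀ x, π x = U → x = u ∨ x = v ∨ x = w := by
    intro x hx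
    by_contra hcon
    simp only [not_or] at hcon
    rw [π1 x ⟨hcon.2.1, hcon.2.2⟩] at hx
    exact hcon.1 (congrArg Subtype.val hx)
  have πinj : ∀ x y, π x = π y → π x ≠ U → x = y := by
    intro x y h hx
    have h1 : x ≠ v ∧ x ≠ w := ⟨fun h => hx (h ▸ πv), fun h => hx (h ▸ πw)⟩
    have h2 : y ≠ v ∧ y ≠ w := ⟨fun h' => hx (h.trans (h' ▸ πv)), fun h' => hx (h.trans (h' ▸ πw))⟩
    rw [π1 x h1, π1 y h2] at h
    exact congrArg Subtype.val h
  have outT : ∀ x y, G.Adj x y → π x = U → π y ≠ U → (x = u ∧ y = u') ∨ (x = v ∧ y = v') ∨ (x = w ∧ y = w') := by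
    intro x y hxy hx hy
    have e1 : y ≠ u := fun h => hy (h ▸ πu)
    have e2 : y ≠ v := fun h => hy (h ▸ πv)
    have e3 : y ≠ w := fun h => hy (h ▸ πw)
    rcases πU x hx with rfl | rfl | rfl
    · have := Nu y hxy; tauto
    · have := Nv y hxy; tauto
    · have := Nw y hxy; tauto
  have hU' : ∀ x (h : x ≠ v ∧ x ≠ w), x = u' ∨ x = v' ∨ x = w' → G'.Adj U ⟨x, h⟩ := by
    rintro x h (rfl | rfl | rfl)
    · exact (A' _ _).2 (Or.inl uu)
    · exact (A' _ _).2 (Or.inr (Or.inl ⟨rfl, Or.inl rfl⟩))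
    · exact (A' _ _).2 (Or.inr (Or.inl ⟨rfl, Or.inr rfl⟩))
  have hom0 : ∀ x y, G.Adj x y → π x = U → π y ≠ U → G'.Adj (π x) (π y) := by
    intro x y hxy hx hy
    have hy' : y ≠ v ∧ y ≠ w := ⟨fun h => hy (h ▸ πv), fun h => hy (h ▸ πw)⟩
    rw [hx, π1 y hy']
    apply hU'
    rcases outT x y hxy hx hy with h | h | h <;> simp [h]
  have hom : ∀ x y, G.Adj x y → π x ≠ π y → G'.Adj (π x) (π y) := by
    intro x y hxy hne
    by_cases hx : π x = U
    · exact hom0 x y hxy hx (fun h => hne (hx.trans h.symm))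
    by_cases hy : π y = U
    · exact (hom0 y x hxy.symm hy hx).symm
    have hx' : x ≠ v ∧ x ≠ w := ⟨fun h => hx (h ▸ πv), fun h => hx (h ▸ πw)⟩
    have hy' : y ≠ v ∧ y ≠ w := ⟨fun h => hy (h ▸ πv), fun h => hy (h ▸ πw)⟩
    rw [π1 x hx', π1 y hy']
    exact (A' _ _).2 (Or.inl hxy)
  have uniq0 : ∀ x y x2 y2, G.Adj x y → G.Adj x2 y2 → π x = π x2 → π y = π y2 → π x = U → π y ≠ U →
      x = x2 ∧ y = y2 := by
    intro x y x2 y2 h h2 e e2 hx hy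
    have : y = y2 := πinj _ _ e2 hy
    subst this
    refine ⟨?_, rfl⟩
    rcases outT x y h hx hy with ⟨rfl, k⟩ | ⟨rfl, k⟩ | ⟨rfl, k⟩ <;>
    rcases outT x2 y h2 (e ▸ hx) hy with ⟨rfl, k'⟩ | ⟨rfl, k'⟩ | ⟨rfl, k'⟩ <;>
      first
      | rfl
      | exact absurd (k.symm.trans k') ‹_›
      | exact absurd (k'.symm.trans k) ‹_›
  have uniq : ∀ x y x2 y2, G.Adj x y → G.Adj x2 y2 → π x = π x2 → π y = π y2 → π x ≠ π y →
      x = x2 ∧ y = y2 := by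
    intro x y x2 y2 h h2 e e2 hne
    by_cases hx : π x = U
    · exact uniq0 x y x2 y2 h h2 e e2 hx (fun h => hne (hx.trans h.symm))
    by_cases hy : π y = U
    · exact (uniq0 y x y2 x2 h.symm h2.symm e2 e hy hx).symm
    exact ⟨πinj _ _ e hx, πinj _ _ e2 hy⟩
  have lift0 : ∀ b, G'.Adj U b → ∃ x y, G.Adj x y ∧ π x = U ∧ π y = b := by
    intro b hb
    rcases (A' _ _).1 hb with h | ⟨-, h | h⟩ | ⟨-, h | h⟩
    · exact ⟨u, b.1, h, πu, πs b⟩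
    · exact ⟨v, b.1, h ▸ vv, πv, πs b⟩
    · exact ⟨w, b.1, h ▸ ww, πw, πs b⟩
    · exact absurd h m3.symm
    · exact absurd h m5.symm
  have lift : ∀ a b, G'.Adj a b → ∃ x y, G.Adj x y ∧ π x = a ∧ π y = b := by
    intro a b hab
    by_cases ha : a = U
    · subst ha; exact lift0 b hab
    by_cases hb : b = U
    · subst hb
      obtain ⟨x, y, h1, h2, h3⟩ := lift0 a hab.symm
      exact ⟨y, x, h1.symm, h3, h2⟩
    rcases (A' _ _).1 hab with h | ⟨h, -⟩ | ⟨h, -⟩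
    · exact ⟨a.1, b.1, h, πs a, πs b⟩
    · exact absurd (Subtype.ext h) ha
    · exact absurd (Subtype.ext h) hb
  have T' : Tran G' := by
    intro A hA hcl a
    have := ht (π ⁻¹' A) (by obtain ⟨b, hb⟩ := hA; exact ⟨b.1, by simpa [πs] using hb⟩) (by
      intro x hx y hxy
      by_cases h : π x = π y
      · show π y ∈ A; rw [← h]; exact hx
      · exact hcl _ hx _ (hom x y hxy h)) a.1
    simpa [πs] using this
  have N' : NoCut1 G' := by
    intro C a b hab ha hb
    obtain ⟨x, y, hxy, rfl, rfl⟩ := lift a b hab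
    obtain ⟨x2, y2, h1, h2, h3, h4⟩ := hn (π ⁻¹' C) x y hxy ha hb
    have hne : π x2 ≠ π y2 := fun h => h3 (by show π y2 ∈ C; rw [← h]; exact h2)
    refine ⟨π x2, π y2, hom _ _ h1 hne, h2, h3, ?_⟩
    rintro ⟨e1, e2⟩
    exact h4 (uniq x2 y2 x y h1 hxy e1 e2 hne)
  have C' : Cub G' := by
    apply cub_of
    intro a
    by_cases hau : a = U
    · subst hau
      refine ⟨⟨u', hu0'⟩, ⟨v', hv0'⟩, ⟨w', hw0'⟩, fun h => n1 (congrArg Subtype.val h),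
        fun h => n2 (congrArg Subtype.val h), fun h => n3 (congrArg Subtype.val h), ?_⟩
      intro y
      constructor
      · intro h
        rcases (A' _ _).1 h with h | ⟨-, h | h⟩ | ⟨-, h | h⟩
        · rcases Nu _ h with h | h | h
          · exact absurd h y.2.1
          · exact absurd h y.2.2
          · exact Or.inl (Subtype.ext h)
        · exact Or.inr (Or.inl (Subtype.ext h))
        · exact Or.inr (Or.inr (Subtype.ext h))
        · exact absurd h m3.symm
        · exact absurd h m5.symm
      · rintro (rfl | rfl | rfl) <;> apply hU' <;> simp
    have πa : π a.1 ≠ U := by rw [πs]; exact hau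
    obtain ⟨t, hat⟩ : ∃ t, G.Adj a.1 t := by
      have := hc a.1
      obtain ⟨t, b, c, -, -, -, h⟩ := Finset.card_eq_three.1 this
      have ht : t ∈ Finset.univ.filter (fun y => G.Adj a.1 y) := by rw [h]; simp
      exact ⟨t, by simpa using ht⟩
    obtain ⟨b, c, k1, k2, k3, k4⟩ := cub3 hc hat
    have hab : G.Adj a.1 b := (k4 b).2 (by simp)
    have hac : G.Adj a.1 c := (k4 c).2 (by simp)
    have key : ∀ y z, G.Adj a.1 y → G.Adj a.1 z → y ≠ z → π y ≠ π z := by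
      intro y z hy hz hyz h
      by_cases hU : π y = U
      · exact hyz (uniq0 y a.1 z a.1 hy.symm hz.symm h rfl hU πa).1
      · exact hyz (πinj _ _ h hU)
    have key2 : ∀ y, G.Adj a.1 y → G'.Adj a (π y) := by
      intro y hy
      have := hom a.1 y hy (fun h => hy.ne (πinj _ _ h πa))
      rwa [πs] at this
    refine ⟨π t, π b, π c, key _ _ hat hab k1, key _ _ hat hac k2, key _ _ hab hac k3, ?_⟩
    intro y
    constructor
    · intro h
      obtain ⟨x, z, hxz, hx, rfl⟩ := lift a y h
      have : a.1 = x := πinj _ _ ((πs a).trans hx.symm) πa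
      subst this
      rcases (k4 z).1 hxz with rfl | rfl | rfl <;> simp
    · rintro (rfl | rfl | rfl)
      · exact key2 _ hat
      · exact key2 _ hab
      · exact key2 _ hac
  obtain ⟨c', cs, cl, cp⟩ := ih C' T' N'
  let α := c' U ⟨u', hu0'⟩
  let β := c' U ⟨v', hv0'⟩
  let γ := c' U ⟨w', hw0'⟩
  have au := hU' u' hu0' (Or.inl rfl)
  have av := hU' v' hv0' (Or.inr (Or.inl rfl))
  have aw := hU' w' hw0' (Or.inr (Or.inr rfl))
  have okαβ : OKn α β := cp _ _ _ au av (fun h => n1 (congrArg Subtype.val h))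
  have okαγ : OKn α γ := cp _ _ _ au aw (fun h => n2 (congrArg Subtype.val h))
  have okβγ : OKn β γ := cp _ _ _ av aw (fun h => n3 (congrArg Subtype.val h))
  let c : V → V → ℕ := fun x y => if π x = U ∧ π y = U then
    (if x ≠ u ∧ y ≠ u then α else if x ≠ v ∧ y ≠ v then β else γ) else c' (π x) (π y)
  have c0 : ∀ x y, π x ≠ π y → c x y = c' (π x) (π y) := by
    intro x y h
    exact if_neg (fun h' => h (h'.1.trans h'.2.symm))
  have cuv : c u v = γ := by simp [c, πu, πv]
  have cvu : c v u = γ := by simp [c, πu, πv]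
  have cuw : c u w = β := by simp [c, πu, πw, uv.ne, vw.ne.symm]
  have cwu : c w u = β := by simp [c, πu, πw, uv.ne, vw.ne.symm]
  have cvw : c v w = α := by simp [c, πv, πw, uv.ne.symm, uw.ne.symm]
  have cwv : c w v = α := by simp [c, πv, πw, uv.ne.symm, uw.ne.symm]
  have nU : ∀ x (h : x ≠ v ∧ x ≠ w), x ≠ u → U ≠ π x := by
    intro x h hx h'
    rw [π1 x h] at h'
    exact hx (congrArg Subtype.val h').symm
  have cuu : c u u' = α := by
    rw [c0 _ _ (by rw [πu]; exact nU _ hu0' uu'ne), πu, π1 _ hu0']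
  have cvv : c v v' = β := by
    rw [c0 _ _ (by rw [πv]; exact nU _ hv0' m3), πv, π1 _ hv0']
  have cww : c w w' = γ := by
    rw [c0 _ _ (by rw [πw]; exact nU _ hw0' m5), πw, π1 _ hw0']
  have inner : ∀ x y, G.Adj x y → π x = π y → π x = U := by
    intro x y hxy h
    by_contra hU
    exact hxy.ne (πinj _ _ h hU)
  refine ⟨c, ?_, ?_, ?_⟩
  · intro x y hxy
    by_cases h : π x = π y
    · have hx := inner x y hxy h
      have hy : π y = U := h ▸ hx
      rcases πU x hx with rfl | rfl | rfl <;> rcases πU y hy with rfl | rfl | rfl <;>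
        first
        | rfl
        | (simp only [cuv, cvu, cuw, cwu, cvw, cwv])
    · rw [c0 _ _ h, c0 _ _ (Ne.symm h)]
      exact cs _ _ (hom _ _ hxy h)
  · intro x y hxy
    by_cases h : π x = π y
    · have hx := inner x y hxy h
      have hy : π y = U := h ▸ hx
      show (if _ then _ else _) < 11
      rw [if_pos ⟨hx, hy⟩]
      split_ifs
      · exact cl _ _ au
      · exact cl _ _ av
      · exact cl _ _ aw
    · rw [c0 _ _ h]
      exact cl _ _ (hom _ _ hxy h)
  · intro x y z hxy hxz hyz
    by_cases hx : π x = U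
    · rcases πU x hx with rfl | rfl | rfl
      · rcases Nu y hxy with rfl | rfl | rfl <;> rcases Nu z hxz with rfl | rfl | rfl <;>
          first
          | exact absurd rfl hyz
          | (simp only [cuv, cvu, cuw, cwu, cvw, cwv, cuu, cvv, cww]
             first | assumption | (apply OKn.symm; assumption))
      · rcases Nv y hxy with rfl | rfl | rfl <;> rcases Nv z hxz with rfl | rfl | rfl <;>
          first
          | exact absurd rfl hyz
          | (simp only [cuv, cvu, cuw, cwu, cvw, cwv, cuu, cvv, cww]
             first | assumption | (apply OKn.symm; assumption))
      · rcases Nw y hxy with rfl | rfl | rfl <;> rcases Nw z hxz with rfl | rfl | rfl <;>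
          first
          | exact absurd rfl hyz
          | (simp only [cuv, cvu, cuw, cwu, cvw, cwv, cuu, cvv, cww]
             first | assumption | (apply OKn.symm; assumption))
    · have e1 : π x ≠ π y := fun h => hx (inner x y hxy h)
      have e2 : π x ≠ π z := fun h => hx (inner x z hxz h)
      rw [c0 _ _ e1, c0 _ _ e2]
      refine cp _ _ _ (hom _ _ hxy e1) (hom _ _ hxz e2) ?_
      intro h
      exact hyz (uniq x y x z hxy hxz rfl h e1).2
end

universe uu

theorem main_ind : ∀ (n : ℕ) (V : Type uu) [Fintype V] [Nonempty V] (G : SimpleGraph V), Fintype.card V = n →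
    Cub G → Tran G → NoCut1 G → EC G := by
  intro n
  induction n using Nat.strong_induction_on with
  | _ n ih =>
    intro V _ _ G hV hc ht hn
    by_cases hI : ∃ u v w u' v' w', IsoTri G u v w u' v' w'
    · obtain ⟨u, v, w, u', v', w', I⟩ := hI
      apply contract_step hc ht hn I
      haveI : Nonempty {x : V // x ≠ v ∧ x ≠ w} := ⟨⟨u, I.uv.ne, I.uw.ne⟩⟩
      refine ih (Fintype.card {x : V // x ≠ v ∧ x ≠ w}) ?_ _ _ rfl
      rw [← hV]
      exact Fintype.card_subtype_lt (x := v) (by simp)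
    · exact base_case hc ht hn (fun u v w u' v' w' h => hI ⟨u, v, w, u', v', w', h⟩)

theorem tran_of {V : Type*} {G : SimpleGraph V} (h : G.Connected) : Tran G := by
  rintro A ⟨a, ha⟩ hcl v
  obtain ⟨p⟩ := h.preconnected a v
  induction p with
  | nil => exact ha
  | cons hadj p ihp => exact ihp (hcl _ ha _ hadj)

theorem nocut_of {V : Type*} {G : SimpleGraph V} (h : ∀ e, ¬ G.IsBridge e) : NoCut1 G := by
  intro C a b hab ha hb
  by_contra hcon
  push Not at hcon
  apply h s(a, b)
  rw [SimpleGraph.isBridge_iff]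
  rintro ⟨p⟩
  have key : ∀ x y (p : (G.deleteEdges {s(a, b)}).Walk x y), x ∈ C → y ∈ C := by
    intro x y p hx
    induction p with
    | nil => exact hx
    | @cons x z y hadj p ihp =>
      apply ihp
      by_contra hz
      rw [SimpleGraph.deleteEdges_adj] at hadj
      obtain ⟨rfl, rfl⟩ := hcon x z hadj.1 hx hz
      exact hadj.2 rfl
  exact hb (key _ _ p ha)

end CSys

/-- Every finite 2-edge-connected cubic simple graph has circular chromatic index at most
`11/3`: its line graph admits an `(11,3)`-coloring. -/
theorem circular_chromatic_index_le_eleven_thirds_of_cubic_twoEdgeConnected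
    {V : Type*} [Fintype V] [DecidableEq V] (G : SimpleGraph V) [DecidableRel G.Adj]
    (h2ec : TwoEdgeConnected G)
    (hcubic : ∀ v, G.degree v = 3) :
    ∃ f, IsPQColoring G.lineGraph 11 3 f := by
  obtain ⟨hconn, -, hbr⟩ := h2ec
  haveI := hconn.nonempty
  obtain ⟨c, cs, cl, cp⟩ := CSys.main_ind _ V G rfl (fun v => by
    rw [← hcubic v, ← SimpleGraph.card_neighborFinset_eq_degree]
    congr 1
    ext y
    simp) (CSys.tran_of hconn) (CSys.nocut_of hbr)
  have key : ∀ e : G.edgeSet, ∃ n : ℕ, ∀ x y, G.Adj x y → (e : Sym2 V) = s(x, y) → n = c x y := by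
    rintro ⟨e, he⟩
    induction e with
    | _ a b =>
      refine ⟨c a b, ?_⟩
      intro x y hxy h
      rcases Sym2.eq_iff.1 h with ⟨rfl, rfl⟩ | ⟨rfl, rfl⟩
      · rfl
      · exact cs _ _ he
  choose f hf using key
  have rep : ∀ (e : G.edgeSet) (v : V), v ∈ (e : Sym2 V) → ∃ y, G.Adj v y ∧ (e : Sym2 V) = s(v, y) := by
    rintro ⟨e, he⟩ v hv
    obtain ⟨y, rfl⟩ := hv
    exact ⟨y, he, rfl⟩
  refine ⟨f, ?_, ?_⟩
  · intro e
    obtain ⟨x, hx⟩ : ∃ x, x ∈ (e : Sym2 V) := ⟨_, Sym2.out_fst_mem _⟩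
    obtain ⟨y, hy, he⟩ := rep e x hx
    rw [hf e x y hy he]
    exact cl _ _ hy
  · intro e1 e2 h
    rw [SimpleGraph.lineGraph_adj_iff_exists] at h
    obtain ⟨hne, v, h1, h2⟩ := h
    obtain ⟨y, hy, k1⟩ := rep e1 v h1
    obtain ⟨z, hz, k2⟩ := rep e2 v h2
    rw [hf e1 v y hy k1, hf e2 v z hz k2]
    have := cp v y z hy hz (by
      rintro rfl
      exact hne (Subtype.ext (k1.trans k2.symm)))
    unfold CSys.OKn at this
    refine ⟨by exact_mod_cast this.1, ?_⟩
    have h8 := this.2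
    push_cast
    linarith
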